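/- arXiv:2008.04177 — 3 statements merged into one kernel-verified Lean document; each statement's English description precedes it below -/
import Mathlib

section
/- Let q ∈ (0,1) and r > 0. Then G^∧(x; r) ~ c(r)·(x − √q)² as x → √q from the right; precisely, lim_{x→√q⁺} G^∧(x;r)/(x − √q)² = c(r), where c(r) := 8 q₀⁴ r³ θ(−qr)⁶ / (q² θ(q)² θ(−r)⁶) > 0. (Short-distance repulsion of the zero point process with power-law index β = 2.) -/
open Complex

/-- Theta function with nome `p = q²` (real argument). -/
noncomputable def thetaR (q : ℝ) (x : ℝ) : ℝ :=
  (∏' i : ℕ, (1 - x * q ^ (2 * i))) * ∏' i : ℕ, (1 - q ^ (2 * (i + 1)) / x)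

/-- `q₀ = ∏_{n=1}^∞ (1 - q^{2n})`. -/
noncomputable def q0 (q : ℝ) : ℝ := ∏' n : ℕ, (1 - q ^ (2 * (n + 1)))

/-- The short-distance unfolded 2-correlation function
`G^∧(x;r) = g(q/x, x; r)`. -/
noncomputable def Gwedge (q r x : ℝ) : ℝ :=
  (r ^ 2 * thetaR q (q * x ^ 2) ^ 2 * thetaR q (-r * x ^ 2) ^ 3 *
      thetaR q (-r⁻¹ * x ^ 2) ^ 3) /
    (x ^ 2 * thetaR q q ^ 2 * thetaR q (-r) ^ 4 * thetaR q (-r * x ^ 4) *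
      thetaR q (-r⁻¹ * x ^ 4)) *
  (1 + thetaR q (-r * q) ^ 2 * thetaR q (x ^ 2) ^ 2 /
      (thetaR q q ^ 2 * thetaR q (-r * x ^ 2) * thetaR q (-r⁻¹ * x ^ 2)))

/-- The coefficient `c(r) = 8 q₀⁴ r³ θ(-qr)⁶/(q² θ(q)² θ(-r)⁶)`. -/
noncomputable def cWedge (q r : ℝ) : ℝ :=
  8 * q0 q ^ 4 * r ^ 3 * thetaR q (-(q * r)) ^ 6 /
    (q ^ 2 * thetaR q q ^ 2 * thetaR q (-r) ^ 6)

/-- The `q²`-shifted factorial `(z; q²)_∞ = ∏_{i ≥ 0} (1 - z q^{2i})`. -/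
noncomputable def infProd (q z : ℝ) : ℝ := ∏' i : ℕ, (1 - z * q ^ (2 * i))

section infProd

variable {q : ℝ}

lemma summable_pow_two_mul (hq : q ∈ Set.Ioo (0 : ℝ) 1) : Summable fun i : ℕ => q ^ (2 * i) := by
  simp only [pow_mul]
  exact summable_geometric_of_lt_one (sq_nonneg q) (pow_lt_one₀ hq.1.le hq.2 two_ne_zero)

lemma multipliable_infProd (hq : q ∈ Set.Ioo (0 : ℝ) 1) (z : ℝ) :
    Multipliable fun i : ℕ => 1 - z * q ^ (2 * i) := by
  simpa only [sub_eq_add_neg] using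
    Real.multipliable_one_add_of_summable ((summable_pow_two_mul hq).mul_left z).neg

lemma infProd_eq_mul (hq : q ∈ Set.Ioo (0 : ℝ) 1) (z : ℝ) :
    infProd q z = (1 - z) * infProd q (q ^ 2 * z) := by
  have hshift : ∀ i : ℕ, 1 - z * q ^ (2 * (i + 1)) = 1 - q ^ 2 * z * q ^ (2 * i) :=
    fun i => by ring
  have hm : Multipliable fun i : ℕ => 1 - z * q ^ (2 * (i + 1)) := by
    simpa only [hshift] using multipliable_infProd hq (q ^ 2 * z)
  have hsplit := tprod_eq_zero_mul' (f := fun i : ℕ => 1 - z * q ^ (2 * i)) hm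
  simp only [hshift, mul_zero, pow_zero, mul_one] at hsplit
  exact hsplit

lemma infProd_ne_zero (hq : q ∈ Set.Ioo (0 : ℝ) 1) {z : ℝ} (hz : z < 1) : infProd q z ≠ 0 := by
  have key := tprod_one_add_ne_zero_of_summable (f := fun i : ℕ => -(z * q ^ (2 * i)))
    (fun i => ?_) ((summable_pow_two_mul hq).mul_left z).neg.norm
  · simpa only [infProd, sub_eq_add_neg] using key
  · have h0 : 0 < q ^ (2 * i) := pow_pos hq.1 _
    have h1 : q ^ (2 * i) ≤ 1 := pow_le_one₀ hq.1.le hq.2.le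
    have : 0 < 1 + -(z * q ^ (2 * i)) := by nlinarith
    exact this.ne'

lemma continuous_infProd (hq : q ∈ Set.Ioo (0 : ℝ) 1) : Continuous (infProd q) := by
  rw [continuous_iff_continuousAt]
  intro z
  have hopen : IsOpen (Metric.ball (0 : ℝ) (|z| + 1)) := Metric.isOpen_ball
  have hz : z ∈ Metric.ball (0 : ℝ) (|z| + 1) := by simp
  have hprod := Summable.hasProdLocallyUniformlyOn_nat_one_add
    (f := fun (i : ℕ) (y : ℝ) => -(y * q ^ (2 * i))) hopen
    ((summable_pow_two_mul hq).mul_left (|z| + 1))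
    (Filter.Eventually.of_forall fun i y hy => ?_)
    (fun i => by fun_prop)
  · have hcont := hprod.tendstoLocallyUniformlyOn_finsetRange.continuousOn
      (Filter.Frequently.of_forall fun n => by fun_prop)
    simp only [← sub_eq_add_neg] at hcont
    exact hcont.continuousAt (hopen.mem_nhds hz)
  · have hpow : 0 ≤ q ^ (2 * i) := pow_nonneg hq.1.le _
    rw [norm_neg, norm_mul, Real.norm_of_nonneg hpow]
    rw [Metric.mem_ball, dist_zero_right] at hy
    exact mul_le_mul_of_nonneg_right hy.le hpow

lemma q0_eq_infProd : q0 q = infProd q (q ^ 2) := by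
  unfold q0 infProd
  congr 1
  ext i
  ring

end infProd

section thetaR

variable {q : ℝ}

lemma thetaR_eq_infProd_mul (x : ℝ) : thetaR q x = infProd q x * infProd q (q ^ 2 / x) := by
  unfold thetaR infProd
  congr 2
  ext i
  ring

lemma thetaR_sq_div (hq : q ≠ 0) (x : ℝ) : thetaR q (q ^ 2 / x) = thetaR q x := by
  rw [thetaR_eq_infProd_mul, thetaR_eq_infProd_mul, div_div_cancel₀ (pow_ne_zero 2 hq), mul_comm]

lemma thetaR_sq_mul (hq : q ∈ Set.Ioo (0 : ℝ) 1) {x : ℝ} (hx : x ≠ 0) (hx1 : x ≠ 1) :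
    thetaR q (q ^ 2 * x) = -thetaR q x / x := by
  have hq0 : q ≠ 0 := hq.1.ne'
  have h1 : 1 - x ≠ 0 := sub_ne_zero.mpr hx1.symm
  have hinv : q ^ 2 / (q ^ 2 * x) = x⁻¹ := by field_simp
  rw [thetaR_eq_infProd_mul, thetaR_eq_infProd_mul, hinv, infProd_eq_mul hq x⁻¹,
    infProd_eq_mul hq x, ← div_eq_mul_inv]
  field_simp
  ring

lemma thetaR_ne_zero_of_neg (hq : q ∈ Set.Ioo (0 : ℝ) 1) {x : ℝ} (hx : x < 0) :
    thetaR q x ≠ 0 := by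
  rw [thetaR_eq_infProd_mul]
  refine mul_ne_zero (infProd_ne_zero hq (hx.trans one_pos)) (infProd_ne_zero hq ?_)
  exact (div_neg_of_pos_of_neg (pow_pos hq.1 2) hx).trans one_pos

lemma thetaR_self_ne_zero (hq : q ∈ Set.Ioo (0 : ℝ) 1) : thetaR q q ≠ 0 := by
  have hdiv : q ^ 2 / q = q := by rw [sq, mul_div_cancel_left₀ _ hq.1.ne']
  rw [thetaR_eq_infProd_mul, hdiv]
  exact mul_ne_zero (infProd_ne_zero hq hq.2) (infProd_ne_zero hq hq.2)

lemma ContinuousAt.thetaR (hq : q ∈ Set.Ioo (0 : ℝ) 1) {f : ℝ → ℝ} {a : ℝ}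
    (hf : ContinuousAt f a) (ha : f a ≠ 0) : ContinuousAt (fun x => thetaR q (f x)) a := by
  simp only [thetaR_eq_infProd_mul]
  exact ((continuous_infProd hq).continuousAt.comp hf).mul
    ((continuous_infProd hq).continuousAt.comp (continuousAt_const.div hf ha))

lemma thetaR_mul_sq_eq (hq : q ∈ Set.Ioo (0 : ℝ) 1) {x : ℝ} (hx : x ≠ 0) :
    thetaR q (q * x ^ 2) =
      (x - √q) * ((x + √q) / x ^ 2 *
        (infProd q (q * x ^ 2) * infProd q (q ^ 2 * (q / x ^ 2)))) := by
  have hq0 : q ≠ 0 := hq.1.ne'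
  have hdiv : q ^ 2 / (q * x ^ 2) = q / x ^ 2 := by field_simp
  have hfac : 1 - q / x ^ 2 = (x - √q) * ((x + √q) / x ^ 2) := by
    field_simp
    nlinarith [Real.sq_sqrt hq.1.le]
  rw [thetaR_eq_infProd_mul, hdiv, infProd_eq_mul hq (q / x ^ 2), hfac]
  ring

end thetaR

lemma cWedge_pos {q r : ℝ} (hq : q ∈ Set.Ioo (0 : ℝ) 1) (hr : 0 < r) : 0 < cWedge q r := by
  have hq0 : 0 < q := hq.1
  have h0 : q0 q ≠ 0 := by
    rw [q0_eq_infProd]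
    exact infProd_ne_zero hq (pow_lt_one₀ hq.1.le hq.2 two_ne_zero)
  have h1 := thetaR_self_ne_zero hq
  have h2 : thetaR q (-r) ≠ 0 := thetaR_ne_zero_of_neg hq (neg_neg_of_pos hr)
  have h3 : thetaR q (-(q * r)) ≠ 0 :=
    thetaR_ne_zero_of_neg hq (neg_neg_of_pos (mul_pos hq0 hr))
  have := (show Even 4 by decide).pow_pos h0
  have := (show Even 6 by decide).pow_pos h2
  have := (show Even 6 by decide).pow_pos h3
  unfold cWedge
  positivity

/-- Short-distance repulsion with power-law index `β = 2`:
`G^∧(x;r) ~ c(r)(x - √q)²` as `x → √q⁺`, with `c(r) > 0`. -/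
theorem short_distance_repulsion (q r : ℝ) (hq : q ∈ Set.Ioo (0 : ℝ) 1) (hr : 0 < r) :
    0 < cWedge q r ∧
    Filter.Tendsto (fun x : ℝ => Gwedge q r x / (x - Real.sqrt q) ^ 2)
      (nhdsWithin (Real.sqrt q) (Set.Ioi (Real.sqrt q))) (nhds (cWedge q r)) := by
  refine ⟨cWedge_pos hq hr, ?_⟩
  have hq0 : 0 < q := hq.1
  have hs : 0 < √q := Real.sqrt_pos.mpr hq0
  have hs2 : √q ^ 2 = q := Real.sq_sqrt hq0.le
  have hs4 : √q ^ 4 = q ^ 2 := by rw [show √q ^ 4 = (√q ^ 2) ^ 2 by ring, hs2]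
  have hT : thetaR q (-r * q) = thetaR q (-(q * r)) := by congr 1; ring
  have hTinv : thetaR q (-r⁻¹ * q) = thetaR q (-(q * r)) := by
    rw [← thetaR_sq_div hq0.ne' (-(q * r))]
    congr 1
    field_simp
  have hA : thetaR q (-r * q ^ 2) = thetaR q (-r) / r := by
    rw [mul_comm, thetaR_sq_mul hq (by linarith) (by linarith), neg_div_neg_eq]
  have hAinv : thetaR q (-r⁻¹ * q ^ 2) = thetaR q (-r) := by
    rw [← thetaR_sq_div hq0.ne' (-r)]
    congr 1
    field_simp
  have hQ : thetaR q q ≠ 0 := thetaR_self_ne_zero hq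
  have hA0 : thetaR q (-r) ≠ 0 := thetaR_ne_zero_of_neg hq (neg_neg_of_pos hr)
  have hT0 : thetaR q (-(q * r)) ≠ 0 :=
    thetaR_ne_zero_of_neg hq (neg_neg_of_pos (mul_pos hq0 hr))
  let H : ℝ → ℝ := fun x =>
    (r ^ 2 * ((x + √q) / x ^ 2 *
          (infProd q (q * x ^ 2) * infProd q (q ^ 2 * (q / x ^ 2)))) ^ 2 *
        thetaR q (-r * x ^ 2) ^ 3 * thetaR q (-r⁻¹ * x ^ 2) ^ 3) /
      (x ^ 2 * thetaR q q ^ 2 * thetaR q (-r) ^ 4 * thetaR q (-r * x ^ 4) *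
        thetaR q (-r⁻¹ * x ^ 4)) *
    (1 + thetaR q (-r * q) ^ 2 * thetaR q (x ^ 2) ^ 2 /
        (thetaR q q ^ 2 * thetaR q (-r * x ^ 2) * thetaR q (-r⁻¹ * x ^ 2)))
  have hH : ContinuousAt H √q := by
    have hF := continuous_infProd hq
    have hdiv : ContinuousAt (fun x : ℝ => infProd q (q ^ 2 * (q / x ^ 2))) √q :=
      hF.continuousAt.comp (by fun_prop (disch := positivity))
    have hθ {c : ℝ} (hc : c ≠ 0) (n : ℕ) : ContinuousAt (fun x : ℝ => thetaR q (c * x ^ n)) √q :=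
      ContinuousAt.thetaR hq (by fun_prop) (mul_ne_zero hc (pow_ne_zero n hs.ne'))
    have hr1 : -r ≠ 0 := neg_ne_zero.mpr hr.ne'
    have hr2 : -r⁻¹ ≠ 0 := neg_ne_zero.mpr (inv_ne_zero hr.ne')
    have h1 := hθ hr1 2
    have h2 := hθ hr2 2
    have h3 := hθ hr1 4
    have h4 := hθ hr2 4
    have h5 : ContinuousAt (fun x : ℝ => thetaR q (x ^ 2)) √q := by
      simpa only [one_mul] using hθ one_ne_zero 2
    refine ContinuousAt.mul (ContinuousAt.div (by fun_prop (disch := positivity))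
      (by fun_prop) ?_) (continuousAt_const.add (ContinuousAt.div (by fun_prop) (by fun_prop) ?_))
    · rw [hs4, hs2, hA, hAinv]
      positivity
    · rw [hs2, hT, hTinv]
      positivity
  have hval : H √q = cWedge q r := by
    have hqq : q * q = q ^ 2 := (sq q).symm
    simp only [H, cWedge, hs2, hs4, hT, hTinv, hA, hAinv, div_self hq0.ne', mul_one, hqq,
      ← q0_eq_infProd]
    have h2s : ((√q + √q) / q * (q0 q * q0 q)) ^ 2 = 4 / q * q0 q ^ 4 := by
      have : ((√q + √q) / q * (q0 q * q0 q)) ^ 2 = 4 * √q ^ 2 / q ^ 2 * q0 q ^ 4 := by ring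
      rw [this, hs2]
      field_simp
    rw [h2s]
    generalize thetaR q (-(q * r)) = T at hT0 ⊢
    field_simp
    ring
  rw [← hval]
  refine (hH.tendsto.mono_left nhdsWithin_le_nhds).congr' ?_
  filter_upwards [self_mem_nhdsWithin] with x hx
  have hx0 : x ≠ 0 := (hs.trans hx).ne'
  have hxs : x - √q ≠ 0 := (sub_pos.mpr hx).ne'
  rw [eq_div_iff (pow_ne_zero 2 hxs)]
  simp only [H, Gwedge, thetaR_mul_sq_eq hq hx0]
  ring
end

section
/- Fix q ∈ (0,1) and r > 0, and regard G̃ as a function of the real variable c on a neighborhood of c = 1 inside (q², q⁻²). Then G̃ is smooth near c = 1, G̃(1) = 1, its first three derivatives vanish at c = 1: G̃'(1) = G̃''(1) = G̃'''(1) = 0, and its fourth derivative is G̃⁗(1) = 12·(10 W_q(−r)² + 4 e₁ W_q(−r) − 2 e₁² − g₂). -/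
/-- `W_q(z)`: the Weierstrass ℘-function with periods `2π` and `-2i log q`,
evaluated at `-i log z`, as an explicit series. -/
noncomputable def W (q z : ℝ) : ℝ :=
  -1 / 12 - z / (1 - z) ^ 2 + 2 * ∑' n : ℕ, q ^ (2 * (n + 1)) / (1 - q ^ (2 * (n + 1))) ^ 2
    - ∑' n : ℕ, z * q ^ (2 * (n + 1)) / (1 - z * q ^ (2 * (n + 1))) ^ 2
    - ∑' n : ℕ, (q ^ (2 * (n + 1)) / z) / (1 - q ^ (2 * (n + 1)) / z) ^ 2

noncomputable def e1 (q : ℝ) : ℝ := W q (-1)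
noncomputable def e2 (q : ℝ) : ℝ := W q (-q)
noncomputable def e3 (q : ℝ) : ℝ := W q q
noncomputable def g2 (q : ℝ) : ℝ := 2 * (e1 q ^ 2 + e2 q ^ 2 + e3 q ^ 2)

/-- `G̃(c)`, the long-distance unfolded 2-correlation as a function of `c = x²`. -/
noncomputable def Gt (q r c : ℝ) : ℝ :=
  c * thetaR q (-r * c) ^ 4 * thetaR q (-1) ^ 2 * thetaR q (-r * c ^ 3) ^ 2 /
      (thetaR q (-r) * thetaR q (-c) ^ 2 * thetaR q (-r * c ^ 2) ^ 5) *
    (1 + thetaR q c ^ 2 * thetaR q (r * c ^ 3) ^ 2 /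
        (thetaR q (-c) ^ 2 * thetaR q (-r * c ^ 3) ^ 2))

namespace ThetaW

open Filter Topology Asymptotics

/-- If `h' = O(tⁿ)` near `0`, then `h - h 0 = O(tⁿ⁺¹)`. -/
lemma isBigO_sub_of_deriv {𝕜 : Type*} [RCLike 𝕜] {h h' : 𝕜 → 𝕜} {n : ℕ}
    (hd : ∀ᶠ t in 𝓝 0, HasDerivAt h (h' t) t) (hO : h' =O[𝓝 0] fun t => t ^ n) :
    (fun t => h t - h 0) =O[𝓝 0] fun t => t ^ (n + 1) := by
  obtain ⟨C, hC⟩ := hO.bound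
  obtain ⟨ε, hε, hball⟩ := Metric.eventually_nhds_iff_ball.1 (hd.and hC)
  refine IsBigO.of_bound |C| ?_
  filter_upwards [Metric.ball_mem_nhds (0 : 𝕜) hε] with t ht
  have hsub : ∀ x ∈ Metric.closedBall (0 : 𝕜) ‖t‖, x ∈ Metric.ball (0 : 𝕜) ε := fun x hx => by
    simp only [Metric.mem_closedBall, Metric.mem_ball, dist_zero_right] at hx ht ⊢
    exact hx.trans_lt ht
  have := Convex.norm_image_sub_le_of_norm_hasDerivWithin_le (f := h) (f' := h')
    (s := Metric.closedBall (0 : 𝕜) ‖t‖) (C := |C| * ‖t‖ ^ n) (x := 0) (y := t)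
    (fun x hx => (hball x (hsub x hx)).1.hasDerivWithinAt)
    (fun x hx => by
      refine (hball x (hsub x hx)).2.trans ?_
      rw [norm_pow]
      have hx' : ‖x‖ ≤ ‖t‖ := by simpa using hx
      gcongr
      exact le_abs_self C)
    (convex_closedBall _ _) (by simp) (by simp)
  rw [norm_pow, pow_succ]
  simpa [mul_assoc] using this

/-- Fourth order Taylor expansion at `0` along an explicit chain of derivatives. -/
lemma taylor_four {𝕜 : Type*} [RCLike 𝕜] {h₀ h₁ h₂ h₃ h₄ : 𝕜 → 𝕜}
    (d₀ : ∀ᶠ t in 𝓝 0, HasDerivAt h₀ (h₁ t) t) (d₁ : ∀ᶠ t in 𝓝 0, HasDerivAt h₁ (h₂ t) t)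
    (d₂ : ∀ᶠ t in 𝓝 0, HasDerivAt h₂ (h₃ t) t) (d₃ : ∀ᶠ t in 𝓝 0, HasDerivAt h₃ (h₄ t) t)
    (d₄ : DifferentiableAt 𝕜 h₄ 0) :
    (fun t => h₀ t - (h₀ 0 + h₁ 0 * t + h₂ 0 / 2 * t ^ 2 + h₃ 0 / 6 * t ^ 3 + h₄ 0 / 24 * t ^ 4))
      =O[𝓝 0] fun t => t ^ 5 := by
  have e₄ : (fun t => h₄ t - h₄ 0) =O[𝓝 0] fun t => t ^ 1 := by
    simpa using d₄.isBigO_sub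
  have e₃ := isBigO_sub_of_deriv (h := fun t => h₃ t - h₄ 0 * t) (h' := fun t => h₄ t - h₄ 0)
    (d₃.mono fun t ht => (ht.sub ((hasDerivAt_id t).const_mul (h₄ 0))).congr_deriv (by simp)) e₄
  have e₂ := isBigO_sub_of_deriv (h := fun t => h₂ t - h₃ 0 * t - h₄ 0 / 2 * t ^ 2)
    (h' := fun t => h₃ t - h₃ 0 - h₄ 0 * t)
    (d₂.mono fun t ht => by
      refine ((ht.sub ((hasDerivAt_id t).const_mul (h₃ 0))).sub
        ((hasDerivAt_pow 2 t).const_mul (h₄ 0 / 2))).congr_deriv ?_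
      push_cast
      ring)
    (e₃.congr_left fun t => by ring)
  have e₁ := isBigO_sub_of_deriv
    (h := fun t => h₁ t - h₂ 0 * t - h₃ 0 / 2 * t ^ 2 - h₄ 0 / 6 * t ^ 3)
    (h' := fun t => h₂ t - h₂ 0 - h₃ 0 * t - h₄ 0 / 2 * t ^ 2)
    (d₁.mono fun t ht => by
      refine (((ht.sub ((hasDerivAt_id t).const_mul (h₂ 0))).sub
        ((hasDerivAt_pow 2 t).const_mul (h₃ 0 / 2))).sub
        ((hasDerivAt_pow 3 t).const_mul (h₄ 0 / 6))).congr_deriv ?_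
      push_cast
      ring)
    (e₂.congr_left fun t => by ring)
  have e₀ := isBigO_sub_of_deriv
    (h := fun t => h₀ t - h₁ 0 * t - h₂ 0 / 2 * t ^ 2 - h₃ 0 / 6 * t ^ 3 - h₄ 0 / 24 * t ^ 4)
    (h' := fun t => h₁ t - h₁ 0 - h₂ 0 * t - h₃ 0 / 2 * t ^ 2 - h₄ 0 / 6 * t ^ 3)
    (d₀.mono fun t ht => by
      refine ((((ht.sub ((hasDerivAt_id t).const_mul (h₁ 0))).sub
        ((hasDerivAt_pow 2 t).const_mul (h₂ 0 / 2))).sub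
        ((hasDerivAt_pow 3 t).const_mul (h₃ 0 / 6))).sub
        ((hasDerivAt_pow 4 t).const_mul (h₄ 0 / 24))).congr_deriv ?_
      push_cast
      ring)
    (e₁.congr_left fun t => by ring)
  exact e₀.congr_left fun t => by ring

/-- A polynomial of degree at most four that is `O(t⁵)` at `0` vanishes. -/
lemma coeff_eq_zero_of_isBigO {b₀ b₁ b₂ b₃ b₄ : ℝ}
    (h : (fun t : ℝ => b₀ + b₁ * t + b₂ * t ^ 2 + b₃ * t ^ 3 + b₄ * t ^ 4) =O[𝓝[≠] 0]
      fun t => t ^ 5) : b₀ = 0 ∧ b₁ = 0 ∧ b₂ = 0 ∧ b₃ = 0 ∧ b₄ = 0 := by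
  have key : ∀ (f : ℝ → ℝ) (n : ℕ), Continuous f → f =O[𝓝[≠] 0] (fun t => t ^ (n + 1)) → f 0 = 0 := by
    intro f n hf hO
    have h1 : Tendsto f (𝓝[≠] 0) (𝓝 (f 0)) := hf.continuousAt.tendsto.mono_left nhdsWithin_le_nhds
    have h2 : Tendsto f (𝓝[≠] 0) (𝓝 0) := by
      refine hO.trans_tendsto ?_
      have : Tendsto (fun t : ℝ => t ^ (n + 1)) (𝓝 0) (𝓝 (0 ^ (n + 1))) :=
        (continuous_pow (n + 1)).continuousAt.tendsto
      rw [zero_pow n.succ_ne_zero] at this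
      exact this.mono_left nhdsWithin_le_nhds
    exact tendsto_nhds_unique h1 h2
  have down : ∀ (f : ℝ → ℝ) (n : ℕ), (fun t => t * f t) =O[𝓝[≠] 0] (fun t : ℝ => t ^ (n + 1)) →
      f =O[𝓝[≠] 0] (fun t : ℝ => t ^ n) := by
    intro f n hO
    have := hO.mul (isBigO_refl (fun t : ℝ => t⁻¹) (𝓝[≠] 0))
    refine this.congr' ?_ ?_
    · filter_upwards [self_mem_nhdsWithin] with t ht
      have : t ≠ 0 := ht
      field_simp
    · filter_upwards [self_mem_nhdsWithin] with t ht
      have : t ≠ 0 := ht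
      field_simp
      ring
  have z₀ : b₀ = 0 := by simpa using key _ 4 (by fun_prop) h
  subst z₀
  have h := down (fun t => b₁ + b₂ * t + b₃ * t ^ 2 + b₄ * t ^ 3) 4 (h.congr_left fun t => by ring)
  have z₁ : b₁ = 0 := by simpa using key _ 3 (by fun_prop) h
  subst z₁
  have h := down (fun t => b₂ + b₃ * t + b₄ * t ^ 2) 3 (h.congr_left fun t => by ring)
  have z₂ : b₂ = 0 := by simpa using key _ 2 (by fun_prop) h
  subst z₂
  have h := down (fun t => b₃ + b₄ * t) 2 (h.congr_left fun t => by ring)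
  have z₃ : b₃ = 0 := by simpa using key _ 1 (by fun_prop) h
  subst z₃
  have h := down (fun t => b₄) 1 (h.congr_left fun t => by ring)
  have z₄ : b₄ = 0 := by simpa using key _ 0 (by fun_prop) h
  simp [z₄]

/-- The summand `z / (1 - z)²` of the Weierstrass series. -/
noncomputable def phi (z : ℂ) : ℂ := z / (1 - z) ^ 2

/-- The one-sided Lambert-type series `∑_{n ≥ 1} phi (z pⁿ)`. -/
noncomputable def lam (p : ℝ) (z : ℂ) : ℂ := ∑' n : ℕ, phi (z * p ^ (n + 1))

/-- The one-sided product `∏_{n ≥ 1} (1 - z pⁿ)`. -/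
noncomputable def qp (p : ℝ) (z : ℂ) : ℂ := ∏' n : ℕ, (1 - z * p ^ (n + 1))

/-- The theta function in the logarithmic coordinate `z = exp t`. -/
noncomputable def vt (p : ℝ) (t : ℂ) : ℂ :=
  (1 - Complex.exp t) * (qp p (Complex.exp t) * qp p (Complex.exp (-t)))

/-- The Weierstrass function in the logarithmic coordinate `z = exp t`. -/
noncomputable def wp (p : ℝ) (t : ℂ) : ℂ :=
  -1 / 12 + 2 * lam p 1 - phi (Complex.exp t) - lam p (Complex.exp t) - lam p (Complex.exp (-t))

lemma phi_inv (z : ℂ) : phi z⁻¹ = phi z := by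
  unfold phi
  rcases eq_or_ne z 0 with rfl | hz
  · simp
  rcases eq_or_ne z 1 with rfl | h1
  · simp
  have : 1 - z ≠ 0 := sub_ne_zero.2 h1.symm
  have h2 : 1 - z⁻¹ ≠ 0 := sub_ne_zero.2 (fun h => h1 (inv_eq_one.1 h.symm))
  have h3 : z - 1 ≠ 0 := sub_ne_zero.2 h1
  rw [show 1 - z⁻¹ = (z - 1) / z by field_simp]
  field_simp
  ring

lemma norm_phi_le {z : ℂ} (hz : ‖z‖ ≤ 1 / 2) : ‖phi z‖ ≤ 4 * ‖z‖ := by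
  have h : (1 / 2 : ℝ) ≤ ‖1 - z‖ := by
    have := norm_sub_norm_le (1 : ℂ) z
    simp only [norm_one] at this
    linarith
  unfold phi
  rw [norm_div, norm_pow, div_le_iff₀ (by positivity)]
  nlinarith [norm_nonneg z, mul_nonneg (norm_nonneg z) (by nlinarith : 0 ≤ 4 * ‖1 - z‖ ^ 2 - 1)]

section

variable {p : ℝ}

lemma norm_mul_pow (hp : 0 < p) (z : ℂ) (n : ℕ) : ‖z * (p : ℂ) ^ n‖ = ‖z‖ * p ^ n := by
  simp [abs_of_pos hp]

lemma exists_tail_le (hp : 0 < p) (hp1 : p < 1) (R : ℝ) :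
    ∃ N : ℕ, ∀ z : ℂ, ‖z‖ ≤ R → ∀ n : ℕ, ‖z * (p : ℂ) ^ (n + N + 1)‖ ≤ 1 / 2 := by
  have h : Tendsto (fun n : ℕ => R * p ^ n) atTop (𝓝 (R * 0)) :=
    (tendsto_pow_atTop_nhds_zero_of_lt_one hp.le hp1).const_mul R
  rw [mul_zero] at h
  obtain ⟨N, hN⟩ := eventually_atTop.1 (h.eventually_le_const (by norm_num : (0 : ℝ) < 1 / 2))
  refine ⟨N, fun z hz n => ?_⟩
  rw [norm_mul_pow hp]
  exact (mul_le_mul_of_nonneg_right hz (by positivity)).trans (hN _ (by omega))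

lemma summable_geom (hp : 0 < p) (hp1 : p < 1) (C : ℝ) (N : ℕ) :
    Summable fun n : ℕ => C * p ^ (n + N) :=
  ((summable_nat_add_iff N).2 (summable_geometric_of_lt_one hp.le hp1)).mul_left C

lemma norm_phi_tail_le (hp : 0 < p) {R : ℝ} {N : ℕ}
    (hN : ∀ z : ℂ, ‖z‖ ≤ R → ∀ n : ℕ, ‖z * (p : ℂ) ^ (n + N + 1)‖ ≤ 1 / 2) {z : ℂ} (hz : ‖z‖ ≤ R)
    (n : ℕ) : ‖phi (z * (p : ℂ) ^ (n + N + 1))‖ ≤ 4 * R * p ^ (n + (N + 1)) := by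
  refine (norm_phi_le (hN z hz n)).trans ?_
  rw [norm_mul_pow hp, mul_assoc, add_assoc]
  gcongr

lemma summable_lam (hp : 0 < p) (hp1 : p < 1) (z : ℂ) :
    Summable fun n : ℕ => phi (z * (p : ℂ) ^ (n + 1)) := by
  obtain ⟨N, hN⟩ := exists_tail_le hp hp1 ‖z‖
  rw [← summable_nat_add_iff N]
  exact (summable_geom hp hp1 (4 * ‖z‖) (N + 1)).of_norm_bounded
    (fun n => norm_phi_tail_le hp hN le_rfl n)

lemma lam_mul (hp : 0 < p) (hp1 : p < 1) (z : ℂ) : lam p z = phi (z * p) + lam p (z * p) := by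
  unfold lam
  rw [(summable_lam hp hp1 z).tsum_eq_zero_add]
  simp [pow_succ', mul_assoc]

lemma differentiableAt_phi {z : ℂ} (hz : z ≠ 1) : DifferentiableAt ℂ phi z := by
  unfold phi
  have : (1 - z) ^ 2 ≠ 0 := pow_ne_zero _ (sub_ne_zero.2 hz.symm)
  fun_prop (disch := assumption)

lemma differentiableAt_lam (hp : 0 < p) (hp1 : p < 1) {z : ℂ}
    (hz : ∀ n : ℕ, z * (p : ℂ) ^ (n + 1) ≠ 1) : DifferentiableAt ℂ (lam p) z := by
  obtain ⟨N, hN⟩ := exists_tail_le hp hp1 (‖z‖ + 1)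
  have hz' : z ∈ Metric.ball (0 : ℂ) (‖z‖ + 1) := by simp
  have hsplit : lam p = fun x => ∑ i ∈ Finset.range N, phi (x * (p : ℂ) ^ (i + 1)) +
      ∑' n : ℕ, phi (x * (p : ℂ) ^ (n + N + 1)) := by
    ext x
    exact ((summable_lam hp hp1 x).sum_add_tsum_nat_add N).symm
  rw [hsplit]
  refine DifferentiableAt.add ?_ ?_
  · refine DifferentiableAt.fun_sum fun i _ => ?_
    exact DifferentiableAt.comp (g := phi) (f := fun x : ℂ => x * (p : ℂ) ^ (i + 1)) z
      (differentiableAt_phi (hz i)) (by fun_prop)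
  · refine DifferentiableOn.differentiableAt (s := Metric.ball (0 : ℂ) (‖z‖ + 1)) ?_
      (Metric.isOpen_ball.mem_nhds hz')
    refine Complex.differentiableOn_tsum_of_summable_norm
      (summable_geom hp hp1 (4 * (‖z‖ + 1)) (N + 1)) (fun n x hx => ?_) Metric.isOpen_ball
      (fun n x hx => ?_)
    · have hx' : ‖x‖ ≤ ‖z‖ + 1 := by simpa using (Metric.mem_ball.1 hx).le
      refine (DifferentiableAt.comp (g := phi) (f := fun x : ℂ => x * (p : ℂ) ^ (n + N + 1)) x
        (differentiableAt_phi ?_) (by fun_prop)).differentiableWithinAt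
      intro h
      have := hN x hx' n
      rw [h] at this
      norm_num at this
    · exact norm_phi_tail_le hp hN (by simpa using (Metric.mem_ball.1 hx).le) n

lemma summable_qp (hp : 0 < p) (hp1 : p < 1) (z : ℂ) :
    Summable fun n : ℕ => ‖-(z * (p : ℂ) ^ (n + 1))‖ := by
  simp_rw [norm_neg, norm_mul_pow hp]
  exact summable_geom hp hp1 ‖z‖ 1

lemma multipliable_qp (hp : 0 < p) (hp1 : p < 1) (z : ℂ) :
    Multipliable fun n : ℕ => 1 - z * (p : ℂ) ^ (n + 1) := by
  simpa [sub_eq_add_neg] using multipliable_one_add_of_summable (summable_qp hp hp1 z)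

lemma qp_ne_zero (hp : 0 < p) (hp1 : p < 1) {z : ℂ}
    (hz : ∀ n : ℕ, z * (p : ℂ) ^ (n + 1) ≠ 1) : qp p z ≠ 0 := by
  unfold qp
  simp_rw [sub_eq_add_neg]
  refine tprod_one_add_ne_zero_of_summable (fun n => ?_) (summable_qp hp hp1 z)
  rw [← sub_eq_add_neg]
  exact sub_ne_zero.2 (hz n).symm

lemma qp_eq_zero {z : ℂ} {n : ℕ} (hz : z * (p : ℂ) ^ (n + 1) = 1) : qp p z = 0 :=
  tprod_of_exists_eq_zero ⟨n, by simp [hz]⟩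

lemma qp_mul (hp : 0 < p) (hp1 : p < 1) (z : ℂ) : qp p z = (1 - z * p) * qp p (z * p) := by
  have h := multipliable_qp hp hp1 (z * p)
  unfold qp
  rw [tprod_eq_zero_mul']
  · simp [pow_succ', mul_assoc]
  · simpa [pow_succ', mul_assoc] using h

lemma differentiable_qp (hp : 0 < p) (hp1 : p < 1) : Differentiable ℂ (qp p) := by
  intro z
  have hz' : z ∈ Metric.ball (0 : ℂ) (‖z‖ + 1) := by simp
  refine DifferentiableOn.differentiableAt (s := Metric.ball (0 : ℂ) (‖z‖ + 1)) ?_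
      (Metric.isOpen_ball.mem_nhds hz')
  have h := Summable.hasProdLocallyUniformlyOn_nat_one_add (f := fun (n : ℕ) (x : ℂ) => -(x * (p : ℂ) ^ (n + 1)))
    (K := Metric.ball (0 : ℂ) (‖z‖ + 1)) Metric.isOpen_ball (summable_geom hp hp1 (‖z‖ + 1) 1)
    (Eventually.of_forall fun n x hx => ?_) (fun n => by fun_prop)
  · have h2 := h.differentiableOn (Eventually.of_forall fun s => by
      simpa [Finset.prod_fn] using DifferentiableOn.finsetProd (fun _ _ ↦ by fun_prop))
      Metric.isOpen_ball
    have e : qp p = fun x => ∏' i : ℕ, (1 + -(x * (p : ℂ) ^ (i + 1))) := by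
      ext x
      simp [qp, sub_eq_add_neg]
    rw [e]
    exact h2
  · rw [norm_neg, norm_mul_pow hp]
    exact mul_le_mul_of_nonneg_right (by simpa using (Metric.mem_ball.1 hx).le) (by positivity)

lemma exp_log_ofReal (hp : 0 < p) : Complex.exp (Real.log p) = p := by
  rw [← Complex.ofReal_exp, Real.exp_log hp]

lemma vt_add_log (hp : 0 < p) (hp1 : p < 1) (t : ℂ) :
    vt p (t + Real.log p) = -Complex.exp (-t) * vt p t := by
  have hp0 : (p : ℂ) ≠ 0 := by exact_mod_cast hp.ne'
  have h1 := qp_mul hp hp1 (Complex.exp t)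
  have h2 := qp_mul hp hp1 (Complex.exp (-t) / p)
  rw [div_mul_cancel₀ _ hp0] at h2
  have h3 : Complex.exp (-(t + Real.log p)) = Complex.exp (-t) / p := by
    rw [neg_add, Complex.exp_add, Complex.exp_neg (Real.log p : ℂ), exp_log_ofReal hp]; rfl
  have h4 : Complex.exp (-t) * Complex.exp t = 1 := by rw [← Complex.exp_add]; simp
  unfold vt
  rw [h3, h2, Complex.exp_add, exp_log_ofReal hp, h1]
  linear_combination (1 - Complex.exp t * p) * qp p (Complex.exp t * p) * qp p (Complex.exp (-t)) * (-h4)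

lemma vt_periodic_two_pi : Function.Periodic (vt p) (2 * Real.pi * Complex.I) := by
  intro t
  simp only [vt, neg_add, Complex.exp_add, Complex.exp_neg (2 * Real.pi * Complex.I),
    Complex.exp_two_pi_mul_I, inv_one, mul_one]

lemma vt_neg (t : ℂ) : vt p (-t) = -Complex.exp (-t) * vt p t := by
  have h4 : Complex.exp (-t) * Complex.exp t = 1 := by rw [← Complex.exp_add]; simp
  simp only [vt, neg_neg]
  linear_combination qp p (Complex.exp t) * qp p (Complex.exp (-t)) * (-h4)

lemma differentiable_vt (hp : 0 < p) (hp1 : p < 1) : Differentiable ℂ (vt p) := by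
  have := differentiable_qp hp hp1
  unfold vt
  fun_prop

lemma vt_zero : vt p 0 = 0 := by simp [vt]

lemma vt_ne_zero_iff (hp : 0 < p) (hp1 : p < 1) (t : ℂ) : vt p t ≠ 0 ↔
    Complex.exp t ≠ 1 ∧ (∀ n : ℕ, Complex.exp t * (p : ℂ) ^ (n + 1) ≠ 1) ∧
      ∀ n : ℕ, Complex.exp (-t) * (p : ℂ) ^ (n + 1) ≠ 1 := by
  constructor
  · intro h
    refine ⟨fun h1 => h (by simp [vt, h1]), fun n h1 => h (by simp [vt, qp_eq_zero h1]),
      fun n h1 => h (by simp [vt, qp_eq_zero h1])⟩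
  · rintro ⟨h1, h2, h3⟩
    exact mul_ne_zero (sub_ne_zero.2 h1.symm) (mul_ne_zero (qp_ne_zero hp hp1 h2)
      (qp_ne_zero hp hp1 h3))

lemma exists_of_vt_eq_zero (hp : 0 < p) (hp1 : p < 1) {t : ℂ} (h : vt p t = 0) :
    ∃ m n : ℤ, t = m * (Real.log p : ℂ) + n * (2 * Real.pi * Complex.I) := by
  have hpow : ∀ n : ℕ, (p : ℂ) ^ n = Complex.exp (n * (Real.log p : ℂ)) := fun n => by
    rw [Complex.exp_nat_mul, exp_log_ofReal hp]
  by_contra hc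
  push Not at hc
  refine (vt_ne_zero_iff hp hp1 t).2 ⟨fun h1 => ?_, fun k h1 => ?_, fun k h1 => ?_⟩ h
  · obtain ⟨n, hn⟩ := Complex.exp_eq_one_iff.1 h1
    exact hc 0 n (by simp [hn])
  · rw [hpow, ← Complex.exp_add] at h1
    obtain ⟨n, hn⟩ := Complex.exp_eq_one_iff.1 h1
    exact hc (-(k + 1 : ℕ)) n (by rw [← hn]; push_cast; ring)
  · rw [hpow, ← Complex.exp_add] at h1
    obtain ⟨n, hn⟩ := Complex.exp_eq_one_iff.1 h1
    refine hc (k + 1 : ℕ) (-n) ?_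
    push_cast at hn ⊢
    linear_combination -hn

lemma exp_pi_add (x : ℂ) : Complex.exp (x + Real.pi * Complex.I) = -Complex.exp x := by
  rw [Complex.exp_add, Complex.exp_pi_mul_I, mul_neg_one]

lemma vt_real_add_pi_ne_zero (hp : 0 < p) (hp1 : p < 1) (x : ℝ) :
    vt p (x + Real.pi * Complex.I) ≠ 0 := by
  intro h
  obtain ⟨m, n, h⟩ := exists_of_vt_eq_zero hp hp1 h
  have := congrArg Complex.im h
  simp at this
  have hpi := Real.pi_pos
  have h2 : (1 : ℝ) = n * 2 := by
    field_simp at this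
    linarith
  have h3 : (1 : ℤ) = n * 2 := by exact_mod_cast h2
  omega

lemma vt_half_log_ne_zero (hp : 0 < p) (hp1 : p < 1) : vt p (Real.log p / 2) ≠ 0 := by
  intro h
  obtain ⟨m, n, h⟩ := exists_of_vt_eq_zero hp hp1 h
  have := congrArg Complex.re h
  have hL : Real.log p ≠ 0 := (Real.log_neg hp hp1).ne
  simp at this
  have h2 : (1 : ℝ) = m * 2 := by
    norm_cast at this
    field_simp at this
    linarith
  have h3 : (1 : ℤ) = m * 2 := by exact_mod_cast h2
  omega

lemma wp_neg (t : ℂ) : wp p (-t) = wp p t := by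
  simp only [wp, neg_neg, Complex.exp_neg, phi_inv]
  ring

lemma wp_periodic_two_pi : Function.Periodic (wp p) (2 * Real.pi * Complex.I) := by
  intro t
  simp only [wp, neg_add, Complex.exp_add, Complex.exp_neg (2 * Real.pi * Complex.I),
    Complex.exp_two_pi_mul_I, inv_one, mul_one]

lemma wp_periodic_log (hp : 0 < p) (hp1 : p < 1) : Function.Periodic (wp p) (Real.log p) := by
  intro t
  have hp0 : (p : ℂ) ≠ 0 := by exact_mod_cast hp.ne'
  have h1 := lam_mul hp hp1 (Complex.exp t)
  have h2 := lam_mul hp hp1 (Complex.exp (-t) / p)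
  rw [div_mul_cancel₀ _ hp0] at h2
  have h3 : Complex.exp (-(t + Real.log p)) = Complex.exp (-t) / p := by
    rw [neg_add, Complex.exp_add, Complex.exp_neg (Real.log p : ℂ), exp_log_ofReal hp]; rfl
  have h4 : phi (Complex.exp (-t)) = phi (Complex.exp t) := by rw [Complex.exp_neg, phi_inv]
  unfold wp
  rw [h3, h2, Complex.exp_add, exp_log_ofReal hp, h1, h4]
  ring

lemma differentiableAt_wp (hp : 0 < p) (hp1 : p < 1) {t : ℂ} (ht : vt p t ≠ 0) :
    DifferentiableAt ℂ (wp p) t := by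
  obtain ⟨h1, h2, h3⟩ := (vt_ne_zero_iff hp hp1 t).1 ht
  have d1 : DifferentiableAt ℂ (fun t => phi (Complex.exp t)) t :=
    (differentiableAt_phi h1).comp t Complex.differentiableAt_exp
  have d2 : DifferentiableAt ℂ (fun t => lam p (Complex.exp t)) t :=
    (differentiableAt_lam hp hp1 h2).comp t Complex.differentiableAt_exp
  have d3 : DifferentiableAt ℂ (fun t => lam p (Complex.exp (-t))) t :=
    DifferentiableAt.comp (g := lam p) (f := fun t => Complex.exp (-t)) t
      (differentiableAt_lam hp hp1 h3) (by fun_prop)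
  unfold wp
  fun_prop

/-- Liouville's theorem for doubly periodic functions whose only possible singularities are
removable ones on the zero lattice of the theta function. -/
lemma eq_const_of_periodic (hp : 0 < p) (hp1 : p < 1) {H : ℂ → ℂ}
    (h1 : Function.Periodic H (Real.log p)) (h2 : Function.Periodic H (2 * Real.pi * Complex.I))
    (hd : ∀ t, vt p t ≠ 0 → DifferentiableAt ℂ H t)
    (hb : H =O[𝓝[≠] 0] fun _ => (1 : ℝ)) : ∃ C, ∀ t, vt p t ≠ 0 → H t = C := by
  have hev : ∀ᶠ t in 𝓝[≠] (0 : ℂ), vt p t ≠ 0 := by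
    have han : AnalyticOnNhd ℂ (vt p) Set.univ := fun t _ => (differentiable_vt hp hp1).analyticAt t
    refine ((han 0 trivial).eventually_eq_zero_or_eventually_ne_zero).resolve_left fun h => ?_
    have := han.eqOn_zero_of_preconnected_of_eventuallyEq_zero isPreconnected_univ trivial h
    exact vt_half_log_ne_zero hp hp1 (this trivial)
  have hL : Real.log p < 0 := Real.log_neg hp hp1
  set g : ℂ → ℂ := fun t => limUnder (𝓝[≠] t) H with hg
  have hgH : ∀ t, vt p t ≠ 0 → g t = H t := fun t ht =>
    ((hd t ht).continuousAt.tendsto.mono_left nhdsWithin_le_nhds).limUnder_eq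
  have hper : ∀ c, Function.Periodic H c → Function.Periodic g c := fun c hc t => by
    have : Filter.map H (𝓝[≠] (t + c)) = Filter.map H (𝓝[≠] t) := by
      have e : 𝓝[≠] (t + c) = Filter.map (fun x => x + c) (𝓝[≠] t) :=
        Filter.map_add_right_nhdsNE.symm
      rw [e, Filter.map_map]
      congr 1
      ext x
      exact hc x
    simp only [hg, limUnder, this]
  have hgd0 : DifferentiableAt ℂ g 0 := by
    have hd0 : ∀ᶠ z in 𝓝[≠] (0 : ℂ), DifferentiableAt ℂ H z := hev.mono hd
    have hlim := Complex.tendsto_limUnder_of_differentiable_on_punctured_nhds_of_bounded_under hd0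
      (by
        have : (fun z => H z - H 0) =O[𝓝[≠] 0] fun _ => (1 : ℝ) :=
          hb.sub (isBigO_const_const _ one_ne_zero _)
        exact (isBigO_one_iff ℝ).1 this)
    have heq : ∀ᶠ z in 𝓝[≠] (0 : ℂ), g z = H z := hev.mono hgH
    have hcont : ContinuousAt g 0 := by
      rw [continuousAt_iff_punctured_nhds]
      exact hlim.congr' (heq.mono fun z hz => hz.symm)
    refine (Complex.analyticAt_of_differentiable_on_punctured_nhds_of_continuousAt ?_
      hcont).differentiableAt
    filter_upwards [eventually_eventually_nhdsWithin.2 heq, hd0, self_mem_nhdsWithin]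
      with z hz hz2 hz3
    have : g =ᶠ[𝓝 z] H := by
      rwa [IsOpen.nhdsWithin_eq isOpen_compl_singleton hz3] at hz
    exact hz2.congr_of_eventuallyEq this
  have hgper : ∀ m n : ℤ, Function.Periodic g (m * (Real.log p : ℂ) + n * (2 * Real.pi * Complex.I)) :=
    fun m n => ((hper _ h1).int_mul m).add_period ((hper _ h2).int_mul n)
  have hgd : Differentiable ℂ g := by
    intro t
    by_cases ht : vt p t = 0
    · obtain ⟨m, n, hmn⟩ := exists_of_vt_eq_zero hp hp1 ht
      have : g = fun x => g (x - t) := by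
        ext x
        have := hgper m n (x - t)
        rw [← hmn] at this
        rw [← this]
        simp
      rw [this]
      exact DifferentiableAt.comp (g := g) (f := fun x => x - t) t (by simpa using hgd0)
        (by fun_prop)
    · have hopen : ∀ᶠ x in 𝓝 t, vt p x ≠ 0 :=
        (differentiable_vt hp hp1).continuous.continuousAt.eventually_ne ht
      exact (hd t ht).congr_of_eventuallyEq (hopen.mono hgH)
  have hbd : Bornology.IsBounded (Set.range g) := by
    have hc : IsCompact ((fun x : ℝ × ℝ => (x.1 : ℂ) * Real.log p + x.2 * (2 * Real.pi * Complex.I)) ''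
        (Set.Icc 0 1 ×ˢ Set.Icc 0 1)) :=
      (isCompact_Icc.prod isCompact_Icc).image (by fun_prop)
    refine (hc.image hgd.continuous).isBounded.subset ?_
    rintro _ ⟨t, rfl⟩
    obtain ⟨a, ha'⟩ : ∃ a : ℝ, t.re = a * Real.log p := ⟨t.re / Real.log p, (div_mul_cancel₀ _ hL.ne).symm⟩
    obtain ⟨b, hb'⟩ : ∃ b : ℝ, t.im = b * (2 * Real.pi) := ⟨t.im / (2 * Real.pi), by field_simp⟩
    have ht : t = (a : ℂ) * Real.log p + b * (2 * Real.pi * Complex.I) := by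
      apply Complex.ext
      · simp [ha']
      · simp [hb']
    refine ⟨_, ⟨(Int.fract a, Int.fract b), ⟨⟨Int.fract_nonneg _, (Int.fract_lt_one _).le⟩,
      ⟨Int.fract_nonneg _, (Int.fract_lt_one _).le⟩⟩, rfl⟩, ?_⟩
    rw [← hgper ⌊a⌋ ⌊b⌋]
    congr 1
    conv_rhs => rw [ht]
    have ha : ((Int.fract a : ℝ) : ℂ) + (⌊a⌋ : ℂ) = a := by exact_mod_cast Int.fract_add_floor a
    have hb : ((Int.fract b : ℝ) : ℂ) + (⌊b⌋ : ℂ) = b := by exact_mod_cast Int.fract_add_floor b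
    rw [← ha, ← hb]
    ring
  refine ⟨g 0, fun t ht => ?_⟩
  rw [← hgH t ht]
  exact hgd.apply_eq_apply_of_bounded hbd t 0

end

/-- The logarithmic derivative of the theta function. -/
noncomputable def mlog (p : ℝ) (t : ℂ) : ℂ := deriv (vt p) t / vt p t

/-- The second logarithmic derivative of the theta function. -/
noncomputable def vlog (p : ℝ) (t : ℂ) : ℂ :=
  (deriv (deriv (vt p)) t * vt p t - deriv (vt p) t ^ 2) / vt p t ^ 2

/-- The part of the Weierstrass function that is regular at the origin. -/
noncomputable def wreg (p : ℝ) (t : ℂ) : ℂ :=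
  -1 / 12 + 2 * lam p 1 - lam p (Complex.exp t) - lam p (Complex.exp (-t))

lemma deriv_periodic {f : ℂ → ℂ} {c : ℂ} (h : Function.Periodic f c) :
    Function.Periodic (deriv f) c := fun t => by
  rw [← deriv_comp_add_const, show (fun x => f (x + c)) = f from funext h]

section

variable {p : ℝ}

lemma differentiable_deriv_vt (hp : 0 < p) (hp1 : p < 1) : Differentiable ℂ (deriv (vt p)) :=
  (differentiable_vt hp hp1).deriv

lemma hasDerivAt_mlog (hp : 0 < p) (hp1 : p < 1) {t : ℂ} (ht : vt p t ≠ 0) :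
    HasDerivAt (mlog p) (vlog p t) t := by
  have h1 := (differentiable_vt hp hp1 t).hasDerivAt
  have h2 := (differentiable_deriv_vt hp hp1 t).hasDerivAt
  exact (h2.div h1 ht).congr_deriv (by rw [vlog, pow_two (deriv (vt p) t)])

lemma vlog_periodic_two_pi : Function.Periodic (vlog p) (2 * Real.pi * Complex.I) := fun t => by
  have h := vt_periodic_two_pi (p := p)
  have h1 := deriv_periodic h
  simp only [vlog, h t, h1 t, deriv_periodic h1 t]

lemma vlog_periodic_log (hp : 0 < p) (hp1 : p < 1) :
    Function.Periodic (vlog p) (Real.log p) := fun t => by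
  have hE : ∀ t, HasDerivAt (fun t : ℂ => -Complex.exp (-t)) (Complex.exp (-t)) t := fun t => by
    refine ((Complex.hasDerivAt_exp (-t)).comp t (hasDerivAt_neg t)).neg.congr_deriv ?_
    ring
  have h0 := vt_add_log hp hp1
  have h1 : ∀ t, deriv (vt p) (t + Real.log p) = Complex.exp (-t) * (vt p t - deriv (vt p) t) := by
    intro t
    rw [← deriv_comp_add_const, show (fun x => vt p (x + Real.log p)) = _ from funext h0]
    refine ((hE t).mul (differentiable_vt hp hp1 t).hasDerivAt).deriv.trans ?_
    ring
  have h2 : deriv (deriv (vt p)) (t + Real.log p) =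
      Complex.exp (-t) * (2 * deriv (vt p) t - vt p t - deriv (deriv (vt p)) t) := by
    rw [← deriv_comp_add_const, show (fun x => deriv (vt p) (x + Real.log p)) = _ from funext h1]
    have hE' : HasDerivAt (fun t : ℂ => Complex.exp (-t)) (-Complex.exp (-t)) t := by
      simpa using (hE t).fun_neg
    refine (hE'.mul ((differentiable_vt hp hp1 t).hasDerivAt.sub
      (differentiable_deriv_vt hp hp1 t).hasDerivAt)).deriv.trans ?_
    simp only [Pi.sub_apply]
    ring
  simp only [vlog, h0, h1, h2]
  have := Complex.exp_ne_zero (-t)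
  rw [show (-Complex.exp (-t) * vt p t) ^ 2 = Complex.exp (-t) ^ 2 * vt p t ^ 2 by ring,
    ← mul_div_mul_left _ (vt p t ^ 2) (pow_ne_zero 2 this)]
  congr 1
  ring

lemma wreg_neg (t : ℂ) : wreg p (-t) = wreg p t := by
  simp only [wreg, neg_neg]
  ring

lemma wreg_zero : wreg p 0 = -1 / 12 := by
  simp [wreg]
  ring

lemma wp_eq (t : ℂ) : wp p t = wreg p t - phi (Complex.exp t) := by
  simp only [wp, wreg]
  ring

lemma analyticAt_wreg (hp : 0 < p) (hp1 : p < 1) : AnalyticAt ℂ (wreg p) 0 := by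
  have key : ∀ᶠ z in 𝓝 (1 : ℂ), DifferentiableAt ℂ (lam p) z := by
    have : ∀ᶠ z in 𝓝 (1 : ℂ), ‖z‖ < p⁻¹ :=
      continuous_norm.continuousAt.eventually_lt_const (by simpa using one_lt_inv_iff₀.2 ⟨hp, hp1⟩)
    filter_upwards [this] with z hz
    refine differentiableAt_lam hp hp1 fun n h => ?_
    have h2 := congrArg norm h
    rw [norm_mul_pow hp, norm_one] at h2
    have h3 : p ^ (n + 1) ≤ p := by
      simpa using pow_le_pow_of_le_one hp.le hp1.le (Nat.le_add_left 1 n)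
    have h4 : ‖z‖ * p ^ (n + 1) < 1 := by
      calc ‖z‖ * p ^ (n + 1) < p⁻¹ * p ^ (n + 1) := by gcongr
        _ ≤ p⁻¹ * p := by gcongr
        _ = 1 := inv_mul_cancel₀ hp.ne'
    exact h4.ne h2
  have hl : AnalyticAt ℂ (lam p) 1 := Complex.analyticAt_iff_eventually_differentiableAt.2 key
  have h1 : AnalyticAt ℂ (fun t => lam p (Complex.exp t)) 0 :=
    AnalyticAt.fun_comp (by simpa using hl) (by fun_prop)
  have h2 : AnalyticAt ℂ (fun t => lam p (Complex.exp (-t))) 0 :=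
    AnalyticAt.fun_comp (by simpa using hl) (by fun_prop)
  unfold wreg
  fun_prop

lemma exp_ne_one_nhdsNE : ∀ᶠ t in 𝓝[≠] (0 : ℂ), Complex.exp t ≠ 1 := by
  have := (Complex.hasDerivAt_exp 0).eventually_ne (c := 1) (by simp)
  exact this

lemma isBigO_phi_exp : (fun t => phi (Complex.exp t)) =O[𝓝[≠] 0] fun t => (t ^ 2)⁻¹ := by
  have h : Tendsto (fun t : ℂ => t⁻¹ * (Complex.exp t - 1)) (𝓝[≠] 0) (𝓝 1) := by
    have := (Complex.hasDerivAt_exp 0).tendsto_slope_zero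
    simpa using this
  have he : Tendsto Complex.exp (𝓝[≠] 0) (𝓝 1) := by
    have : ContinuousAt Complex.exp 0 := by fun_prop
    simpa using this.tendsto.mono_left nhdsWithin_le_nhds
  have h2 := (he.div (h.pow 2) (by simp)).isBigO_one ℝ
  have h3 := h2.mul (isBigO_refl (fun t : ℂ => (t ^ 2)⁻¹) (𝓝[≠] 0)).norm_right
  refine (h3.congr' ?_ (Eventually.of_forall fun t => rfl)).trans (IsBigO.of_bound 1 (by simp))
  filter_upwards [self_mem_nhdsWithin] with t ht
  have ht' : t ≠ 0 := ht
  simp only [Pi.div_apply, phi, mul_pow, inv_pow]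
  rw [show (1 - Complex.exp t) ^ 2 = (Complex.exp t - 1) ^ 2 by ring]
  field_simp

lemma isBigO_phi_exp_mul {K : ℂ → ℂ} (hK : AnalyticAt ℂ K 0) (heven : ∀ t, K (-t) = K t)
    (h0 : K 0 = 0) : (fun t => phi (Complex.exp t) * K t) =O[𝓝[≠] 0] fun _ => (1 : ℝ) := by
  have hd0 : deriv K 0 = 0 := by
    have := deriv_comp_neg K 0
    rw [show (fun x => K (-x)) = K from funext heven, neg_zero] at this
    linear_combination this / 2
  have h1 : deriv K =O[𝓝 0] fun t => t ^ 1 := by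
    simpa [hd0] using hK.deriv.differentiableAt.isBigO_sub
  have h2 := isBigO_sub_of_deriv
    (hK.eventually_analyticAt.mono fun t ht => ht.differentiableAt.hasDerivAt) h1
  simp only [h0, sub_zero] at h2
  have h3 := isBigO_phi_exp.mul (h2.mono nhdsWithin_le_nhds)
  refine h3.trans (IsBigO.of_bound 1 ?_)
  filter_upwards [self_mem_nhdsWithin] with t ht
  have ht' : t ≠ 0 := ht
  simp [ht']

lemma isBigO_one_of_analyticAt {f : ℂ → ℂ} {z : ℂ} (h : AnalyticAt ℂ f z) :
    f =O[𝓝[≠] z] fun _ => (1 : ℝ) :=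
  (h.continuousAt.tendsto.mono_left nhdsWithin_le_nhds).isBigO_one ℝ

/-- The regular factor of the theta function at the origin. -/
noncomputable def vreg (p : ℝ) (t : ℂ) : ℂ := qp p (Complex.exp t) * qp p (Complex.exp (-t))

lemma vt_eq (t : ℂ) : vt p t = (1 - Complex.exp t) * vreg p t := rfl

lemma vreg_neg (t : ℂ) : vreg p (-t) = vreg p t := by
  simp only [vreg, neg_neg]
  ring

lemma vreg_zero_ne_zero (hp : 0 < p) (hp1 : p < 1) : vreg p 0 ≠ 0 := by
  have : qp p 1 ≠ 0 := qp_ne_zero hp hp1 fun n h => by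
    have h2 := congrArg norm h
    rw [norm_mul_pow hp, norm_one, one_mul] at h2
    exact (pow_lt_one₀ hp.le hp1 n.succ_ne_zero).ne h2
  simpa [vreg] using this

lemma differentiable_vreg (hp : 0 < p) (hp1 : p < 1) : Differentiable ℂ (vreg p) := by
  have := differentiable_qp hp hp1
  unfold vreg
  fun_prop

lemma hasDerivAt_one_sub_exp (t : ℂ) : HasDerivAt (fun t => 1 - Complex.exp t) (-Complex.exp t) t :=
  (Complex.hasDerivAt_exp t).const_sub 1

lemma deriv_vt (hp : 0 < p) (hp1 : p < 1) : deriv (vt p) =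
    fun t => -Complex.exp t * vreg p t + (1 - Complex.exp t) * deriv (vreg p) t := by
  ext t
  exact ((hasDerivAt_one_sub_exp t).mul (differentiable_vreg hp hp1 t).hasDerivAt).deriv

lemma vlog_eq (hp : 0 < p) (hp1 : p < 1) {t : ℂ} (h1 : Complex.exp t ≠ 1) (hv : vreg p t ≠ 0) :
    vlog p t = -phi (Complex.exp t) +
      (deriv (deriv (vreg p)) t * vreg p t - deriv (vreg p) t ^ 2) / vreg p t ^ 2 := by
  have hd := (differentiable_vreg hp hp1 t).hasDerivAt
  have hd2 := ((differentiable_vreg hp hp1).deriv t).hasDerivAt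
  have h2 : deriv (deriv (vt p)) t = -Complex.exp t * vreg p t - 2 * Complex.exp t * deriv (vreg p) t
      + (1 - Complex.exp t) * deriv (deriv (vreg p)) t := by
    rw [deriv_vt hp hp1]
    refine (((Complex.hasDerivAt_exp t).neg.mul hd).add
      ((hasDerivAt_one_sub_exp t).mul hd2)).deriv.trans ?_
    simp only [Pi.neg_apply]
    ring
  have h3 : 1 - Complex.exp t ≠ 0 := sub_ne_zero.2 h1.symm
  rw [vlog, h2, deriv_vt hp hp1, vt_eq, phi]
  field_simp
  ring

/-- The Weierstrass function is, up to a constant, the second logarithmic derivative of theta. -/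
lemma exists_wp_eq_add_vlog (hp : 0 < p) (hp1 : p < 1) :
    ∃ κ, ∀ t, vt p t ≠ 0 → wp p t = κ + vlog p t := by
  have hreg := (differentiable_vreg hp hp1).analyticAt 0
  have hne := vreg_zero_ne_zero hp hp1
  obtain ⟨C, hC⟩ := eq_const_of_periodic hp hp1 (H := fun t => wp p t - vlog p t)
    (fun t => by simp only [wp_periodic_log hp hp1 t, vlog_periodic_log hp hp1 t])
    (fun t => by simp only [wp_periodic_two_pi t, vlog_periodic_two_pi t])
    (fun t ht => by
      have h0 := differentiableAt_wp hp hp1 ht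
      have h1 := differentiable_vt hp hp1 t
      have h2 := differentiable_deriv_vt hp hp1 t
      have h3 := (differentiable_deriv_vt hp hp1).deriv t
      have h4 := pow_ne_zero 2 ht
      unfold vlog
      fun_prop (disch := assumption))
    (by
      have hA : AnalyticAt ℂ (fun t => wreg p t -
          (deriv (deriv (vreg p)) t * vreg p t - deriv (vreg p) t ^ 2) / vreg p t ^ 2) 0 := by
        have h1 := analyticAt_wreg hp hp1
        have h2 := hreg.deriv
        have h3 := h2.deriv
        have h4 := pow_ne_zero 2 hne
        fun_prop (disch := assumption)
      refine (isBigO_one_of_analyticAt hA).congr' ?_ EventuallyEq.rfl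
      filter_upwards [exp_ne_one_nhdsNE,
        (hreg.continuousAt.eventually_ne hne).filter_mono nhdsWithin_le_nhds] with t h1 h2
      rw [vlog_eq hp hp1 h1 h2, wp_eq]
      ring)
  exact ⟨C, fun t ht => by linear_combination hC t ht⟩

lemma isOpen_vt_ne_zero (hp : 0 < p) (hp1 : p < 1) : IsOpen {t | vt p t ≠ 0} :=
  isOpen_ne_fun (differentiable_vt hp hp1).continuous continuous_const

lemma analyticAt_wp (hp : 0 < p) (hp1 : p < 1) {t : ℂ} (ht : vt p t ≠ 0) :
    AnalyticAt ℂ (wp p) t :=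
  DifferentiableOn.analyticAt (s := {t | vt p t ≠ 0})
    (fun _ hx => (differentiableAt_wp hp hp1 hx).differentiableWithinAt)
    ((isOpen_vt_ne_zero hp hp1).mem_nhds ht)

lemma hasDerivAt_phi_exp {t : ℂ} (h : Complex.exp t ≠ 1) :
    HasDerivAt (fun t => phi (Complex.exp t))
      (Complex.exp t * (1 + Complex.exp t) / (1 - Complex.exp t) ^ 3) t := by
  have h3 : 1 - Complex.exp t ≠ 0 := sub_ne_zero.2 h.symm
  refine ((Complex.hasDerivAt_exp t).div ((hasDerivAt_one_sub_exp t).pow 2)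
    (pow_ne_zero 2 h3)).congr_deriv ?_
  simp only [Pi.pow_apply]
  field_simp
  ring

lemma hasDerivAt_phi_exp' {t : ℂ} (h : Complex.exp t ≠ 1) :
    HasDerivAt (fun t => Complex.exp t * (1 + Complex.exp t) / (1 - Complex.exp t) ^ 3)
      (phi (Complex.exp t) + 6 * phi (Complex.exp t) ^ 2) t := by
  have h3 : 1 - Complex.exp t ≠ 0 := sub_ne_zero.2 h.symm
  have he := Complex.hasDerivAt_exp t
  refine ((he.mul (he.const_add 1)).div ((hasDerivAt_one_sub_exp t).pow 3)
    (pow_ne_zero 3 h3)).congr_deriv ?_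
  simp only [Pi.pow_apply, Pi.mul_apply, phi]
  field_simp
  ring

/-- The second order differential equation of the Weierstrass function. -/
lemma exists_ode (hp : 0 < p) (hp1 : p < 1) :
    ∃ C, ∀ t, vt p t ≠ 0 → HasDerivAt (deriv (wp p)) (C - 6 * wp p t ^ 2) t := by
  have hreg := analyticAt_wreg hp hp1
  obtain ⟨C, hC⟩ := eq_const_of_periodic hp hp1
    (H := fun t => deriv (deriv (wp p)) t + 6 * wp p t ^ 2)
    (fun t => by
      simp only [wp_periodic_log hp hp1 t,
        deriv_periodic (deriv_periodic (wp_periodic_log hp hp1)) t])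
    (fun t => by
      simp only [wp_periodic_two_pi t, deriv_periodic (deriv_periodic wp_periodic_two_pi) t])
    (fun t ht => by
      have h0 := analyticAt_wp hp hp1 ht
      have h1 := h0.deriv.deriv.differentiableAt
      have h2 := h0.differentiableAt
      fun_prop)
    (by
      have hA : AnalyticAt ℂ (fun t => deriv (deriv (wreg p)) t + 6 * wreg p t ^ 2) 0 := by
        have h2 := hreg.deriv.deriv
        fun_prop
      have hB := isBigO_phi_exp_mul (K := fun t => 1 + 12 * wreg p t) (by fun_prop)
        (fun t => by simp only [wreg_neg]) (by simp only [wreg_zero]; norm_num)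
      refine ((isBigO_one_of_analyticAt hA).sub hB).congr' ?_ EventuallyEq.rfl
      have hd : ∀ᶠ t in 𝓝[≠] (0 : ℂ), deriv (wp p) t =
          deriv (wreg p) t - Complex.exp t * (1 + Complex.exp t) / (1 - Complex.exp t) ^ 3 := by
        filter_upwards [exp_ne_one_nhdsNE,
          hreg.eventually_analyticAt.filter_mono nhdsWithin_le_nhds] with t h1 h2
        rw [show wp p = fun t => wreg p t - phi (Complex.exp t) from funext wp_eq]
        exact (h2.differentiableAt.hasDerivAt.sub (hasDerivAt_phi_exp h1)).deriv
      filter_upwards [exp_ne_one_nhdsNE, eventually_eventually_nhdsWithin.2 hd,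
        hreg.eventually_analyticAt.filter_mono nhdsWithin_le_nhds, self_mem_nhdsWithin]
        with t h1 h2 h3 h4
      rw [IsOpen.nhdsWithin_eq isOpen_compl_singleton h4] at h2
      rw [EventuallyEq.deriv_eq h2,
        (h3.deriv.differentiableAt.hasDerivAt.fun_sub (hasDerivAt_phi_exp' h1)).deriv, wp_eq]
      ring)
  refine ⟨C, fun t ht => ?_⟩
  have := (analyticAt_wp hp hp1 ht).deriv.differentiableAt.hasDerivAt
  rwa [show deriv (deriv (wp p)) t = C - 6 * wp p t ^ 2 by linear_combination hC t ht] at this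

/-- The square of the normalising constant relating theta quotients to Weierstrass functions. -/
noncomputable def thc (p : ℝ) : ℂ := vreg p 0 ^ 2 / vt p (Real.pi * Complex.I) ^ 2

lemma vt_pi_ne_zero (hp : 0 < p) (hp1 : p < 1) : vt p (Real.pi * Complex.I) ≠ 0 := by
  simpa using vt_real_add_pi_ne_zero hp hp1 0

lemma thc_ne_zero (hp : 0 < p) (hp1 : p < 1) : thc p ≠ 0 :=
  div_ne_zero (pow_ne_zero 2 (vreg_zero_ne_zero hp hp1)) (pow_ne_zero 2 (vt_pi_ne_zero hp hp1))

lemma vt_neg_add_pi (t : ℂ) :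
    vt p (-t + Real.pi * Complex.I) = Complex.exp (-t) * vt p (t + Real.pi * Complex.I) := by
  have h1 := vt_neg (p := p) (t + Real.pi * Complex.I)
  have h2 := vt_periodic_two_pi (p := p) (-(t + Real.pi * Complex.I))
  rw [show -(t + Real.pi * Complex.I) + 2 * Real.pi * Complex.I = -t + Real.pi * Complex.I by ring,
    h1, neg_add, Complex.exp_add, Complex.exp_neg (Real.pi * Complex.I), Complex.exp_pi_mul_I] at h2
  rw [h2, inv_neg, inv_one]
  ring

lemma vt_add_pi_add_pi (t : ℂ) :
    vt p (t + Real.pi * Complex.I + Real.pi * Complex.I) = vt p t := by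
  rw [show t + Real.pi * Complex.I + Real.pi * Complex.I = t + 2 * Real.pi * Complex.I by ring]
  exact vt_periodic_two_pi t

lemma wp_add_pi_add_pi (t : ℂ) :
    wp p (t + Real.pi * Complex.I + Real.pi * Complex.I) = wp p t := by
  rw [show t + Real.pi * Complex.I + Real.pi * Complex.I = t + 2 * Real.pi * Complex.I by ring]
  exact wp_periodic_two_pi t

/-- The Weierstrass function as a quotient of theta functions. -/
lemma wp_sub_eq (hp : 0 < p) (hp1 : p < 1) {t : ℂ} (ht : vt p t ≠ 0) :
    wp p t - wp p (Real.pi * Complex.I) =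
      -thc p * (vt p (t + Real.pi * Complex.I) ^ 2 / vt p t ^ 2) := by
  have hne := vreg_zero_ne_zero hp hp1
  have hpi := vt_pi_ne_zero hp hp1
  have hdv := differentiable_vt hp hp1
  obtain ⟨C, hC⟩ := eq_const_of_periodic hp hp1
    (H := fun t => wp p t + thc p * (vt p (t + Real.pi * Complex.I) ^ 2 / vt p t ^ 2))
    (fun t => by
      have h1 := vt_add_log hp hp1 t
      have h2 := vt_add_log hp hp1 (t + Real.pi * Complex.I)
      have h3 : Complex.exp (-(t + Real.pi * Complex.I)) = -Complex.exp (-t) := by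
        rw [neg_add, Complex.exp_add, Complex.exp_neg (Real.pi * Complex.I), Complex.exp_pi_mul_I,
          inv_neg, inv_one, mul_neg_one]
      have h4 := Complex.exp_ne_zero (-t)
      simp only [wp_periodic_log hp hp1 t, h1,
        add_right_comm t (Real.log p : ℂ) (Real.pi * Complex.I), h2, h3]
      rw [mul_pow, mul_pow, neg_neg, neg_sq, mul_div_mul_left _ _ (pow_ne_zero 2 h4)])
    (fun t => by
      simp only [wp_periodic_two_pi t, vt_periodic_two_pi t,
        add_right_comm t (2 * Real.pi * Complex.I) (Real.pi * Complex.I),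
        vt_periodic_two_pi (t + Real.pi * Complex.I)])
    (fun t ht => by
      have h0 := differentiableAt_wp hp hp1 ht
      have h4 := pow_ne_zero 2 ht
      fun_prop (disch := assumption))
    (by
      have hK : AnalyticAt ℂ (fun t => thc p *
          (Complex.exp (-t) * vt p (t + Real.pi * Complex.I) ^ 2 / vreg p t ^ 2) - 1) 0 := by
        have h1 := (differentiable_vreg hp hp1).analyticAt 0
        have h2 : AnalyticAt ℂ (fun t => vt p (t + Real.pi * Complex.I)) 0 :=
          Differentiable.analyticAt (by fun_prop) 0
        have h4 := pow_ne_zero 2 hne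
        fun_prop (disch := assumption)
      have hB := isBigO_phi_exp_mul hK
        (fun t => by
          simp only [vt_neg_add_pi, vreg_neg, neg_neg]
          have : Complex.exp t * Complex.exp (-t) = 1 := by rw [← Complex.exp_add]; simp
          linear_combination thc p * Complex.exp (-t) * vt p (t + Real.pi * Complex.I) ^ 2
            / vreg p t ^ 2 * this)
        (by
          simp only [thc, neg_zero, Complex.exp_zero, zero_add]
          field_simp
          ring)
      refine ((isBigO_one_of_analyticAt (analyticAt_wreg hp hp1)).add hB).congr' ?_
        EventuallyEq.rfl
      filter_upwards [exp_ne_one_nhdsNE, ((differentiable_vreg hp hp1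
        0).continuousAt.eventually_ne hne).filter_mono nhdsWithin_le_nhds] with t h1 h2
      have h3 : 1 - Complex.exp t ≠ 0 := sub_ne_zero.2 h1.symm
      have h4 : Complex.exp (-t) = (Complex.exp t)⁻¹ := Complex.exp_neg t
      have h5 := Complex.exp_ne_zero t
      rw [wp_eq, vt_eq t, phi, h4]
      field_simp
      ring)
  have h1 := hC t ht
  have h2 := hC _ hpi
  have h3 : vt p (Real.pi * Complex.I + Real.pi * Complex.I) = 0 := by
    simpa [vt_zero] using vt_add_pi_add_pi (p := p) 0
  simp only [h3, ne_eq, OfNat.ofNat_ne_zero, not_false_eq_true, zero_pow, zero_div, mul_zero,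
    add_zero] at h2
  linear_combination h1 - h2

lemma wp_add_pi_sub_eq (hp : 0 < p) (hp1 : p < 1) {t : ℂ}
    (ht : vt p (t + Real.pi * Complex.I) ≠ 0) :
    wp p (t + Real.pi * Complex.I) - wp p (Real.pi * Complex.I) =
      -thc p * (vt p t ^ 2 / vt p (t + Real.pi * Complex.I) ^ 2) := by
  rw [wp_sub_eq hp hp1 ht, vt_add_pi_add_pi]

lemma wp_sub_mul_wp_add_pi_sub (hp : 0 < p) (hp1 : p < 1) {t : ℂ} (h0 : vt p t ≠ 0)
    (ht : vt p (t + Real.pi * Complex.I) ≠ 0) :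
    (wp p t - wp p (Real.pi * Complex.I)) *
      (wp p (t + Real.pi * Complex.I) - wp p (Real.pi * Complex.I)) = thc p ^ 2 := by
  rw [wp_sub_eq hp hp1 h0, wp_add_pi_sub_eq hp hp1 ht]
  field_simp

lemma deriv_wp_eq_zero_of_periodic {s : ℂ} (h : Function.Periodic (wp p) (s + s)) :
    deriv (wp p) s = 0 := by
  have h1 := deriv_periodic h (-s)
  have h2 := deriv_comp_neg (wp p) s
  rw [show (fun x => wp p (-x)) = wp p from funext wp_neg] at h2
  rw [show -s + (s + s) = s by ring] at h1
  linear_combination (h1 + h2) / 2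

lemma deriv_wp_pi : deriv (wp p) (Real.pi * Complex.I) = 0 :=
  deriv_wp_eq_zero_of_periodic fun t => by
    rw [← add_assoc]
    exact wp_add_pi_add_pi t

lemma deriv_wp_half_log_add_pi (hp : 0 < p) (hp1 : p < 1) :
    deriv (wp p) (Real.log p / 2 + Real.pi * Complex.I) = 0 :=
  deriv_wp_eq_zero_of_periodic fun t => by
    rw [show t + (Real.log p / 2 + Real.pi * Complex.I + (Real.log p / 2 + Real.pi * Complex.I)) =
      t + Real.pi * Complex.I + Real.pi * Complex.I + Real.log p by ring,
      wp_periodic_log hp hp1, wp_add_pi_add_pi]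

lemma hasDerivAt_wp (hp : 0 < p) (hp1 : p < 1) {t : ℂ} (ht : vt p t ≠ 0) :
    HasDerivAt (wp p) (deriv (wp p) t) t :=
  (differentiableAt_wp hp hp1 ht).hasDerivAt

/-- The first integral of the differential equation, between two half periods. -/
lemma first_integral (hp : 0 < p) (hp1 : p < 1) {C : ℂ}
    (hC : ∀ t, vt p t ≠ 0 → HasDerivAt (deriv (wp p)) (C - 6 * wp p t ^ 2) t) :
    4 * wp p (Real.log p / 2 + Real.pi * Complex.I) ^ 3 -
        2 * C * wp p (Real.log p / 2 + Real.pi * Complex.I) =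
      4 * wp p (Real.pi * Complex.I) ^ 3 - 2 * C * wp p (Real.pi * Complex.I) := by
  have key : ∀ x : ℝ, HasDerivAt (fun x : ℝ => deriv (wp p) (x + Real.pi * Complex.I) ^ 2 +
      4 * wp p (x + Real.pi * Complex.I) ^ 3 - 2 * C * wp p (x + Real.pi * Complex.I)) 0 x := by
    intro x
    have hx := vt_real_add_pi_ne_zero hp hp1 x
    have h1 := (hasDerivAt_wp hp hp1 hx).comp_add_const (x : ℂ) (Real.pi * Complex.I)
    have h2 := (hC _ hx).comp_add_const (x : ℂ) (Real.pi * Complex.I)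
    refine HasDerivAt.comp_ofReal (e := fun x : ℂ => deriv (wp p) (x + Real.pi * Complex.I) ^ 2 +
      4 * wp p (x + Real.pi * Complex.I) ^ 3 - 2 * C * wp p (x + Real.pi * Complex.I)) ?_
    refine (((h2.fun_pow 2).fun_add ((h1.fun_pow 3).const_mul 4)).fun_sub
      (h1.const_mul (2 * C))).congr_deriv ?_
    push_cast
    ring
  have := is_const_of_deriv_eq_zero (fun x => (key x).differentiableAt) (fun x => (key x).deriv)
    (Real.log p / 2) 0
  simp only [Complex.ofReal_zero, zero_add, deriv_wp_pi] at this
  push_cast at this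
  rw [deriv_wp_half_log_add_pi hp hp1] at this
  linear_combination this

lemma deriv_vt_zero (hp : 0 < p) (hp1 : p < 1) : deriv (vt p) 0 = -vreg p 0 := by
  rw [deriv_vt hp hp1]
  simp

/-- The value of the second derivative of the Weierstrass function at the first half period. -/
lemma ode_const_eq (hp : 0 < p) (hp1 : p < 1) {C : ℂ}
    (hC : ∀ t, vt p t ≠ 0 → HasDerivAt (deriv (wp p)) (C - 6 * wp p t ^ 2) t) :
    C - 6 * wp p (Real.pi * Complex.I) ^ 2 = -2 * thc p ^ 2 := by
  have hpi := vt_pi_ne_zero hp hp1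
  have hdv := differentiable_vt hp hp1
  set u : ℂ → ℂ := fun t => vt p t / vt p (t + Real.pi * Complex.I) with hu
  have hne : vt p (0 + Real.pi * Complex.I) ≠ 0 := by simpa using hpi
  have hu0 : u 0 = 0 := by simp [hu, vt_zero]
  have hdu : deriv u 0 = -vreg p 0 / vt p (Real.pi * Complex.I) := by
    have h1 := (hdv 0).hasDerivAt
    have h2 := (hdv (0 + Real.pi * Complex.I)).hasDerivAt.comp_add_const 0 (Real.pi * Complex.I)
    refine (h1.div h2 hne).deriv.trans ?_
    rw [vt_zero, deriv_vt_zero hp hp1, zero_add]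
    field_simp
    ring
  have hua : AnalyticAt ℂ u 0 := by
    have h1 := hdv.analyticAt 0
    have h2 : AnalyticAt ℂ (fun t => vt p (t + Real.pi * Complex.I)) 0 :=
      Differentiable.analyticAt (by fun_prop) 0
    exact h1.div h2 hne
  have hev : (fun t => wp p (t + Real.pi * Complex.I)) =ᶠ[𝓝 0]
      fun t => wp p (Real.pi * Complex.I) - thc p * u t ^ 2 := by
    have h2 : Continuous (fun t => vt p (t + Real.pi * Complex.I)) := by
      have := hdv.continuous
      fun_prop
    filter_upwards [h2.continuousAt.eventually_ne hne] with t ht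
    have := wp_add_pi_sub_eq hp hp1 ht
    simp only [hu, div_pow]
    linear_combination this
  have hev2 : (fun t => deriv (wp p) (t + Real.pi * Complex.I)) =ᶠ[𝓝 0]
      fun t => -(thc p * (2 * (u t * deriv u t))) := by
    refine EventuallyEq.trans (Eventually.of_forall fun t => ?_)
      (hev.deriv.trans (hua.eventually_analyticAt.mono fun t ht => ?_))
    · exact (deriv_comp_add_const (wp p) (Real.pi * Complex.I) t).symm
    · refine (((ht.differentiableAt.hasDerivAt.fun_pow 2).const_mul (thc p)).const_sub
        _).deriv.trans ?_
      push_cast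
      ring
  have h1 := (hC _ hne).comp_add_const 0 (Real.pi * Complex.I)
  have h2 := (((hua.differentiableAt.hasDerivAt.fun_mul
    hua.deriv.differentiableAt.hasDerivAt).const_mul 2).const_mul (thc p)).fun_neg.congr_of_eventuallyEq
    hev2
  have h3 := h1.unique h2
  rw [hu0, hdu, zero_add] at h3
  rw [h3, thc]
  field_simp
  ring

/-- The sum of the half period values vanishes, and the constant of the differential equation is
the second symmetric function of these values. -/
lemma ode_const_eq_sum (hp : 0 < p) (hp1 : p < 1) {C : ℂ}
    (hC : ∀ t, vt p t ≠ 0 → HasDerivAt (deriv (wp p)) (C - 6 * wp p t ^ 2) t) :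
    C = wp p (Real.pi * Complex.I) ^ 2 + wp p (Real.log p / 2 + Real.pi * Complex.I) ^ 2 +
      wp p (Real.log p / 2) ^ 2 := by
  have h1 := first_integral hp hp1 hC
  have h2 := ode_const_eq hp hp1 hC
  have hne := vt_half_log_ne_zero hp hp1
  have hne2 := vt_real_add_pi_ne_zero hp hp1 (Real.log p / 2)
  push_cast at hne2
  have h3 := wp_sub_mul_wp_add_pi_sub hp hp1 hne hne2
  have h4 : wp p (Real.log p / 2 + Real.pi * Complex.I) - wp p (Real.pi * Complex.I) ≠ 0 := by
    intro h
    rw [h, mul_zero] at h3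
    exact pow_ne_zero 2 (thc_ne_zero hp hp1) h3.symm
  generalize wp p (Real.log p / 2 + Real.pi * Complex.I) = b at *
  generalize wp p (Real.log p / 2) = c at *
  generalize wp p (Real.pi * Complex.I) = a at *
  have h5 : C = 2 * (a ^ 2 + a * b + b ^ 2) := mul_left_cancel₀ h4 (by linear_combination -h1 / 2)
  have h6 : c = -a - b := mul_left_cancel₀ h4 (by linear_combination h3 + h2 / 2 - h5 / 2)
  rw [h6, h5]
  ring

lemma hasDerivAt_comp_affine {f : ℂ → ℂ} {f' k b t : ℂ} (h : HasDerivAt f f' (k * t + b)) :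
    HasDerivAt (fun t => f (k * t + b)) (k * f') t := by
  have h2 : HasDerivAt (fun t : ℂ => k * t + b) k t := by
    simpa using ((hasDerivAt_id t).const_mul k).add_const b
  exact (h.comp t h2).congr_deriv (mul_comm _ _)

lemma eventually_vt_affine_ne_zero (hp : 0 < p) (hp1 : p < 1) {b : ℂ} (hb : vt p b ≠ 0) (k : ℂ) :
    ∀ᶠ t in 𝓝 (0 : ℂ), vt p (k * t + b) ≠ 0 := by
  have h : Continuous fun t => vt p (k * t + b) := by
    have := (differentiable_vt hp hp1).continuous
    fun_prop
  exact h.continuousAt.eventually_ne (by simpa using hb)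

lemma hasDerivAt_vt_affine (hp : 0 < p) (hp1 : p < 1) {k b t : ℂ} (h : vt p (k * t + b) ≠ 0) :
    HasDerivAt (fun t => vt p (k * t + b)) (vt p (k * t + b) * (k * mlog p (k * t + b))) t := by
  refine (hasDerivAt_comp_affine (differentiable_vt hp hp1 _).hasDerivAt).congr_deriv ?_
  rw [mlog]
  field_simp

lemma hasDerivAt_log_mul {f g : ℂ → ℂ} {l m t : ℂ} (hf : HasDerivAt f (f t * l) t)
    (hg : HasDerivAt g (g t * m) t) :
    HasDerivAt (fun t => f t * g t) (f t * g t * (l + m)) t :=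
  (hf.fun_mul hg).congr_deriv (by ring)

lemma hasDerivAt_log_div {f g : ℂ → ℂ} {l m t : ℂ} (hf : HasDerivAt f (f t * l) t)
    (hg : HasDerivAt g (g t * m) t) (h : g t ≠ 0) :
    HasDerivAt (fun t => f t / g t) (f t / g t * (l - m)) t :=
  (hf.fun_div hg h).congr_deriv (by field_simp)

lemma hasDerivAt_log_pow {f : ℂ → ℂ} {l t : ℂ} (hf : HasDerivAt f (f t * l) t) (n : ℕ) :
    HasDerivAt (fun t => f t ^ n) (f t ^ n * (n * l)) t := by
  refine (hf.fun_pow n).congr_deriv ?_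
  cases n with
  | zero => simp
  | succ n => simp only [Nat.add_sub_cancel, pow_succ]; ring

lemma mlog_pi (hp : 0 < p) (hp1 : p < 1) : mlog p (Real.pi * Complex.I) = 1 / 2 := by
  have hpi := vt_pi_ne_zero hp hp1
  have hdv := differentiable_vt hp hp1
  have h1 := (hdv (0 + Real.pi * Complex.I)).hasDerivAt.comp_add_const 0 (Real.pi * Complex.I)
  have h2 : HasDerivAt (fun t => vt p (-t + Real.pi * Complex.I))
      (-deriv (vt p) (Real.pi * Complex.I)) 0 := by
    have := hasDerivAt_comp_affine (k := -1) (t := 0) (b := Real.pi * Complex.I) (hdv _).hasDerivAt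
    simpa using this
  have h3 : HasDerivAt (fun t : ℂ => Complex.exp (-t)) (-1) 0 := by
    simpa using (hasDerivAt_neg (0 : ℂ)).cexp
  have h4 := h3.fun_mul h1
  simp only [← vt_neg_add_pi] at h4
  have h5 := h2.unique h4
  simp only [neg_zero, Complex.exp_zero, zero_add] at h5
  rw [mlog, div_eq_iff hpi]
  linear_combination -h5 / 2

lemma taylor_four_of_log {X m m₁ m₂ m₃ : ℂ → ℂ}
    (d : ∀ᶠ t in 𝓝 0, HasDerivAt X (X t * m t) t) (d₀ : ∀ᶠ t in 𝓝 0, HasDerivAt m (m₁ t) t)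
    (d₁ : ∀ᶠ t in 𝓝 0, HasDerivAt m₁ (m₂ t) t) (d₂ : ∀ᶠ t in 𝓝 0, HasDerivAt m₂ (m₃ t) t)
    (d₃ : DifferentiableAt ℂ m₃ 0) (hX : X 0 = 1) (hm : m 0 = 0) :
    (fun t => X t - (1 + m₁ 0 / 2 * t ^ 2 + m₂ 0 / 6 * t ^ 3 +
      (m₃ 0 + 3 * m₁ 0 ^ 2) / 24 * t ^ 4)) =O[𝓝 0] fun t => t ^ 5 := by
  have key := taylor_four (h₀ := X) (h₁ := fun t => X t * m t)
    (h₂ := fun t => X t * (m t ^ 2 + m₁ t))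
    (h₃ := fun t => X t * (m t ^ 3 + 3 * m t * m₁ t + m₂ t))
    (h₄ := fun t => X t * (m t ^ 4 + 6 * m t ^ 2 * m₁ t + 3 * m₁ t ^ 2 + 4 * m t * m₂ t + m₃ t))
    d
    (by
      filter_upwards [d, d₀] with t h h0
      exact (h.fun_mul h0).congr_deriv (by ring))
    (by
      filter_upwards [d, d₀, d₁] with t h h0 h1
      refine (h.fun_mul ((h0.fun_pow 2).fun_add h1)).congr_deriv ?_
      push_cast
      ring)
    (by
      filter_upwards [d, d₀, d₁, d₂] with t h h0 h1 h2
      refine (h.fun_mul (((h0.fun_pow 3).fun_add ((h0.const_mul 3).fun_mul h1)).fun_add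
        h2)).congr_deriv ?_
      push_cast
      ring)
    (by
      have h := d.self_of_nhds.differentiableAt
      have h0 := d₀.self_of_nhds.differentiableAt
      have h1 := d₁.self_of_nhds.differentiableAt
      have h2 := d₂.self_of_nhds.differentiableAt
      fun_prop)
  refine key.congr_left fun t => ?_
  rw [hX, hm]
  ring

lemma isBigO_mul_sub_mul {f g F G : ℂ → ℂ} {n : ℕ}
    (hf : (fun t => f t - F t) =O[𝓝 0] fun t => t ^ n)
    (hg : (fun t => g t - G t) =O[𝓝 0] fun t => t ^ n)
    (hfc : ContinuousAt f 0) (hG : ContinuousAt G 0) :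
    (fun t => f t * g t - F t * G t) =O[𝓝 0] fun t => t ^ n := by
  have h1 := (hfc.tendsto.isBigO_one ℂ).mul hg
  have h2 := (hG.tendsto.isBigO_one ℂ).mul hf
  simp only [one_mul] at h1 h2
  exact (h1.add h2).congr_left fun t => by ring

/-- The first factor of the long-distance function, in the logarithmic variable. -/
noncomputable def facX (p : ℝ) (a t : ℂ) : ℂ :=
  Complex.exp t * vt p (t + a) ^ 4 * vt p (Real.pi * Complex.I) ^ 2 * vt p (3 * t + a) ^ 2 /
    (vt p a * vt p (t + Real.pi * Complex.I) ^ 2 * vt p (2 * t + a) ^ 5)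

lemma hasDerivAt_wp_affine (hp : 0 < p) (hp1 : p < 1) {k b t : ℂ} (h : vt p (k * t + b) ≠ 0) :
    HasDerivAt (fun t => wp p (k * t + b)) (k * deriv (wp p) (k * t + b)) t :=
  hasDerivAt_comp_affine (hasDerivAt_wp hp hp1 h)

lemma facX_taylor (hp : 0 < p) (hp1 : p < 1) {a C : ℂ} (ha : vt p a ≠ 0)
    (hC : ∀ t, vt p t ≠ 0 → HasDerivAt (deriv (wp p)) (C - 6 * wp p t ^ 2) t) :
    (fun t => facX p a t - (1 + (wp p a - wp p (Real.pi * Complex.I)) * t ^ 2 +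
      3 * deriv (wp p) a * t ^ 3 + ((86 * (C - 6 * wp p a ^ 2) + 4 * thc p ^ 2) / 24 +
        (wp p a - wp p (Real.pi * Complex.I)) ^ 2 / 2) * t ^ 4)) =O[𝓝 0] fun t => t ^ 5 := by
  have hpi := vt_pi_ne_zero hp hp1
  obtain ⟨κ, hκ⟩ := exists_wp_eq_add_vlog hp hp1
  have hev : ∀ᶠ t in 𝓝 (0 : ℂ), vt p (1 * t + a) ≠ 0 ∧ vt p (2 * t + a) ≠ 0 ∧
      vt p (3 * t + a) ≠ 0 ∧ vt p (1 * t + Real.pi * Complex.I) ≠ 0 :=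
    (eventually_vt_affine_ne_zero hp hp1 ha 1).and ((eventually_vt_affine_ne_zero hp hp1 ha 2).and
      ((eventually_vt_affine_ne_zero hp hp1 ha 3).and (eventually_vt_affine_ne_zero hp hp1 hpi 1)))
  have key := taylor_four_of_log (X := facX p a)
    (m := fun t => 1 + 4 * mlog p (1 * t + a) + 6 * mlog p (3 * t + a) - 10 * mlog p (2 * t + a)
      - 2 * mlog p (1 * t + Real.pi * Complex.I))
    (m₁ := fun t => 4 * wp p (1 * t + a) + 18 * wp p (3 * t + a) - 20 * wp p (2 * t + a)
      - 2 * wp p (1 * t + Real.pi * Complex.I))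
    (m₂ := fun t => 4 * deriv (wp p) (1 * t + a) + 54 * deriv (wp p) (3 * t + a)
      - 40 * deriv (wp p) (2 * t + a) - 2 * deriv (wp p) (1 * t + Real.pi * Complex.I))
    (m₃ := fun t => 4 * (C - 6 * wp p (1 * t + a) ^ 2) + 162 * (C - 6 * wp p (3 * t + a) ^ 2)
      - 80 * (C - 6 * wp p (2 * t + a) ^ 2) - 2 * (C - 6 * wp p (1 * t + Real.pi * Complex.I) ^ 2))
    (by
      filter_upwards [hev] with t ⟨h1, h2, h3, h4⟩
      have g1 := hasDerivAt_log_pow (hasDerivAt_vt_affine hp hp1 h1) 4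
      have g2 := hasDerivAt_log_pow (hasDerivAt_vt_affine hp hp1 h2) 5
      have g3 := hasDerivAt_log_pow (hasDerivAt_vt_affine hp hp1 h3) 2
      have g4 := hasDerivAt_log_pow (hasDerivAt_vt_affine hp hp1 h4) 2
      have ge : HasDerivAt Complex.exp (Complex.exp t * 1) t := by
        simpa using Complex.hasDerivAt_exp t
      have c1 : HasDerivAt (fun _ : ℂ => vt p (Real.pi * Complex.I) ^ 2)
        (vt p (Real.pi * Complex.I) ^ 2 * 0) t := by simpa using hasDerivAt_const t _
      have c2 : HasDerivAt (fun _ : ℂ => vt p a) (vt p a * 0) t := by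
        simpa using hasDerivAt_const t _
      have := hasDerivAt_log_div
        (hasDerivAt_log_mul (hasDerivAt_log_mul (hasDerivAt_log_mul ge g1) c1) g3)
        (hasDerivAt_log_mul (hasDerivAt_log_mul c2 g4) g2)
        (mul_ne_zero (mul_ne_zero ha (pow_ne_zero _ h4)) (pow_ne_zero _ h2))
      have hX : facX p a = fun t => Complex.exp t * vt p (1 * t + a) ^ 4 *
          vt p (Real.pi * Complex.I) ^ 2 * vt p (3 * t + a) ^ 2 /
          (vt p a * vt p (1 * t + Real.pi * Complex.I) ^ 2 * vt p (2 * t + a) ^ 5) := by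
        ext t
        simp only [facX, one_mul]
      rw [hX]
      refine this.congr_deriv ?_
      push_cast
      ring)
    (by
      filter_upwards [hev] with t ⟨h1, h2, h3, h4⟩
      have g1 := (hasDerivAt_comp_affine (hasDerivAt_mlog hp hp1 h1)).const_mul 4
      have g2 := (hasDerivAt_comp_affine (hasDerivAt_mlog hp hp1 h2)).const_mul 10
      have g3 := (hasDerivAt_comp_affine (hasDerivAt_mlog hp hp1 h3)).const_mul 6
      have g4 := (hasDerivAt_comp_affine (hasDerivAt_mlog hp hp1 h4)).const_mul 2
      refine ((((g1.const_add 1).fun_add g3).fun_sub g2).fun_sub g4).congr_deriv ?_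
      rw [hκ _ h1, hκ _ h2, hκ _ h3, hκ _ h4]
      ring)
    (by
      filter_upwards [hev] with t ⟨h1, h2, h3, h4⟩
      have g1 := (hasDerivAt_wp_affine hp hp1 h1).const_mul 4
      have g2 := (hasDerivAt_wp_affine hp hp1 h2).const_mul 20
      have g3 := (hasDerivAt_wp_affine hp hp1 h3).const_mul 18
      have g4 := (hasDerivAt_wp_affine hp hp1 h4).const_mul 2
      exact (((g1.fun_add g3).fun_sub g2).fun_sub g4).congr_deriv (by ring))
    (by
      filter_upwards [hev] with t ⟨h1, h2, h3, h4⟩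
      have g1 := (hasDerivAt_comp_affine (hC _ h1)).const_mul 4
      have g2 := (hasDerivAt_comp_affine (hC _ h2)).const_mul 40
      have g3 := (hasDerivAt_comp_affine (hC _ h3)).const_mul 54
      have g4 := (hasDerivAt_comp_affine (hC _ h4)).const_mul 2
      exact (((g1.fun_add g3).fun_sub g2).fun_sub g4).congr_deriv (by ring))
    (by
      obtain ⟨h1, h2, h3, h4⟩ := hev.self_of_nhds
      have g1 := (hasDerivAt_wp_affine hp hp1 h1).differentiableAt
      have g2 := (hasDerivAt_wp_affine hp hp1 h2).differentiableAt
      have g3 := (hasDerivAt_wp_affine hp hp1 h3).differentiableAt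
      have g4 := (hasDerivAt_wp_affine hp hp1 h4).differentiableAt
      fun_prop)
    (by
      simp only [facX, Complex.exp_zero, mul_zero, zero_add, one_mul]
      field_simp)
    (by
      simp only [mul_zero, zero_add, mlog_pi hp hp1]
      ring)
  refine key.congr_left fun t => ?_
  simp only [mul_zero, zero_add, deriv_wp_pi]
  linear_combination t ^ 4 / 12 * ode_const_eq hp hp1 hC

lemma wp_affine_taylor (hp : 0 < p) (hp1 : p < 1) {k b C : ℂ} (hb : vt p b ≠ 0)
    (hC : ∀ t, vt p t ≠ 0 → HasDerivAt (deriv (wp p)) (C - 6 * wp p t ^ 2) t) :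
    (fun t => wp p (k * t + b) - (wp p b + k * deriv (wp p) b * t +
      k ^ 2 * (C - 6 * wp p b ^ 2) / 2 * t ^ 2 - 2 * k ^ 3 * wp p b * deriv (wp p) b * t ^ 3 -
      k ^ 4 * (deriv (wp p) b ^ 2 + wp p b * (C - 6 * wp p b ^ 2)) / 2 * t ^ 4)) =O[𝓝 0]
        fun t => t ^ 5 := by
  have hev := eventually_vt_affine_ne_zero hp hp1 hb k
  have key := taylor_four (h₀ := fun t => wp p (k * t + b))
    (h₁ := fun t => k * deriv (wp p) (k * t + b))
    (h₂ := fun t => k ^ 2 * (C - 6 * wp p (k * t + b) ^ 2))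
    (h₃ := fun t => -12 * k ^ 3 * (wp p (k * t + b) * deriv (wp p) (k * t + b)))
    (h₄ := fun t => -12 * k ^ 4 * (deriv (wp p) (k * t + b) ^ 2 +
      wp p (k * t + b) * (C - 6 * wp p (k * t + b) ^ 2)))
    (hev.mono fun t ht => hasDerivAt_wp_affine hp hp1 ht)
    (hev.mono fun t ht => ((hasDerivAt_comp_affine (hC _ ht)).const_mul k).congr_deriv (by ring))
    (hev.mono fun t ht => by
      refine (((((hasDerivAt_wp_affine hp hp1 ht).fun_pow 2).const_mul 6).const_sub C).const_mul
        (k ^ 2)).congr_deriv ?_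
      push_cast
      ring)
    (hev.mono fun t ht => (((hasDerivAt_wp_affine hp hp1 ht).fun_mul
      (hasDerivAt_comp_affine (hC _ ht))).const_mul (-12 * k ^ 3)).congr_deriv (by ring))
    (by
      have h1 := (hasDerivAt_wp_affine hp hp1 hev.self_of_nhds).differentiableAt
      have h2 := (hasDerivAt_comp_affine (hC _ hev.self_of_nhds)).differentiableAt
      fun_prop)
  refine key.congr_left fun t => ?_
  simp only [mul_zero, zero_add]
  ring

lemma isBigO_mul_pow_poly {x₂ x₃ x₄ e p₂ p₃ p₄ : ℂ} :
    (fun t : ℂ => (1 + x₂ * t ^ 2 + x₃ * t ^ 3 + x₄ * t ^ 4) * (1 + (-t ^ 2 + e * t ^ 4) *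
      (x₂ + x₃ * t + p₂ * t ^ 2 + p₃ * t ^ 3 + p₄ * t ^ 4)) -
      (1 + (x₄ - x₂ ^ 2 + e * x₂ - p₂) * t ^ 4)) =O[𝓝 0] fun t => t ^ 5 := by
  have hc : ContinuousAt (fun t : ℂ => (e * x₃ - p₃ + (e * p₂ - p₄) * t + e * p₃ * t ^ 2 +
      e * p₄ * t ^ 3) * (1 + x₂ * t ^ 2 + x₃ * t ^ 3 + x₄ * t ^ 4) + (-2 * x₂ * x₃ +
      (x₂ * (e * x₂ - p₂) - x₃ ^ 2 - x₄ * x₂) * t + (x₃ * (e * x₂ - p₂) - x₄ * x₃) * t ^ 2 +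
      x₄ * (e * x₂ - p₂) * t ^ 3)) 0 := by fun_prop
  refine ((hc.tendsto.isBigO_one ℂ).mul (isBigO_refl (fun t : ℂ => t ^ 5) _)).congr
    (fun t => by ring) (fun t => one_mul _)

/-- The second factor of the long-distance function, in the logarithmic variable. -/
noncomputable def facY (p : ℝ) (l t : ℂ) : ℂ :=
  1 + vt p t ^ 2 * vt p (3 * t + l) ^ 2 /
    (vt p (t + Real.pi * Complex.I) ^ 2 * vt p (3 * t + (l + Real.pi * Complex.I)) ^ 2)

lemma facX_mul_facY_taylor (hp : 0 < p) (hp1 : p < 1) {l C : ℂ}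
    (ha : vt p (l + Real.pi * Complex.I) ≠ 0)
    (hC : ∀ t, vt p t ≠ 0 → HasDerivAt (deriv (wp p)) (C - 6 * wp p t ^ 2) t) :
    (fun t => facX p (l + Real.pi * Complex.I) t * facY p l t -
      (1 + 12 * (10 * wp p (l + Real.pi * Complex.I) ^ 2 +
        4 * wp p (Real.pi * Complex.I) * wp p (l + Real.pi * Complex.I) -
        2 * wp p (Real.pi * Complex.I) ^ 2 - 2 * C) / 24 * t ^ 4)) =O[𝓝 0] fun t => t ^ 5 := by
  have hpi := vt_pi_ne_zero hp hp1
  have hA := thc_ne_zero hp hp1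
  have hode := ode_const_eq hp hp1 hC
  have hX := facX_taylor hp hp1 ha hC
  have hQ := wp_affine_taylor hp hp1 (k := 1) hpi hC
  have hP := wp_affine_taylor hp hp1 (k := 3) ha hC
  rw [deriv_wp_pi, hode] at hQ
  have cont : ∀ {k b : ℂ}, vt p b ≠ 0 → ContinuousAt (fun t => wp p (k * t + b)) 0 :=
    fun hb => (hasDerivAt_wp_affine hp hp1
      (eventually_vt_affine_ne_zero hp hp1 hb _).self_of_nhds).continuousAt
  have cP := cont (k := 3) ha
  have cQ := cont (k := 1) hpi
  have hY : facY p l =ᶠ[𝓝 0] fun t => 1 + (wp p (1 * t + Real.pi * Complex.I) -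
      wp p (Real.pi * Complex.I)) * (wp p (3 * t + (l + Real.pi * Complex.I)) -
      wp p (Real.pi * Complex.I)) / thc p ^ 2 := by
    filter_upwards [eventually_vt_affine_ne_zero hp hp1 hpi 1,
      eventually_vt_affine_ne_zero hp hp1 ha 3] with t h1 h2
    rw [one_mul] at h1 ⊢
    rw [← add_assoc] at h2 ⊢
    rw [wp_add_pi_sub_eq hp hp1 h1, wp_add_pi_sub_eq hp hp1 h2, facY, ← add_assoc]
    have := thc_ne_zero hp hp1
    field_simp
  generalize l + Real.pi * Complex.I = a at *
  generalize wp p (Real.pi * Complex.I) = e at *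
  generalize deriv (wp p) a = P₁ at *
  generalize thc p = A at *
  have cX : ContinuousAt (facX p a) 0 := by
    have hdv := (differentiable_vt hp hp1).continuous
    unfold facX
    have : vt p a * vt p (0 + Real.pi * Complex.I) ^ 2 * vt p (2 * 0 + a) ^ 5 ≠ 0 := by
      simpa [hpi] using ha
    fun_prop (disch := assumption)
  generalize wp p a = P at *
  have h1 := isBigO_mul_sub_mul (hQ.congr_left fun t => (sub_sub_sub_cancel_right _ _ e).symm)
    (hP.congr_left fun t => (sub_sub_sub_cancel_right _ _ e).symm)
    (by fun_prop) (by fun_prop)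
  have h2 : (fun t => facY p l t - (1 + (-t ^ 2 + e * t ^ 4) * (P - e + 3 * P₁ * t +
      9 * (C - 6 * P ^ 2) / 2 * t ^ 2 + -54 * P * P₁ * t ^ 3 +
      -81 * (P₁ ^ 2 + P * (C - 6 * P ^ 2)) / 2 * t ^ 4))) =O[𝓝 0] fun t => t ^ 5 :=
    (h1.const_mul_left (A ^ 2)⁻¹).congr' (hY.mono fun t ht => by
      beta_reduce at ht ⊢
      rw [ht]
      field_simp
      ring) EventuallyEq.rfl
  have h3 := isBigO_mul_sub_mul hX h2 cX (by fun_prop)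
  refine (h3.add (isBigO_mul_pow_poly (x₂ := P - e) (x₃ := 3 * P₁)
    (x₄ := (86 * (C - 6 * P ^ 2) + 4 * A ^ 2) / 24 + (P - e) ^ 2 / 2) (e := e)
    (p₂ := 9 * (C - 6 * P ^ 2) / 2) (p₃ := -54 * P * P₁)
    (p₄ := -81 * (P₁ ^ 2 + P * (C - 6 * P ^ 2)) / 2))).congr_left fun t => ?_
  linear_combination (-t ^ 4 / 12) * hode

lemma ofReal_tprod (f : ℕ → ℝ) : ((∏' n, f n : ℝ) : ℂ) = ∏' n, (f n : ℂ) :=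
  Topology.IsClosedEmbedding.map_tprod (g := Complex.ofRealHom) f
    (Complex.isometry_ofReal.isClosedEmbedding)

lemma ofReal_thetaR {q s : ℝ} {t : ℂ} (hq : q ∈ Set.Ioo (0 : ℝ) 1) (h : Complex.exp t = s) :
    ((thetaR q s : ℝ) : ℂ) = vt (q ^ 2) t := by
  have hp : 0 < q ^ 2 := pow_pos hq.1 2
  have hp1 : q ^ 2 < 1 := pow_lt_one₀ hq.1.le hq.2 two_ne_zero
  have h1 : ∏' i : ℕ, (1 - (s : ℂ) * ((q : ℂ) ^ (2 * i))) =
      (1 - s) * ∏' i : ℕ, (1 - (s : ℂ) * ((q ^ 2 : ℝ) : ℂ) ^ (i + 1)) := by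
    have := tprod_eq_zero_mul' (f := fun i => 1 - (s : ℂ) * ((q ^ 2 : ℝ) : ℂ) ^ i)
      (multipliable_qp hp hp1 s)
    simpa [pow_mul] using this
  have h2 : Complex.exp (-t) = (s : ℂ)⁻¹ := by rw [Complex.exp_neg, h]
  simp only [thetaR, vt, qp, Complex.ofReal_mul, ofReal_tprod, h, h2]
  push_cast at h1 ⊢
  rw [h1]
  simp only [pow_mul, div_eq_mul_inv, mul_assoc, mul_comm (s : ℂ)⁻¹]

lemma ofReal_W {q s : ℝ} {t : ℂ} (h : Complex.exp t = s) :
    ((W q s : ℝ) : ℂ) = wp (q ^ 2) t := by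
  have h2 : Complex.exp (-t) = (s : ℂ)⁻¹ := by rw [Complex.exp_neg, h]
  simp only [W, wp, lam, phi, h, h2]
  push_cast
  simp only [pow_mul, div_eq_mul_inv, mul_comm (s : ℂ)⁻¹, one_mul]
  ring

lemma exp_log_add_pi {x : ℝ} (hx : 0 < x) :
    Complex.exp (Real.log x + Real.pi * Complex.I) = ((-x : ℝ) : ℂ) := by
  rw [exp_pi_add, exp_log_ofReal hx, Complex.ofReal_neg]

lemma ofReal_Gt {q r c : ℝ} (hq : q ∈ Set.Ioo (0 : ℝ) 1) (hr : 0 < r) (hc : 0 < c) :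
    ((Gt q r c : ℝ) : ℂ) = facX (q ^ 2) (Real.log r + Real.pi * Complex.I) (Real.log c) *
      facY (q ^ 2) (Real.log r) (Real.log c) := by
  have hmul : ∀ k : ℕ, Complex.exp (k * Real.log c + Real.log r) = ((r * c ^ k : ℝ) : ℂ) := by
    intro k
    rw [Complex.exp_add, Complex.exp_nat_mul, exp_log_ofReal hc, exp_log_ofReal hr]
    push_cast
    ring
  have hmul' : ∀ k : ℕ, Complex.exp (k * Real.log c + (Real.log r + Real.pi * Complex.I)) =
      ((-r * c ^ k : ℝ) : ℂ) := by
    intro k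
    rw [← add_assoc, exp_pi_add, hmul]
    push_cast
    ring
  have h3 := ofReal_thetaR hq (hmul 3)
  have h1' := ofReal_thetaR hq (hmul' 1)
  have h2' := ofReal_thetaR hq (hmul' 2)
  have h3' := ofReal_thetaR hq (hmul' 3)
  have hc' := ofReal_thetaR hq (exp_log_add_pi hc)
  have hc0 := ofReal_thetaR hq (exp_log_ofReal hc)
  have hr' := ofReal_thetaR hq (exp_log_add_pi hr)
  have hpi := ofReal_thetaR hq (exp_log_add_pi one_pos)
  simp only [Real.log_one, Complex.ofReal_zero, zero_add, pow_one, Nat.cast_one, one_mul,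
    Nat.cast_ofNat] at h3 h1' h2' h3' hpi
  simp only [Gt, facX, facY, Complex.ofReal_mul, Complex.ofReal_div, Complex.ofReal_add,
    Complex.ofReal_pow, Complex.ofReal_one, h3, h1', h2', h3', hc', hc0, hr', hpi,
    exp_log_ofReal hc]

lemma analyticAt_facX_mul_facY (hp : 0 < p) (hp1 : p < 1) {l : ℂ}
    (ha : vt p (l + Real.pi * Complex.I) ≠ 0) :
    AnalyticAt ℂ (fun t => facX p (l + Real.pi * Complex.I) t * facY p l t) 0 := by
  have hpi := vt_pi_ne_zero hp hp1
  have hv : ∀ k b : ℂ, AnalyticAt ℂ (fun t => vt p (k * t + b)) 0 := fun k b => by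
    have := differentiable_vt hp hp1
    exact Differentiable.analyticAt (by fun_prop) 0
  have v0 : AnalyticAt ℂ (vt p) 0 := by simpa using hv 1 0
  have v1 : ∀ b : ℂ, AnalyticAt ℂ (fun t => vt p (t + b)) 0 := by simpa using hv 1
  have h1 : vt p (l + Real.pi * Complex.I) * vt p (0 + Real.pi * Complex.I) ^ 2 *
      vt p (2 * 0 + (l + Real.pi * Complex.I)) ^ 5 ≠ 0 := by
    simpa [hpi] using ha
  have h2 : vt p (0 + Real.pi * Complex.I) ^ 2 *
      vt p (3 * 0 + (l + Real.pi * Complex.I)) ^ 2 ≠ 0 := by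
    simpa [hpi] using ha
  unfold facX facY
  have := hv 2
  have := hv 3
  fun_prop (disch := assumption)

end

lemma isBigO_log_one_add : (fun x : ℝ => Real.log (1 + x)) =O[𝓝 0] fun x => x := by
  have h : HasDerivAt (fun x : ℝ => Real.log (1 + x)) 1 0 := by
    simpa using ((hasDerivAt_id (0 : ℝ)).const_add 1).log (by simp)
  simpa using h.differentiableAt.isBigO_sub

lemma isBigO_log_one_add_sub : (fun x : ℝ => Real.log (1 + x) - x) =O[𝓝 0] fun x => x ^ 2 := by
  have h1 : ∀ᶠ x : ℝ in 𝓝 0, HasDerivAt (fun x : ℝ => Real.log (1 + x) - x) ((1 + x)⁻¹ - 1) x := by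
    filter_upwards [eventually_gt_nhds (show (-1 : ℝ) < 0 by norm_num)] with x hx
    have := (((hasDerivAt_id x).const_add 1).log
      (by simp only [id]; linarith : 1 + id x ≠ 0)).fun_sub (hasDerivAt_id x)
    simpa using this
  have h2 : (fun x : ℝ => (1 + x)⁻¹ - 1) =O[𝓝 0] fun x => x ^ 1 := by
    have h : DifferentiableAt ℝ (fun x : ℝ => (1 + x)⁻¹) 0 := by
      fun_prop (disch := norm_num)
    simpa using h.isBigO_sub
  simpa using isBigO_sub_of_deriv h1 h2

lemma isBigO_log_one_add_pow :
    (fun x : ℝ => Real.log (1 + x) ^ 4 - x ^ 4) =O[𝓝 0] fun x => x ^ 5 := by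
  have h1 := isBigO_log_one_add
  have h0 := isBigO_refl (fun x : ℝ => x) (𝓝 0)
  have h2 := (isBigO_log_one_add_sub.mul (h1.add h0)).mul ((h1.pow 2).add (h0.pow 2))
  exact h2.congr (fun x => by ring) (fun x => by ring)

/-- The iterated derivatives are the coefficients of a fourth order expansion. -/
lemma iteratedDeriv_of_isBigO {f : ℝ → ℝ} {b : ℝ} (hf : AnalyticAt ℝ f 1)
    (h : (fun x => f (1 + x) - (1 + b / 24 * x ^ 4)) =O[𝓝 0] fun x => x ^ 5) :
    f 1 = 1 ∧ iteratedDeriv 1 f 1 = 0 ∧ iteratedDeriv 2 f 1 = 0 ∧ iteratedDeriv 3 f 1 = 0 ∧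
      iteratedDeriv 4 f 1 = b := by
  have ht : Tendsto (fun x : ℝ => 1 + x) (𝓝 0) (𝓝 1) := by
    have : ContinuousAt (fun x : ℝ => 1 + x) 0 := by fun_prop
    simpa using this.tendsto
  have han : ∀ n, AnalyticAt ℝ (iteratedDeriv n f) 1 := fun n => by
    rw [iteratedDeriv_eq_iterate]
    exact hf.iterated_deriv n
  have hd : ∀ n, ∀ᶠ x : ℝ in 𝓝 0, HasDerivAt (fun x => iteratedDeriv n f (1 + x))
      (iteratedDeriv (n + 1) f (1 + x)) x := fun n => by
    filter_upwards [ht.eventually (han n).eventually_analyticAt] with x hx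
    rw [iteratedDeriv_succ]
    exact hx.differentiableAt.hasDerivAt.comp_const_add 1 x
  have key := taylor_four (hd 0) (hd 1) (hd 2) (hd 3)
    (by
      have h4 : DifferentiableAt ℝ (iteratedDeriv 4 f) (1 + 0) := by
        simpa using (han 4).differentiableAt
      exact (h4.hasDerivAt.comp_const_add 1 0).differentiableAt)
  simp only [add_zero, iteratedDeriv_zero] at key
  obtain ⟨h0, h1, h2, h3, h4⟩ := coeff_eq_zero_of_isBigO (b₀ := f 1 - 1)
    (b₁ := iteratedDeriv 1 f 1) (b₂ := iteratedDeriv 2 f 1 / 2) (b₃ := iteratedDeriv 3 f 1 / 6)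
    (b₄ := iteratedDeriv 4 f 1 / 24 - b / 24)
    (((h.sub key).congr_left fun t => by ring).mono nhdsWithin_le_nhds)
  refine ⟨?_, ?_, ?_, ?_, ?_⟩ <;> linarith

lemma analyticAt_Gt {q r : ℝ} (hq : q ∈ Set.Ioo (0 : ℝ) 1) (hr : 0 < r) :
    AnalyticAt ℝ (Gt q r) 1 := by
  have hp : 0 < q ^ 2 := pow_pos hq.1 2
  have hp1 : q ^ 2 < 1 := pow_lt_one₀ hq.1.le hq.2 two_ne_zero
  have h := analyticAt_facX_mul_facY hp hp1 (vt_real_add_pi_ne_zero hp hp1 (Real.log r))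
  have hlog : AnalyticAt ℂ Complex.log ((1 : ℝ) : ℂ) := analyticAt_clog (by simp)
  have h2 := (AnalyticAt.comp_of_eq h hlog (by simp)).re_ofReal
  refine h2.congr ?_
  filter_upwards [eventually_gt_nhds (show (0 : ℝ) < 1 by norm_num)] with c hc
  simp only [Function.comp_apply, ← Complex.ofReal_log hc.le]
  rw [← ofReal_Gt hq hr hc, Complex.ofReal_re]

lemma ofReal_values {q : ℝ} (hq : q ∈ Set.Ioo (0 : ℝ) 1) :
    ((e1 q : ℝ) : ℂ) = wp (q ^ 2) (Real.pi * Complex.I) ∧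
    ((e2 q : ℝ) : ℂ) = wp (q ^ 2) (Real.log (q ^ 2) / 2 + Real.pi * Complex.I) ∧
    ((e3 q : ℝ) : ℂ) = wp (q ^ 2) (Real.log (q ^ 2) / 2) := by
  have hl : ((Real.log (q ^ 2) : ℝ) : ℂ) / 2 = Real.log q := by
    rw [Real.log_pow]
    push_cast
    ring
  rw [hl]
  exact ⟨ofReal_W (by simp), ofReal_W (exp_log_add_pi hq.1), ofReal_W (exp_log_ofReal hq.1)⟩

lemma Gt_taylor {q r : ℝ} (hq : q ∈ Set.Ioo (0 : ℝ) 1) (hr : 0 < r) :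
    (fun x => Gt q r (1 + x) - (1 + 12 * (10 * W q (-r) ^ 2 + 4 * e1 q * W q (-r) -
      2 * e1 q ^ 2 - g2 q) / 24 * x ^ 4)) =O[𝓝 0] fun x => x ^ 5 := by
  have hp : 0 < q ^ 2 := pow_pos hq.1 2
  have hp1 : q ^ 2 < 1 := pow_lt_one₀ hq.1.le hq.2 two_ne_zero
  obtain ⟨C, hC⟩ := exists_ode hp hp1
  have hT := facX_mul_facY_taylor hp hp1 (vt_real_add_pi_ne_zero hp hp1 (Real.log r)) hC
  obtain ⟨he1, he2, he3⟩ := ofReal_values hq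
  have hg : 2 * C = ((g2 q : ℝ) : ℂ) := by
    rw [ode_const_eq_sum hp hp1 hC, ← he1, ← he2, ← he3, g2]
    push_cast
    ring
  rw [hg, ← he1, ← ofReal_W (exp_log_add_pi hr)] at hT
  set b : ℝ := 12 * (10 * W q (-r) ^ 2 + 4 * e1 q * W q (-r) - 2 * e1 q ^ 2 - g2 q) / 24 with hb
  have hlim : Tendsto (fun x : ℝ => (Real.log (1 + x) : ℂ)) (𝓝 0) (𝓝 0) := by
    have : ContinuousAt (fun x : ℝ => (Real.log (1 + x) : ℂ)) 0 := by
      fun_prop (disch := norm_num)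
    simpa using this.tendsto
  have h1 := hT.comp_tendsto hlim
  have h2 : (fun x => Gt q r (1 + x) - (1 + b * Real.log (1 + x) ^ 4)) =O[𝓝 0]
      fun x => Real.log (1 + x) ^ 5 := by
    refine IsBigO.of_norm_norm (h1.norm_norm.congr' ?_ (Eventually.of_forall fun x => ?_))
    · filter_upwards [eventually_gt_nhds (show (-1 : ℝ) < 0 by norm_num)] with x hx
      rw [← Complex.norm_real]
      simp only [Function.comp_apply]
      rw [← ofReal_Gt hq hr (by linarith : 0 < 1 + x), hb]
      push_cast
      rfl
    · simp only [Function.comp_apply]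
      rw [← Complex.norm_real]
      push_cast
      rfl
  have h3 := (h2.trans (isBigO_log_one_add.pow 5)).add (isBigO_log_one_add_pow.const_mul_left b)
  exact h3.congr_left fun x => by ring

end ThetaW

/-- `G̃` is smooth near `c = 1`, `G̃(1) = 1`, its first three derivatives vanish
at `c = 1`, and `G̃⁗(1) = 12(10 W_q(-r)² + 4 e₁ W_q(-r) - 2 e₁² - g₂)`. -/
theorem Gt_derivatives_at_one (q r : ℝ) (hq : q ∈ Set.Ioo (0 : ℝ) 1) (hr : 0 < r) :
    ContDiffAt ℝ (⊤ : ℕ∞) (Gt q r) 1 ∧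
    Gt q r 1 = 1 ∧
    iteratedDeriv 1 (Gt q r) 1 = 0 ∧
    iteratedDeriv 2 (Gt q r) 1 = 0 ∧
    iteratedDeriv 3 (Gt q r) 1 = 0 ∧
    iteratedDeriv 4 (Gt q r) 1
      = 12 * (10 * W q (-r) ^ 2 + 4 * e1 q * W q (-r) - 2 * e1 q ^ 2 - g2 q) := by
  obtain ⟨h0, h1, h2, h3, h4⟩ := ThetaW.iteratedDeriv_of_isBigO (ThetaW.analyticAt_Gt hq hr)
    (ThetaW.Gt_taylor hq hr)
  exact ⟨(ThetaW.analyticAt_Gt hq hr).contDiffAt, h0, h1, h2, h3, h4⟩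
end

section
/- Fix q ∈ (0,1) and r > 0. Then lim_{c→1⁻} (G̃(c) − 1)/(1 − c)⁴ = κ(r;q). Equivalently, the long-distance unfolded 2-correlation G^∨(x;r) = G̃(x²) satisfies G^∨(x;r) ~ 1 + κ(r;q)·(1 − x²)⁴ as x ↑ 1, i.e. the decay exponent is η = 4 with coefficient κ(r;q). -/
/-- `κ(r;q) = 5 W_q(-r)² + 2 e₁ W_q(-r) - (e₁² + g₂/2)`. -/
noncomputable def kappa (q r : ℝ) : ℝ :=
  5 * W q (-r) ^ 2 + 2 * e1 q * W q (-r) - (e1 q ^ 2 + g2 q / 2)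

open Filter Topology

/-- The product `∏ (1 + x q^{2(i+1)})`. -/
noncomputable def shiftedProd (q x : ℝ) : ℝ := ∏' i : ℕ, (1 + x * q ^ (2 * (i + 1)))

/-- The summands of the Lambert series in `W`. -/
noncomputable def lambertTerm (q x : ℝ) (i : ℕ) : ℝ :=
  x * q ^ (2 * (i + 1)) / (1 + x * q ^ (2 * (i + 1))) ^ 2

section Products

variable {q : ℝ}

theorem summable_sq_pow (hq : q ∈ Set.Ioo (0 : ℝ) 1) :
    Summable fun i : ℕ => q ^ (2 * (i + 1)) := by
  have h : Summable fun i : ℕ => (q ^ 2) ^ (i + 1) :=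
    (summable_nat_add_iff 1).2
      (summable_geometric_of_lt_one (sq_nonneg q) (by nlinarith [hq.1, hq.2]))
  simpa only [← pow_mul] using h

theorem multipliable_shifted (hq : q ∈ Set.Ioo (0 : ℝ) 1) (x : ℝ) :
    Multipliable fun i : ℕ => (1 + x * q ^ (2 * (i + 1))) :=
  Real.multipliable_one_add_of_summable ((summable_sq_pow hq).mul_left x)

theorem multipliable_unshifted (hq : q ∈ Set.Ioo (0 : ℝ) 1) (x : ℝ) :
    Multipliable fun i : ℕ => (1 + x * q ^ (2 * i)) := by
  refine Real.multipliable_one_add_of_summable (Summable.mul_left x ?_)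
  exact (summable_nat_add_iff 1).1 (summable_sq_pow hq)

theorem tprod_unshifted (hq : q ∈ Set.Ioo (0 : ℝ) 1) (x : ℝ) :
    ∏' i : ℕ, (1 + x * q ^ (2 * i)) = (1 + x) * shiftedProd q x := by
  have := tprod_eq_zero_mul' (f := fun i : ℕ => (1 + x * q ^ (2 * i)))
    (multipliable_shifted hq x)
  simpa [shiftedProd] using this

theorem shiftedProd_eq_mul (hq : q ∈ Set.Ioo (0 : ℝ) 1) (x : ℝ) :
    shiftedProd q x = (1 + q ^ 2 * x) * shiftedProd q (q ^ 2 * x) := by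
  rw [← tprod_unshifted hq, shiftedProd]
  refine tprod_congr fun i => ?_
  ring

theorem shiftedProd_ne_zero (hq : q ∈ Set.Ioo (0 : ℝ) 1) {x : ℝ}
    (hx : ∀ i : ℕ, 1 + x * q ^ (2 * (i + 1)) ≠ 0) : shiftedProd q x ≠ 0 :=
  tprod_one_add_ne_zero_of_summable hx ((summable_sq_pow hq).mul_left x).norm

theorem one_add_mul_pow_ne_zero (hq : q ∈ Set.Ioo (0 : ℝ) 1) {x : ℝ} (hx : -1 ≤ x) (i : ℕ) :
    1 + x * q ^ (2 * (i + 1)) ≠ 0 := by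
  have h1 : q ^ (2 * (i + 1)) < 1 := pow_lt_one₀ hq.1.le hq.2 (by omega)
  have h0 : 0 < q ^ (2 * (i + 1)) := pow_pos hq.1 _
  nlinarith

theorem thetaR_neg_eq (hq : q ∈ Set.Ioo (0 : ℝ) 1) (x : ℝ) :
    thetaR q (-x) = (1 + x) * shiftedProd q x * shiftedProd q x⁻¹ := by
  rw [← tprod_unshifted hq, thetaR, shiftedProd]
  congr 1 <;> refine tprod_congr fun i => ?_
  · ring
  · rw [div_neg, sub_neg_eq_add, div_eq_mul_inv, mul_comm]

theorem thetaR_neg_inv (hq : q ∈ Set.Ioo (0 : ℝ) 1) {x : ℝ} (hx : x ≠ 0) :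
    x * thetaR q (-x⁻¹) = thetaR q (-x) := by
  rw [thetaR_neg_eq hq, thetaR_neg_eq hq, inv_inv]
  field_simp
  ring

theorem thetaR_neg_sq_mul (hq : q ∈ Set.Ioo (0 : ℝ) 1) {x : ℝ} (hx : x ≠ 0) :
    x * thetaR q (-(q ^ 2 * x)) = thetaR q (-x) := by
  have hq0 := hq.1.ne'
  rw [thetaR_neg_eq hq, thetaR_neg_eq hq, shiftedProd_eq_mul hq x,
    shiftedProd_eq_mul hq (q ^ 2 * x)⁻¹,
    show q ^ 2 * (q ^ 2 * x)⁻¹ = x⁻¹ by field_simp]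
  field_simp
  ring

theorem thetaR_one (hq : q ∈ Set.Ioo (0 : ℝ) 1) : thetaR q 1 = 0 := by
  simpa using thetaR_neg_eq hq (-1)

theorem thetaR_neg_ne_zero_of_pos (hq : q ∈ Set.Ioo (0 : ℝ) 1) {x : ℝ} (hx : 0 < x) :
    thetaR q (-x) ≠ 0 := by
  rw [thetaR_neg_eq hq]
  have hx' : 0 < x⁻¹ := inv_pos.2 hx
  exact mul_ne_zero (mul_ne_zero (by positivity)
    (shiftedProd_ne_zero hq (one_add_mul_pow_ne_zero hq (by linarith))))
    (shiftedProd_ne_zero hq (one_add_mul_pow_ne_zero hq (by linarith)))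

theorem tendsto_shiftedProd (hq : q ∈ Set.Ioo (0 : ℝ) 1) (x : ℝ) :
    Tendsto (shiftedProd q) (𝓝 x) (𝓝 (shiftedProd q x)) := by
  refine tendsto_tprod_one_add_of_dominated_convergence
    ((summable_sq_pow hq).mul_left (|x| + 1)) (fun i => ?_) ?_
  · exact (continuous_id.mul continuous_const).tendsto x
  · filter_upwards [(continuous_abs.tendsto x).eventually (gt_mem_nhds (lt_add_one |x|))]
      with y hy i
    have h0 : 0 < q ^ (2 * (i + 1)) := pow_pos hq.1 _
    rw [norm_mul, Real.norm_eq_abs, Real.norm_of_nonneg h0.le]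
    gcongr

theorem tendsto_thetaR_neg (hq : q ∈ Set.Ioo (0 : ℝ) 1) {x : ℝ} (hx : x ≠ 0) :
    Tendsto (fun y => thetaR q (-y)) (𝓝 x) (𝓝 (thetaR q (-x))) := by
  simp_rw [thetaR_neg_eq hq]
  exact ((tendsto_const_nhds.add tendsto_id).mul (tendsto_shiftedProd hq x)).mul
    ((tendsto_shiftedProd hq x⁻¹).comp (tendsto_inv₀ hx))

theorem shiftedProd_mul_shiftedProd_div (hq : q ∈ Set.Ioo (0 : ℝ) 1) {x y : ℝ} (hy : y ≠ 0)
    (hx : ∀ i : ℕ, 1 + x * q ^ (2 * (i + 1)) ≠ 0) :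
    shiftedProd q (x * y) * shiftedProd q (x / y) = shiftedProd q x ^ 2 *
      ∏' i : ℕ, (1 + lambertTerm q x i * (y + y⁻¹ - 2)) := by
  have hne := shiftedProd_ne_zero hq hx
  have key : shiftedProd q (x * y) * shiftedProd q (x / y) / shiftedProd q x ^ 2 =
      ∏' i : ℕ, (1 + lambertTerm q x i * (y + y⁻¹ - 2)) := by
    refine (HasProd.tprod_eq ?_).symm
    have h2 := ((multipliable_shifted hq x).hasProd.mul (multipliable_shifted hq x).hasProd)
    have h := ((multipliable_shifted hq (x * y)).hasProd.mul
      (multipliable_shifted hq (x / y)).hasProd).div₀ h2 (mul_ne_zero hne hne)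
    convert! h using 2 with i
    · have := hx i
      rw [lambertTerm]
      field_simp
      ring
    · rw [sq]; rfl
  rw [← key]
  field_simp

end Products

/-- First-order expansion of `∏ (1 + aᵢ η)` at `η = 0`. -/
theorem tendsto_tprod_one_add_mul_slope {a : ℕ → ℝ} (ha : Summable a) :
    Tendsto (fun η : ℝ => (∏' i, (1 + a i * η) - 1) / η) (𝓝[≠] 0) (𝓝 (∑' i, a i)) := by
  have hb : ∀ η : ℝ, |η| ≤ 1 → ∀ i, ‖a i * ∏ j ∈ Finset.Iio i, (1 + a j * η)‖ ≤
      |a i| * Real.exp (∑' j, |a j|) := by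
    intro η hη i
    rw [norm_mul, Real.norm_eq_abs]
    gcongr
    calc ‖∏ j ∈ Finset.Iio i, (1 + a j * η)‖
        = ∏ j ∈ Finset.Iio i, ‖1 + a j * η‖ := norm_prod _ _
      _ ≤ ∏ j ∈ Finset.Iio i, (1 + |a j|) := by
          refine Finset.prod_le_prod (fun _ _ => norm_nonneg _) fun j _ => ?_
          refine (norm_add_le _ _).trans ?_
          rw [norm_one, norm_mul, Real.norm_eq_abs, Real.norm_eq_abs]
          have := mul_le_mul_of_nonneg_left hη (abs_nonneg (a j))
          linarith
      _ ≤ Real.exp (∑ j ∈ Finset.Iio i, |a j|) :=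
          Real.prod_one_add_le_exp_sum _ fun _ => abs_nonneg _
      _ ≤ Real.exp (∑' j, |a j|) :=
          Real.exp_le_exp.2 (ha.abs.sum_le_tsum _ fun _ _ => abs_nonneg _)
  have hs := ha.abs.mul_right (Real.exp (∑' j, |a j|))
  have h01 : ∀ᶠ η : ℝ in 𝓝[≠] 0, |η| ≤ 1 := by
    filter_upwards [nhdsWithin_le_nhds (Metric.closedBall_mem_nhds (0 : ℝ) one_pos)] with η hη
    simpa using hη
  have hlim : Tendsto (fun η : ℝ => ∑' i, a i * ∏ j ∈ Finset.Iio i, (1 + a j * η))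
      (𝓝[≠] 0) (𝓝 (∑' i, a i)) := by
    refine tendsto_tsum_of_dominated_convergence hs (fun i => ?_) (h01.mono hb)
    have hc : Continuous fun η : ℝ => a i * ∏ j ∈ Finset.Iio i, (1 + a j * η) := by fun_prop
    simpa using (hc.tendsto 0).mono_left nhdsWithin_le_nhds
  refine hlim.congr' ?_
  filter_upwards [h01, self_mem_nhdsWithin] with η hη hη0
  have hη0 : η ≠ 0 := hη0
  have hsη : Summable fun i => a i * η * ∏ j ∈ Finset.Iio i, (1 + a j * η) :=
    ((hs.of_norm_bounded (hb η hη)).mul_left η).congr fun i => by ring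
  rw [tprod_one_add_ordered hsη (Real.multipliable_one_add_of_summable (ha.mul_right η)),
    add_sub_cancel_left, eq_div_iff hη0, ← tsum_mul_right]
  exact tsum_congr fun i => by ring

theorem tendsto_one_of_slope {f : ℝ → ℝ} {l : ℝ}
    (h : Tendsto (fun η : ℝ => (f η - 1) / η) (𝓝[≠] 0) (𝓝 l)) :
    Tendsto f (𝓝[≠] 0) (𝓝 1) := by
  have h0 : Tendsto (fun η : ℝ => η) (𝓝[≠] 0) (𝓝 0) := nhdsWithin_le_nhds
  have := (h.mul h0).add_const 1
  rw [mul_zero, zero_add] at this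
  refine this.congr' ?_
  filter_upwards [self_mem_nhdsWithin] with η hη
  rw [div_mul_cancel₀ _ hη, sub_add_cancel]

theorem slope_mul {f g : ℝ → ℝ} {l m : ℝ}
    (hf : Tendsto (fun η : ℝ => (f η - 1) / η) (𝓝[≠] 0) (𝓝 l))
    (hg : Tendsto (fun η : ℝ => (g η - 1) / η) (𝓝[≠] 0) (𝓝 m)) :
    Tendsto (fun η : ℝ => (f η * g η - 1) / η) (𝓝[≠] 0) (𝓝 (l + m)) := by
  have := (hf.mul (tendsto_one_of_slope hg)).add hg
  rw [mul_one] at this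
  exact this.congr fun η => by ring

theorem summable_lambertTerm {q : ℝ} (hq : q ∈ Set.Ioo (0 : ℝ) 1) (x : ℝ) :
    Summable (lambertTerm q x) := by
  have h := (summable_sq_pow hq).mul_left x
  have h1 : Tendsto (fun i : ℕ => ((1 + x * q ^ (2 * (i + 1))) ^ 2)⁻¹) atTop (𝓝 1) := by
    have := ((h.tendsto_atTop_zero.const_add 1).pow 2).inv₀ (by norm_num)
    simpa using this
  refine summable_of_isBigO_nat h.norm ?_
  have := (Asymptotics.isBigO_refl (fun i : ℕ => x * q ^ (2 * (i + 1))) atTop).mul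
    (h1.isBigO_one ℝ)
  refine this.norm_right.congr (fun i => ?_) fun i => by rw [mul_one]
  rw [lambertTerm, div_eq_mul_inv]

theorem W_neg_eq (q x : ℝ) :
    W q (-x) = -1 / 12 + 2 * ∑' n : ℕ, q ^ (2 * (n + 1)) / (1 - q ^ (2 * (n + 1))) ^ 2 +
      (x / (1 + x) ^ 2 + ∑' n, lambertTerm q x n + ∑' n, lambertTerm q x⁻¹ n) := by
  have h1 : ∑' n : ℕ, -x * q ^ (2 * (n + 1)) / (1 - -x * q ^ (2 * (n + 1))) ^ 2 =
      -∑' n, lambertTerm q x n := by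
    rw [← tsum_neg]
    refine tsum_congr fun n => ?_
    rw [lambertTerm]
    ring
  have h2 : ∑' n : ℕ, (q ^ (2 * (n + 1)) / -x) / (1 - q ^ (2 * (n + 1)) / -x) ^ 2 =
      -∑' n, lambertTerm q x⁻¹ n := by
    rw [← tsum_neg]
    refine tsum_congr fun n => ?_
    rw [lambertTerm, div_neg, sub_neg_eq_add, div_eq_inv_mul]
    ring
  rw [W, h1, h2]
  ring

/-- Every factor of the theta product at `-x` is nonzero. -/
structure ThetaRegular (q x : ℝ) : Prop where
  ne_zero : x ≠ 0
  one_add_ne : 1 + x ≠ 0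
  shifted_ne : ∀ i : ℕ, 1 + x * q ^ (2 * (i + 1)) ≠ 0
  shifted_inv_ne : ∀ i : ℕ, 1 + x⁻¹ * q ^ (2 * (i + 1)) ≠ 0

theorem thetaRegular_of_pos {q x : ℝ} (hq : q ∈ Set.Ioo (0 : ℝ) 1) (hx : 0 < x) :
    ThetaRegular q x where
  ne_zero := hx.ne'
  one_add_ne := by positivity
  shifted_ne := one_add_mul_pow_ne_zero hq (by linarith)
  shifted_inv_ne := one_add_mul_pow_ne_zero hq (by have := inv_pos.2 hx; linarith)

theorem thetaRegular_neg_self {q : ℝ} (hq : q ∈ Set.Ioo (0 : ℝ) 1) : ThetaRegular q (-q) where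
  ne_zero := neg_ne_zero.2 hq.1.ne'
  one_add_ne := by linarith [hq.2]
  shifted_ne := one_add_mul_pow_ne_zero hq (by linarith [hq.2])
  shifted_inv_ne i := by
    have h1 : q ^ (2 * i + 1) < 1 := pow_lt_one₀ hq.1.le hq.2 (by omega)
    have h0 := hq.1.ne'
    rw [show (-q)⁻¹ * q ^ (2 * (i + 1)) = -q ^ (2 * i + 1) by field_simp; ring]
    linarith

theorem thetaR_neg_ne_zero {q x : ℝ} (hq : q ∈ Set.Ioo (0 : ℝ) 1) (hx : ThetaRegular q x) :
    thetaR q (-x) ≠ 0 := by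
  rw [thetaR_neg_eq hq]
  exact mul_ne_zero (mul_ne_zero hx.one_add_ne (shiftedProd_ne_zero hq hx.shifted_ne))
    (shiftedProd_ne_zero hq hx.shifted_inv_ne)

theorem exists_thetaR_mul_expansion {q x : ℝ} (hq : q ∈ Set.Ioo (0 : ℝ) 1)
    (hx : ThetaRegular q x) : ∃ F : ℝ → ℝ,
      (∀ y : ℝ, y ≠ 0 → thetaR q (-(x * y)) * thetaR q (-(x / y)) =
        thetaR q (-x) ^ 2 * F (y + y⁻¹ - 2)) ∧
      Tendsto (fun η : ℝ => (F η - 1) / η) (𝓝[≠] 0)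
        (𝓝 (x / (1 + x) ^ 2 + ∑' n, lambertTerm q x n + ∑' n, lambertTerm q x⁻¹ n)) := by
  refine ⟨fun η => (1 + x / (1 + x) ^ 2 * η) * (∏' i, (1 + lambertTerm q x i * η)) *
    ∏' i, (1 + lambertTerm q x⁻¹ i * η), fun y hy => ?_, ?_⟩
  · have h1 := shiftedProd_mul_shiftedProd_div hq hy hx.shifted_ne
    have h2 := shiftedProd_mul_shiftedProd_div hq hy hx.shifted_inv_ne
    have h0 : (1 + x * y) * (1 + x / y) =
        (1 + x) ^ 2 * (1 + x / (1 + x) ^ 2 * (y + y⁻¹ - 2)) := by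
      have := hx.one_add_ne
      field_simp
      ring
    rw [thetaR_neg_eq hq, thetaR_neg_eq hq, thetaR_neg_eq hq,
      show (x * y)⁻¹ = x⁻¹ / y by rw [mul_inv, div_eq_mul_inv],
      show (x / y)⁻¹ = x⁻¹ * y by rw [inv_div, div_eq_inv_mul]]
    calc _ = ((1 + x * y) * (1 + x / y)) * (shiftedProd q (x * y) * shiftedProd q (x / y)) *
          (shiftedProd q (x⁻¹ * y) * shiftedProd q (x⁻¹ / y)) := by ring
      _ = _ := by rw [h0, h1, h2]; ring
  · refine slope_mul (slope_mul ?_ (tendsto_tprod_one_add_mul_slope (summable_lambertTerm hq x)))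
      (tendsto_tprod_one_add_mul_slope (summable_lambertTerm hq x⁻¹))
    refine tendsto_const_nhds.congr' ?_
    filter_upwards [self_mem_nhdsWithin] with η hη
    rw [add_sub_cancel_left, mul_div_cancel_right₀ _ hη]

/-- `(θ'(1) / θ(-1))²`. -/
noncomputable def thetaRatio (q : ℝ) : ℝ := (shiftedProd q (-1) ^ 2 / thetaR q (-1)) ^ 2

theorem exists_thetaR_sq_expansion {q : ℝ} (hq : q ∈ Set.Ioo (0 : ℝ) 1) : ∃ F : ℝ → ℝ,
      (∀ y : ℝ, y ≠ 0 → thetaR q y ^ 2 / y =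
        thetaR q (-1) ^ 2 * ((y + y⁻¹ - 2) * (thetaRatio q * F (y + y⁻¹ - 2)))) ∧
      Tendsto F (𝓝[≠] 0) (𝓝 1) := by
  refine ⟨fun η => (∏' i, (1 + lambertTerm q (-1) i * η)) ^ 2, fun y hy => ?_, ?_⟩
  · have h1 := shiftedProd_mul_shiftedProd_div hq hy
      (one_add_mul_pow_ne_zero hq (le_refl (-1)))
    have ht : thetaR q (-1) ≠ 0 := thetaR_neg_ne_zero_of_pos hq one_pos
    have hy2 := thetaR_neg_eq hq (-y)
    rw [neg_neg] at hy2
    rw [hy2, thetaRatio]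
    rw [show (-y)⁻¹ = -1 / y by rw [← neg_inv, neg_div, one_div],
      show -y = -1 * y by ring]
    calc _ = (1 - y) ^ 2 / y * (shiftedProd q (-1 * y) * shiftedProd q (-1 / y)) ^ 2 := by ring
      _ = _ := by
        rw [h1]
        beta_reduce
        generalize (∏' i : ℕ, (1 + lambertTerm q (-1) i * (y + y⁻¹ - 2))) = P
        field_simp
        ring
  · have := (tendsto_one_of_slope
      (tendsto_tprod_one_add_mul_slope (summable_lambertTerm hq (-1)))).pow 2
    simpa using this

/-- The finite `q`-Pochhammer symbol `(p; p)_N` at `p = q²`. -/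
noncomputable def poch (q : ℝ) (N : ℕ) : ℝ := ∏ i ∈ Finset.range N, (1 - q ^ (2 * (i + 1)))

/-- The reciprocal of `(p; p)_m`, extended by zero to negative `m`. -/
noncomputable def invPoch (q : ℝ) (m : ℤ) : ℝ := if 0 ≤ m then (poch q m.toNat)⁻¹ else 0

section TripleProduct

variable {q : ℝ}

theorem one_sub_sq_pow_pos (hq : q ∈ Set.Ioo (0 : ℝ) 1) (i : ℕ) : 0 < 1 - q ^ (2 * (i + 1)) :=
  sub_pos.2 (pow_lt_one₀ hq.1.le hq.2 (by omega))

theorem poch_pos (hq : q ∈ Set.Ioo (0 : ℝ) 1) (N : ℕ) : 0 < poch q N :=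
  Finset.prod_pos fun i _ => one_sub_sq_pow_pos hq i

theorem poch_le_one (hq : q ∈ Set.Ioo (0 : ℝ) 1) (N : ℕ) : poch q N ≤ 1 :=
  Finset.prod_le_one (fun i _ => (one_sub_sq_pow_pos hq i).le)
    fun i _ => by linarith [pow_pos hq.1 (2 * (i + 1))]

theorem invPoch_natCast (q : ℝ) (n : ℕ) : invPoch q n = (poch q n)⁻¹ := by simp [invPoch]

theorem invPoch_of_neg (q : ℝ) {m : ℤ} (hm : m < 0) : invPoch q m = 0 := by
  rw [invPoch, if_neg (not_le.2 hm)]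

theorem one_sub_zpow_mul_invPoch (hq : q ∈ Set.Ioo (0 : ℝ) 1) (m : ℤ) :
    (1 - (q ^ 2) ^ m) * invPoch q m = invPoch q (m - 1) := by
  rcases lt_trichotomy m 0 with hm | rfl | hm
  · rw [invPoch_of_neg q hm, invPoch_of_neg q (by omega), mul_zero]
  · simp [invPoch]
  · obtain ⟨n, rfl⟩ : ∃ n : ℕ, m = (n + 1 : ℕ) := ⟨(m - 1).toNat, by omega⟩
    rw [invPoch_natCast, show ((n + 1 : ℕ) : ℤ) - 1 = (n : ℤ) by push_cast; ring,
      invPoch_natCast, zpow_natCast, ← pow_mul, poch, poch, Finset.prod_range_succ]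
    have h1 := (one_sub_sq_pow_pos hq n).ne'
    have h2 := (poch_pos hq n).ne'
    rw [poch] at h2
    field_simp

theorem hasSum_finite_tripleProduct (hq : q ∈ Set.Ioo (0 : ℝ) 1) {x : ℝ} (hx : x ≠ 0) (n : ℕ) :
    HasSum (fun k : ℤ => poch q (2 * n) * invPoch q (n - k) * invPoch q (n + k) *
        q ^ (k * (k - 1)) * x ^ k)
      ((∏ i ∈ Finset.range n, (1 + x * q ^ (2 * i))) *
        ∏ i ∈ Finset.range n, (1 + x⁻¹ * q ^ (2 * (i + 1)))) := by
  have hq0 := hq.1.ne'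
  induction n with
  | zero =>
    have := hasSum_single (f := fun k : ℤ => poch q (2 * 0) * invPoch q ((0 : ℕ) - k) *
        invPoch q ((0 : ℕ) + k) * q ^ (k * (k - 1)) * x ^ k) 0 (fun k hk => ?_)
    · simpa [poch, invPoch] using this
    · rcases lt_or_gt_of_ne hk with h | h
      · rw [invPoch_of_neg q (m := (0 : ℕ) + k) (by simpa using h)]; ring
      · rw [invPoch_of_neg q (m := (0 : ℕ) - k) (by simpa using h)]; ring
  | succ n ih =>
    have h0 := ih.mul_left (1 + q ^ (2 * (2 * n + 1)))
    have h1 := ((Equiv.addRight (-1 : ℤ)).hasSum_iff.2 ih).mul_left (x * q ^ (2 * n))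
    have h2 := ((Equiv.addRight (1 : ℤ)).hasSum_iff.2 ih).mul_left (x⁻¹ * q ^ (2 * (n + 1)))
    have h := (h0.add h1).add h2
    rw [Finset.prod_range_succ, Finset.prod_range_succ]
    convert! h using 1
    · funext k
      simp only [Function.comp, Equiv.coe_addRight]
      have ea : ((n + 1 : ℕ) : ℤ) - k - 1 = n - k := by push_cast; ring
      have eb : ((n + 1 : ℕ) : ℤ) + k - 1 = n + k := by push_cast; ring
      have a1 := one_sub_zpow_mul_invPoch hq ((n + 1 : ℕ) - k)
      have a2 := one_sub_zpow_mul_invPoch hq (n - k)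
      have b1 := one_sub_zpow_mul_invPoch hq ((n + 1 : ℕ) + k)
      have b2 := one_sub_zpow_mul_invPoch hq (n + k)
      rw [ea] at a1
      rw [eb] at b1
      rw [show (n : ℤ) - (k + -1) = (n + 1 : ℕ) - k by push_cast; ring,
        show (n : ℤ) + (k + -1) = n + k - 1 by ring,
        show (n : ℤ) - (k + 1) = n - k - 1 by ring,
        show (n : ℤ) + (k + 1) = (n + 1 : ℕ) + k by push_cast; ring,
        ← a2, ← b2, ← a1, ← b1]
      have hp0 : q ^ 2 ≠ 0 := pow_ne_zero _ hq0
      have za : (q ^ 2) ^ ((n : ℤ) - k) = q ^ (2 * n) * ((q ^ 2) ^ k)⁻¹ := by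
        rw [zpow_sub₀ hp0, zpow_natCast, pow_mul, div_eq_mul_inv]
      have zb : (q ^ 2) ^ ((n : ℤ) + k) = q ^ (2 * n) * (q ^ 2) ^ k := by
        rw [zpow_add₀ hp0, zpow_natCast, pow_mul]
      have za1 : (q ^ 2) ^ (((n + 1 : ℕ) : ℤ) - k) = q ^ 2 * q ^ (2 * n) * ((q ^ 2) ^ k)⁻¹ := by
        rw [zpow_sub₀ hp0, zpow_natCast, ← pow_mul, div_eq_mul_inv]; ring
      have zb1 : (q ^ 2) ^ (((n + 1 : ℕ) : ℤ) + k) = q ^ 2 * q ^ (2 * n) * (q ^ 2) ^ k := by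
        rw [zpow_add₀ hp0, zpow_natCast, ← pow_mul]; ring
      have hk : q ^ (2 * k) = (q ^ 2) ^ k := by rw [zpow_mul, zpow_ofNat]
      have c1 : q ^ ((k + -1) * (k + -1 - 1)) = q ^ (k * (k - 1)) * (q ^ 2 * ((q ^ 2) ^ k)⁻¹) := by
        rw [show (k + -1) * (k + -1 - 1) = k * (k - 1) + (2 - 2 * k) by ring, zpow_add₀ hq0,
          zpow_sub₀ hq0, hk, div_eq_mul_inv, zpow_ofNat]
      have c2 : q ^ ((k + 1) * (k + 1 - 1)) = q ^ (k * (k - 1)) * (q ^ 2) ^ k := by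
        rw [show (k + 1) * (k + 1 - 1) = k * (k - 1) + 2 * k by ring, zpow_add₀ hq0, hk]
      have hG : poch q (2 * (n + 1)) = poch q (2 * n) * (1 - q ^ 2 * (q ^ (2 * n)) ^ 2) *
          (1 - (q ^ 2) ^ 2 * (q ^ (2 * n)) ^ 2) := by
        rw [poch, poch, show 2 * (n + 1) = 2 * n + 1 + 1 by ring, Finset.prod_range_succ,
          Finset.prod_range_succ]
        ring
      rw [za, zb, za1, zb1, c1, c2, hG, zpow_add₀ hx, zpow_add₀ hx, zpow_one, zpow_neg_one,
        show q ^ (2 * (2 * n + 1)) = q ^ 2 * (q ^ (2 * n)) ^ 2 by ring,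
        show q ^ (2 * (n + 1)) = q ^ 2 * q ^ (2 * n) by ring]
      have hz : (q ^ 2) ^ k ≠ 0 := zpow_ne_zero _ hp0
      generalize (q ^ 2) ^ k = z at hz
      generalize q ^ (2 * n) = w
      generalize invPoch q _ = u
      generalize invPoch q _ = v
      generalize q ^ (k * (k - 1)) = s
      generalize x ^ k = y
      generalize poch q (2 * n) = G
      field_simp
      ring
    · field_simp
      ring

end TripleProduct

/-- The two-sided series `∑ Q^{k²} w^k`. -/
noncomputable def thetaSum (Q w : ℝ) : ℝ := ∑' k : ℤ, Q ^ (k ^ 2) * w ^ k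

section ThetaSum

variable {q : ℝ}

theorem summable_nat_thetaSum {Q w : ℝ} (hQ : Q ∈ Set.Ioo (0 : ℝ) 1) (hw : w ≠ 0) :
    Summable fun n : ℕ => Q ^ (n ^ 2) * w ^ n := by
  have hQ0 := hQ.1.ne'
  refine summable_of_ratio_test_tendsto_lt_one (l := 0) one_pos
    (Eventually.of_forall fun n => mul_ne_zero (pow_ne_zero _ hQ0) (pow_ne_zero _ hw)) ?_
  have h : Tendsto (fun n : ℕ => Q * |w| * (Q ^ 2) ^ n) atTop (𝓝 (Q * |w| * 0)) :=
    (tendsto_pow_atTop_nhds_zero_of_lt_one (sq_nonneg Q)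
      (by nlinarith [hQ.1, hQ.2])).const_mul _
  rw [mul_zero] at h
  refine h.congr fun n => ?_
  rw [← norm_div, show Q ^ ((n + 1) ^ 2) * w ^ (n + 1) / (Q ^ (n ^ 2) * w ^ n) =
    Q * w * (Q ^ 2) ^ n by field_simp; ring]
  rw [norm_mul, norm_mul, Real.norm_eq_abs w, Real.norm_of_nonneg hQ.1.le,
    Real.norm_of_nonneg (by positivity)]

theorem summable_thetaSum {Q w : ℝ} (hQ : Q ∈ Set.Ioo (0 : ℝ) 1) (hw : w ≠ 0) :
    Summable fun k : ℤ => Q ^ (k ^ 2) * w ^ k := by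
  refine Summable.of_nat_of_neg ?_ ?_
  · refine (summable_nat_thetaSum hQ hw).congr fun n => ?_
    norm_cast
  · refine (summable_nat_thetaSum hQ (inv_ne_zero hw)).congr fun n => ?_
    rw [neg_sq, zpow_neg, zpow_natCast, inv_pow]
    norm_cast

theorem tendsto_invPoch_add (hq : q ∈ Set.Ioo (0 : ℝ) 1) (k : ℤ) :
    Tendsto (fun n : ℕ => invPoch q (n + k)) atTop (𝓝 (shiftedProd q (-1))⁻¹) := by
  have h0 : Tendsto (poch q) atTop (𝓝 (shiftedProd q (-1))) := by
    refine (multipliable_shifted hq (-1)).hasProd.tendsto_prod_nat.congr fun n => ?_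
    exact Finset.prod_congr rfl fun i _ => by ring
  have h1 := (h0.inv₀ (shiftedProd_ne_zero hq (one_add_mul_pow_ne_zero hq le_rfl)))
  have h2 : Tendsto (fun n : ℕ => ((n : ℤ) + k).toNat) atTop atTop := by
    refine tendsto_atTop_mono (f := fun n => n - k.natAbs) (fun n => by omega) ?_
    exact tendsto_sub_atTop_nat _
  refine (h1.comp h2).congr' ?_
  filter_upwards [eventually_ge_atTop k.natAbs] with n hn
  rw [invPoch, if_pos (by omega)]
  rfl

theorem exists_invPoch_le (hq : q ∈ Set.Ioo (0 : ℝ) 1) : ∃ C, ∀ m : ℤ, |invPoch q m| ≤ C := by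
  obtain ⟨C, hC⟩ := (tendsto_invPoch_add hq 0).bddAbove_range
  refine ⟨max C 0, fun m => ?_⟩
  rcases lt_or_ge m 0 with hm | hm
  · rw [invPoch_of_neg q hm, abs_zero]
    exact le_max_right _ _
  · obtain ⟨n, rfl⟩ := Int.eq_ofNat_of_zero_le hm
    rw [abs_of_nonneg]
    · exact (hC ⟨n, by simp⟩).trans (le_max_left _ _)
    · exact (invPoch_natCast q n).symm ▸ (inv_pos.2 (poch_pos hq n)).le

/-- The Jacobi triple product, with the constant left unspecified. -/
theorem thetaR_neg_eq_thetaSum (hq : q ∈ Set.Ioo (0 : ℝ) 1) {x : ℝ} (hx : x ≠ 0) :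
    thetaR q (-x) = (shiftedProd q (-1))⁻¹ * thetaSum q (x / q) := by
  have hq0 := hq.1.ne'
  have hG := shiftedProd_ne_zero hq (one_add_mul_pow_ne_zero hq (le_refl (-1)))
  have hprod := ((multipliable_unshifted hq x).hasProd.tendsto_prod_nat).mul
    (multipliable_shifted hq x⁻¹).hasProd.tendsto_prod_nat
  rw [tprod_unshifted hq, ← shiftedProd, ← thetaR_neg_eq hq] at hprod
  obtain ⟨C, hC⟩ := exists_invPoch_le hq
  have hC0 : 0 ≤ C := (abs_nonneg _).trans (hC 0)
  have hs := ((summable_thetaSum hq (div_ne_zero hx hq0)).norm).mul_left (C * C)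
  have hterm : ∀ k : ℤ, q ^ (k * (k - 1)) * x ^ k = q ^ (k ^ 2) * (x / q) ^ k := fun k => by
    rw [div_zpow, show k * (k - 1) = k ^ 2 - k by ring, zpow_sub₀ hq0]
    ring
  have hsum := tendsto_tsum_of_dominated_convergence (𝓕 := atTop)
    (f := fun (n : ℕ) (k : ℤ) => poch q (2 * n) * invPoch q (n - k) * invPoch q (n + k) *
        q ^ (k * (k - 1)) * x ^ k)
    (g := fun k => (shiftedProd q (-1))⁻¹ * (q ^ (k ^ 2) * (x / q) ^ k)) hs (fun k => ?_)
    (Eventually.of_forall fun n k => ?_)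
  · rw [tsum_mul_left, ← thetaSum] at hsum
    refine tendsto_nhds_unique hprod (hsum.congr fun n => ?_)
    exact (hasSum_finite_tripleProduct hq hx n).tsum_eq
  · have h0 : Tendsto (fun n : ℕ => poch q (2 * n)) atTop (𝓝 (shiftedProd q (-1))) := by
      have := ((tendsto_invPoch_add hq 0).comp
        (tendsto_id.const_mul_atTop' (two_pos (α := ℕ)))).inv₀ (inv_ne_zero hG)
      rw [inv_inv] at this
      refine this.congr fun n => ?_
      simp only [Function.comp, add_zero, invPoch_natCast, inv_inv, id]
    have := (((h0.mul (tendsto_invPoch_add hq (-k))).mul (tendsto_invPoch_add hq k))).mul_const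
      (q ^ (k ^ 2) * (x / q) ^ k)
    rw [mul_inv_cancel₀ hG, one_mul] at this
    refine this.congr fun n => ?_
    rw [← hterm, ← sub_eq_add_neg]
    ring
  · rw [mul_assoc, hterm, norm_mul, norm_mul, norm_mul, Real.norm_of_nonneg (poch_pos hq _).le,
      Real.norm_eq_abs, Real.norm_eq_abs]
    refine mul_le_mul_of_nonneg_right ?_ (norm_nonneg _)
    calc poch q (2 * n) * |invPoch q (n - k)| * |invPoch q (n + k)| ≤ 1 * C * C := by
          gcongr
          · exact poch_le_one hq _
          · exact hC _
          · exact hC _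
      _ = C * C := by ring

theorem bijective_parity_split :
    Function.Bijective (Sum.elim (fun k : ℤ × ℤ => (k.1 + k.2, k.1 - k.2))
      fun k : ℤ × ℤ => (k.1 + k.2 + 1, k.1 - k.2)) := by
  constructor
  · rintro (⟨a, b⟩ | ⟨a, b⟩) (⟨c, d⟩ | ⟨c, d⟩) h <;>
      simp only [Sum.elim_inl, Sum.elim_inr, Prod.mk.injEq] at h
    · congr 2 <;> omega
    · omega
    · omega
    · congr 2 <;> omega
  · rintro ⟨m, n⟩
    rcases Int.even_or_odd' (m + n) with ⟨k, hk | hk⟩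
    · exact ⟨Sum.inl (k, m - k), by simp only [Sum.elim_inl, Prod.mk.injEq]; omega⟩
    · exact ⟨Sum.inr (k, m - k - 1), by simp only [Sum.elim_inr, Prod.mk.injEq]; omega⟩

theorem hasSum_thetaSum_mul {Q v w : ℝ} (hQ : Q ∈ Set.Ioo (0 : ℝ) 1) (hv : v ≠ 0)
    (hw : w ≠ 0) :
    HasSum (fun k : ℤ × ℤ => Q ^ (k.1 ^ 2) * v ^ k.1 * (Q ^ (k.2 ^ 2) * w ^ k.2))
      (thetaSum Q v * thetaSum Q w) :=
  HasSum.mul (f := fun k : ℤ => Q ^ (k ^ 2) * v ^ k) (g := fun k : ℤ => Q ^ (k ^ 2) * w ^ k)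
    (summable_thetaSum hQ hv).hasSum (summable_thetaSum hQ hw).hasSum
    (summable_mul_of_summable_norm (f := fun k : ℤ => Q ^ (k ^ 2) * v ^ k)
      (g := fun k : ℤ => Q ^ (k ^ 2) * w ^ k)
      (summable_thetaSum hQ hv).norm (summable_thetaSum hQ hw).norm)

theorem thetaSum_mul_thetaSum {Q a b : ℝ} (hQ : Q ∈ Set.Ioo (0 : ℝ) 1) (ha : a ≠ 0)
    (hb : b ≠ 0) :
    thetaSum Q (a * b) * thetaSum Q (a / b) =
      thetaSum (Q ^ 2) (a ^ 2) * thetaSum (Q ^ 2) (b ^ 2) +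
      Q * a * b * (thetaSum (Q ^ 2) (Q ^ 2 * a ^ 2) * thetaSum (Q ^ 2) (Q ^ 2 * b ^ 2)) := by
  have hQ0 := hQ.1.ne'
  have hQ2 : Q ^ 2 ∈ Set.Ioo (0 : ℝ) 1 := ⟨by have := hQ.1; positivity, by nlinarith [hQ.1, hQ.2]⟩
  have h1 := hasSum_thetaSum_mul hQ2 (pow_ne_zero 2 ha) (pow_ne_zero 2 hb)
  have h2 := (hasSum_thetaSum_mul hQ2 (mul_ne_zero (pow_ne_zero 2 hQ0) (pow_ne_zero 2 ha))
    (mul_ne_zero (pow_ne_zero 2 hQ0) (pow_ne_zero 2 hb))).mul_left (Q * a * b)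
  have h3 := (Equiv.ofBijective _ bijective_parity_split).hasSum_iff.2
    (hasSum_thetaSum_mul hQ (mul_ne_zero ha hb) (div_ne_zero ha hb))
  refine h3.unique (HasSum.sum (h1.congr_fun ?_) (h2.congr_fun ?_))
  · rintro ⟨k, j⟩
    simp only [Function.comp, Equiv.ofBijective_apply, Sum.elim_inl]
    have hz : ∀ {y : ℝ} (k : ℤ), (y ^ 2) ^ k = y ^ (2 * k) := fun {y} k => by
      rw [zpow_mul, zpow_ofNat]
    calc Q ^ ((k + j) ^ 2) * (a * b) ^ (k + j) * (Q ^ ((k - j) ^ 2) * (a / b) ^ (k - j)) =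
        (Q ^ ((k + j) ^ 2) * Q ^ ((k - j) ^ 2)) * (a ^ (k + j) * a ^ (k - j)) *
          (b ^ (k + j) / b ^ (k - j)) := by
          rw [mul_zpow, div_zpow]
          ring
      _ = (Q ^ (2 * k ^ 2) * Q ^ (2 * j ^ 2)) * a ^ (2 * k) * b ^ (2 * j) := by
          rw [← zpow_add₀ hQ0, ← zpow_add₀ hQ0, ← zpow_add₀ ha, ← zpow_sub₀ hb]
          congr 3 <;> ring
      _ = _ := by
          rw [hz, hz, hz, hz]
          ring
  · rintro ⟨k, j⟩
    simp only [Function.comp, Equiv.ofBijective_apply, Sum.elim_inr]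
    have hz : ∀ {y : ℝ} (k : ℤ), (y ^ 2) ^ k = y ^ (2 * k) := fun {y} k => by
      rw [zpow_mul, zpow_ofNat]
    calc Q ^ ((k + j + 1) ^ 2) * (a * b) ^ (k + j + 1) *
          (Q ^ ((k - j) ^ 2) * (a / b) ^ (k - j)) =
        (Q ^ ((k + j + 1) ^ 2) * Q ^ ((k - j) ^ 2)) * (a ^ (k + j + 1) * a ^ (k - j)) *
          (b ^ (k + j + 1) / b ^ (k - j)) := by
          rw [mul_zpow, div_zpow]
          ring
      _ = (Q ^ (2 * k ^ 2) * Q ^ (2 * j ^ 2) * Q ^ (2 * k) * Q ^ (2 * j) * Q) *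
          (a ^ (2 * k) * a) * (b ^ (2 * j) * b) := by
          rw [← zpow_add₀ hQ0, ← zpow_add₀ hQ0, ← zpow_add₀ hQ0, ← zpow_add₀ hQ0,
            ← zpow_add_one₀ hQ0, ← zpow_add₀ ha, ← zpow_sub₀ hb, ← zpow_add_one₀ ha,
            ← zpow_add_one₀ hb]
          congr 3 <;> ring
      _ = _ := by
          rw [mul_zpow, mul_zpow, hz, hz, hz, hz, hz, hz]
          ring

end ThetaSum

section Addition

variable {q : ℝ}

theorem exists_even_split (hq : q ∈ Set.Ioo (0 : ℝ) 1) : ∃ E O A B : ℝ → ℝ,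
    (∀ x, E (-x) = E x) ∧ (∀ x, O (-x) = O x) ∧ ∀ x y : ℝ, x ≠ 0 → y ≠ 0 →
      thetaR q (-(x * y)) * thetaR q (-(x / y)) = E x * A y + x * y * (O x * B y) := by
  have hq0 := hq.1.ne'
  refine ⟨fun x => (shiftedProd q (-1))⁻¹ ^ 2 * thetaSum (q ^ 2) ((x / q) ^ 2),
    fun x => (shiftedProd q (-1))⁻¹ ^ 2 * thetaSum (q ^ 2) (q ^ 2 * (x / q) ^ 2),
    fun y => thetaSum (q ^ 2) (y ^ 2), fun y => thetaSum (q ^ 2) (q ^ 2 * y ^ 2),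
    fun x => by simp only [neg_div, neg_sq], fun x => by simp only [neg_div, neg_sq],
    fun x y hx hy => ?_⟩
  have h := thetaSum_mul_thetaSum hq (div_ne_zero hx hq0) hy
  rw [thetaR_neg_eq_thetaSum hq (mul_ne_zero hx hy), thetaR_neg_eq_thetaSum hq (div_ne_zero hx hy),
    show x * y / q = x / q * y by ring, show x / y / q = x / q / y by ring,
    mul_mul_mul_comm, h, mul_div_cancel₀ x hq0]
  ring

theorem thetaR_addition (hq : q ∈ Set.Ioo (0 : ℝ) 1) {x y : ℝ} (hx : x ≠ 0) (hy : y ≠ 0) :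
    thetaR q (-1) ^ 2 * (thetaR q (-(x * y)) * thetaR q (-(x / y)) * y) =
      thetaR q (-x) ^ 2 * thetaR q (-y) ^ 2 - thetaR q x ^ 2 * thetaR q y ^ 2 := by
  obtain ⟨E, O, A, B, hE, hO, h⟩ := exists_even_split hq
  have h0 := h (-1) 1 (by norm_num) one_ne_zero
  have h1 := h 1 1 one_ne_zero one_ne_zero
  have hx1 := h x 1 hx one_ne_zero
  have hx2 := h (-x) 1 (neg_ne_zero.2 hx) one_ne_zero
  have hy1 := h 1 y one_ne_zero hy
  have hy2 := h (-1) y (by norm_num) hy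
  have hxy := h x y hx hy
  have i1 := thetaR_neg_inv hq hy
  have i2 := thetaR_neg_inv hq (neg_ne_zero.2 hy)
  simp only [mul_one, div_one, neg_neg, one_mul, one_div, hE, hO, inv_neg, neg_mul, neg_div,
    thetaR_one hq, mul_zero] at h0 h1 hx1 hx2 hy1 hy2 i1 i2
  rw [hxy]
  have e1 : thetaR q (-y) ^ 2 = y * (E 1 * A y + y * (O 1 * B y)) := by rw [← hy1, ← i1]; ring
  have e2 : thetaR q y ^ 2 = -y * (E 1 * A y + -(y * (O 1 * B y))) := by
    rw [← hy2, ← i2]; ring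
  rw [e1, e2, sq (thetaR q (-1)), h1, sq (thetaR q (-x)), hx1, sq (thetaR q x), hx2]
  linear_combination (E x * A y - x * y * (O x * B y)) * y * h0

end Addition

theorem tendsto_add_inv_sub_two :
    Tendsto (fun y : ℝ => y + y⁻¹ - 2) (𝓝[≠] 1) (𝓝[≠] 0) := by
  refine tendsto_nhdsWithin_iff.2 ⟨?_, ?_⟩
  · have h : Tendsto (fun y : ℝ => y + y⁻¹ - 2) (𝓝 1) (𝓝 (1 + 1⁻¹ - 2)) :=
      (tendsto_id.add (tendsto_inv₀ one_ne_zero)).sub tendsto_const_nhds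
    norm_num at h
    exact h.mono_left nhdsWithin_le_nhds
  · filter_upwards [self_mem_nhdsWithin,
      nhdsWithin_le_nhds (eventually_ne_nhds (one_ne_zero (α := ℝ)))] with y hy hy0
    have : (y - 1) ^ 2 / y ≠ 0 := div_ne_zero (pow_ne_zero 2 (sub_ne_zero.2 hy)) hy0
    rwa [Set.mem_compl_singleton_iff,
      show y + y⁻¹ - 2 = (y - 1) ^ 2 / y by field_simp; ring]

/-- `K · θ(x)² / θ(-x)²` is an affine function of `℘`. -/
theorem thetaRatio_mul_sq {q x : ℝ} (hq : q ∈ Set.Ioo (0 : ℝ) 1) (hx : ThetaRegular q x) :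
    thetaRatio q * thetaR q x ^ 2 = (W q (-1) - W q (-x)) * thetaR q (-x) ^ 2 := by
  obtain ⟨F, hF, hF'⟩ := exists_thetaR_mul_expansion hq hx
  obtain ⟨F₁, hF₁, hF₁'⟩ := exists_thetaR_mul_expansion hq (thetaRegular_of_pos hq one_pos)
  obtain ⟨H, hH, hH'⟩ := exists_thetaR_sq_expansion hq
  have ht1 : thetaR q (-1) ≠ 0 := thetaR_neg_ne_zero_of_pos hq one_pos
  have htx := thetaR_neg_ne_zero hq hx
  have key : ∀ᶠ y : ℝ in 𝓝[≠] 1, (F (y + y⁻¹ - 2) - 1) / (y + y⁻¹ - 2) -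
      (F₁ (y + y⁻¹ - 2) - 1) / (y + y⁻¹ - 2) =
      -(thetaRatio q * thetaR q x ^ 2 / thetaR q (-x) ^ 2) * H (y + y⁻¹ - 2) := by
    filter_upwards [nhdsWithin_le_nhds (eventually_ne_nhds (one_ne_zero (α := ℝ))),
      tendsto_add_inv_sub_two self_mem_nhdsWithin] with y hy hη
    have a1 := thetaR_addition hq one_ne_zero hy
    have a2 := thetaR_addition hq hx.ne_zero hy
    have b := hH y hy
    rw [hF₁ y hy, thetaR_one hq] at a1
    rw [hF y hy] at a2
    rw [div_eq_iff hy] at b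
    change y + y⁻¹ - 2 ≠ 0 at hη
    generalize y + y⁻¹ - 2 = η at *
    have c : thetaR q (-y) ^ 2 = thetaR q (-1) ^ 2 * F₁ η * y := by
      refine mul_left_cancel₀ (pow_ne_zero 2 ht1) ?_
      linear_combination -a1
    rw [b, c] at a2
    have d : thetaR q (-x) ^ 2 * (F η - F₁ η) = -(thetaR q x ^ 2 * (η * (thetaRatio q * H η))) := by
      refine mul_left_cancel₀ (mul_ne_zero (pow_ne_zero 2 ht1) hy) ?_
      linear_combination a2
    field_simp
    linear_combination d
  have h1 := ((hF'.comp tendsto_add_inv_sub_two).sub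
    (hF₁'.comp tendsto_add_inv_sub_two)).congr' key
  have h2 := (hH'.comp tendsto_add_inv_sub_two).const_mul
    (-(thetaRatio q * thetaR q x ^ 2 / thetaR q (-x) ^ 2))
  have h3 := tendsto_nhds_unique h1 h2
  have h4 : thetaRatio q * thetaR q x ^ 2 / thetaR q (-x) ^ 2 = W q (-1) - W q (-x) := by
    rw [W_neg_eq, W_neg_eq]
    linarith
  rw [← h4]
  field_simp

theorem W_neg_eq_of_sq_eq {q x : ℝ} (hq : q ∈ Set.Ioo (0 : ℝ) 1) (hx : x ^ 2 = q ^ 2) :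
    W q (-x) = -1 / 12 + 2 * ∑' n : ℕ, q ^ (2 * (n + 1)) / (1 - q ^ (2 * (n + 1))) ^ 2 +
      2 * ∑' n, lambertTerm q x⁻¹ n := by
  have hx0 : x ≠ 0 := fun h => by
    rw [h] at hx
    exact pow_ne_zero 2 hq.1.ne' (by simpa using hx.symm)
  have hx2 : x⁻¹ * q ^ 2 = x := by rw [← hx]; field_simp
  rw [W_neg_eq]
  have h : ∑' n, lambertTerm q x⁻¹ n = x / (1 + x) ^ 2 + ∑' n, lambertTerm q x n := by
    rw [(summable_lambertTerm hq x⁻¹).tsum_eq_zero_add]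
    congr 1
    · rw [lambertTerm, zero_add, mul_one, hx2]
    · refine tsum_congr fun n => ?_
      rw [lambertTerm, lambertTerm, show x⁻¹ * q ^ (2 * (n + 1 + 1)) =
        x⁻¹ * q ^ 2 * q ^ (2 * (n + 1)) by ring, hx2]
  rw [← h]
  ring

theorem e1_add_e2_add_e3 {q : ℝ} (hq : q ∈ Set.Ioo (0 : ℝ) 1) : e1 q + e2 q + e3 q = 0 := by
  have hq0 := hq.1.ne'
  have hs := summable_lambertTerm hq (-1)
  have hinj1 : Function.Injective fun n : ℕ => 2 * n := fun a b h => by simpa using h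
  have hinj2 : Function.Injective fun n : ℕ => 2 * n + 1 := fun a b h => by simpa using h
  have he : Summable fun n => lambertTerm q (-1) (2 * n) := hs.comp_injective hinj1
  have ho : Summable fun n => lambertTerm q (-1) (2 * n + 1) := hs.comp_injective hinj2
  have hsplit := tsum_even_add_odd he ho
  have h0 : ∑' n : ℕ, q ^ (2 * (n + 1)) / (1 - q ^ (2 * (n + 1))) ^ 2 =
      -∑' n, lambertTerm q (-1) n := by
    rw [← tsum_neg]
    refine tsum_congr fun n => ?_
    rw [lambertTerm]
    ring
  have hpow : ∀ n : ℕ, 1 - q ^ (n + 1) ≠ 0 := fun n =>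
    (sub_pos.2 (pow_lt_one₀ hq.1.le hq.2 n.succ_ne_zero)).ne'
  have hpow' : ∀ n : ℕ, 1 + q ^ (n + 1) ≠ 0 := fun n => by have := hq.1; positivity
  have h1 : ∑' n, lambertTerm q 1 n =
      -∑' n, lambertTerm q (-1) n + 4 * ∑' n, lambertTerm q (-1) (2 * n + 1) := by
    rw [← tsum_neg, ← tsum_mul_left, ← hs.neg.tsum_add (ho.mul_left 4)]
    refine tsum_congr fun n => ?_
    have a := hpow (2 * n + 1)
    have b := hpow' (2 * n + 1)
    simp only [lambertTerm]
    rw [show q ^ (2 * (2 * n + 1 + 1)) = (q ^ (2 * n + 1 + 1)) ^ 2 by ring,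
      show 2 * (n + 1) = 2 * n + 1 + 1 by ring]
    generalize q ^ (2 * n + 1 + 1) = z at *
    have c : 1 + -1 * z ^ 2 = (1 - z) * (1 + z) := by ring
    rw [c, show 1 + -1 * z = 1 - z by ring]
    field_simp
    ring
  have h2 : ∑' n, lambertTerm q q⁻¹ n + ∑' n, lambertTerm q (-q)⁻¹ n =
      4 * ∑' n, lambertTerm q (-1) (2 * n) := by
    rw [← tsum_mul_left,
      ← (summable_lambertTerm hq q⁻¹).tsum_add (summable_lambertTerm hq (-q)⁻¹)]
    refine tsum_congr fun n => ?_
    have a := hpow (2 * n)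
    have b := hpow' (2 * n)
    simp only [lambertTerm]
    rw [show q ^ (2 * (2 * n + 1)) = (q ^ (2 * n + 1)) ^ 2 by ring,
      show q⁻¹ * q ^ (2 * (n + 1)) = q ^ (2 * n + 1) by field_simp; ring,
      show (-q)⁻¹ * q ^ (2 * (n + 1)) = -q ^ (2 * n + 1) by field_simp; ring]
    generalize q ^ (2 * n + 1) = z at *
    have c : 1 + -1 * z ^ 2 = (1 - z) * (1 + z) := by ring
    rw [c, ← sub_eq_add_neg]
    field_simp
    ring
  have w1 := W_neg_eq q 1
  have w2 := W_neg_eq_of_sq_eq hq (x := q) rfl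
  have w3 := W_neg_eq_of_sq_eq hq (neg_sq q)
  rw [inv_one] at w1
  rw [neg_neg] at w3
  rw [e1, e2, e3, w1, w2, w3, h0, h1]
  linear_combination 2 * h2 + 8 * hsplit

/-- The squared ratio of theta functions `(θ(x) / θ(-x))²`. -/
noncomputable def thetaQuot (q x : ℝ) : ℝ := thetaR q x ^ 2 / thetaR q (-x) ^ 2

section ThetaQuot

variable {q x y : ℝ}

theorem sq_mul_thetaQuot (hq : q ∈ Set.Ioo (0 : ℝ) 1) (hx : 0 < x) :
    thetaR q (-x) ^ 2 * thetaQuot q x = thetaR q x ^ 2 :=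
  mul_div_cancel₀ _ (pow_ne_zero 2 (thetaR_neg_ne_zero_of_pos hq hx))

theorem thetaR_addition_neg (hq : q ∈ Set.Ioo (0 : ℝ) 1) (hx : 0 < x) (hy : 0 < y) :
    thetaR q (-1) ^ 2 * (thetaR q (-(x * y)) * thetaR q (-(x / y)) * y) =
      thetaR q (-x) ^ 2 * thetaR q (-y) ^ 2 * (1 - thetaQuot q x * thetaQuot q y) := by
  rw [thetaR_addition hq hx.ne' hy.ne', ← sq_mul_thetaQuot hq hx, ← sq_mul_thetaQuot hq hy]
  ring

theorem thetaR_addition_pos (hq : q ∈ Set.Ioo (0 : ℝ) 1) (hx : 0 < x) (hy : 0 < y) :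
    thetaR q (-1) ^ 2 * (thetaR q (x * y) * thetaR q (x / y) * y) =
      thetaR q (-x) ^ 2 * thetaR q (-y) ^ 2 * (thetaQuot q x - thetaQuot q y) := by
  have h := thetaR_addition hq (neg_ne_zero.2 hx.ne') hy.ne'
  rw [neg_mul, neg_neg, neg_div, neg_neg, neg_neg] at h
  rw [h, ← sq_mul_thetaQuot hq hx, ← sq_mul_thetaQuot hq hy]
  ring

theorem one_sub_thetaQuot_mul_ne_zero (hq : q ∈ Set.Ioo (0 : ℝ) 1) (hx : 0 < x) (hy : 0 < y) :
    1 - thetaQuot q x * thetaQuot q y ≠ 0 := by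
  intro h
  have := thetaR_addition_neg hq hx hy
  rw [h, mul_zero] at this
  exact mul_ne_zero (pow_ne_zero 2 (thetaR_neg_ne_zero_of_pos hq one_pos)) (mul_ne_zero (mul_ne_zero
    (thetaR_neg_ne_zero_of_pos hq (mul_pos hx hy))
    (thetaR_neg_ne_zero_of_pos hq (div_pos hx hy))) hy.ne') this

theorem thetaQuot_mul_mul_thetaQuot_div (hq : q ∈ Set.Ioo (0 : ℝ) 1) (hx : 0 < x) (hy : 0 < y) :
    thetaQuot q (x * y) * thetaQuot q (x / y) * (1 - thetaQuot q x * thetaQuot q y) ^ 2 =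
      (thetaQuot q x - thetaQuot q y) ^ 2 := by
  have h1 := thetaR_addition_neg hq hx hy
  have h2 := thetaR_addition_pos hq hx hy
  have a := sq_mul_thetaQuot hq (mul_pos hx hy)
  have b := sq_mul_thetaQuot hq (div_pos hx hy)
  have c : thetaR q (-x) ^ 2 * thetaR q (-y) ^ 2 ≠ 0 :=
    mul_ne_zero (pow_ne_zero 2 (thetaR_neg_ne_zero_of_pos hq hx))
      (pow_ne_zero 2 (thetaR_neg_ne_zero_of_pos hq hy))
  refine mul_left_cancel₀ (pow_ne_zero 2 c) ?_
  rw [← mul_pow _ (thetaQuot q x - thetaQuot q y), ← h2]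
  rw [mul_left_comm, ← mul_pow, ← h1]
  calc _ = (thetaR q (-1) ^ 2 * y) ^ 2 * (thetaR q (-(x * y)) ^ 2 * thetaQuot q (x * y)) *
        (thetaR q (-(x / y)) ^ 2 * thetaQuot q (x / y)) := by ring
    _ = _ := by rw [a, b]; ring

theorem thetaQuot_mul_nome (hq : q ∈ Set.Ioo (0 : ℝ) 1) (hx : 0 < x) :
    thetaQuot q (x * q) * (1 - thetaQuot q q * thetaQuot q x) =
      thetaQuot q q - thetaQuot q x := by
  have hq0 := hq.1.ne'
  have h1 := thetaR_addition_neg hq hx hq.1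
  have h2 := thetaR_addition_pos hq hx hq.1
  have a := sq_mul_thetaQuot hq (mul_pos hx hq.1)
  have s1 := thetaR_neg_sq_mul hq (div_ne_zero hx.ne' hq0)
  have s2 := thetaR_neg_sq_mul hq (neg_ne_zero.2 (div_ne_zero hx.ne' hq0))
  rw [show q ^ 2 * (x / q) = x * q by field_simp] at s1
  rw [show -(q ^ 2 * -(x / q)) = x * q by field_simp, neg_neg] at s2
  rw [← s1] at h1
  rw [← s2] at h2
  have c : thetaR q (-x) ^ 2 * thetaR q (-q) ^ 2 ≠ 0 :=
    mul_ne_zero (pow_ne_zero 2 (thetaR_neg_ne_zero_of_pos hq hx))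
      (pow_ne_zero 2 (thetaR_neg_ne_zero_of_pos hq hq.1))
  refine mul_left_cancel₀ c ?_
  linear_combination -thetaQuot q (x * q) * h1 - h2 +
    thetaR q (-1) ^ 2 * (x / q * q) * a

theorem thetaQuot_nome_ne_zero (hq : q ∈ Set.Ioo (0 : ℝ) 1) : thetaQuot q q ≠ 0 := by
  have h := thetaR_neg_ne_zero hq (thetaRegular_neg_self hq)
  rw [neg_neg] at h
  exact div_ne_zero (pow_ne_zero 2 h) (pow_ne_zero 2 (thetaR_neg_ne_zero_of_pos hq hq.1))

theorem thetaQuot_sq_ne_one (hq : q ∈ Set.Ioo (0 : ℝ) 1) (hx : 0 < x) :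
    1 - thetaQuot q x ^ 2 ≠ 0 := by
  rw [sq]
  exact one_sub_thetaQuot_mul_ne_zero hq hx hx

/-- The addition formula for `(θ(x) / θ(-x))²`. -/
theorem thetaQuot_mul_add_thetaQuot_div (hq : q ∈ Set.Ioo (0 : ℝ) 1) (hx : 0 < x) (hy : 0 < y) :
    thetaQuot q q * (thetaQuot q (x * y) + thetaQuot q (x / y)) *
        (1 - thetaQuot q x * thetaQuot q y) ^ 2 =
      2 * thetaQuot q q * (thetaQuot q x + thetaQuot q y) * (1 + thetaQuot q x * thetaQuot q y) -
        4 * (1 + thetaQuot q q ^ 2) * (thetaQuot q x * thetaQuot q y) := by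
  have h0 := thetaQuot_mul_mul_thetaQuot_div hq hx hy
  have h1 := thetaQuot_mul_mul_thetaQuot_div hq (mul_pos hx hq.1) hy
  rw [mul_right_comm x q y, mul_div_right_comm x q y] at h1
  have n1 := thetaQuot_mul_nome hq hx
  have n2 := thetaQuot_mul_nome hq (mul_pos hx hy)
  have n3 := thetaQuot_mul_nome hq (div_pos hx hy)
  have d1 := one_sub_thetaQuot_mul_ne_zero hq hq.1 hx
  have d2 := one_sub_thetaQuot_mul_ne_zero hq hq.1 (mul_pos hx hy)
  have d3 := one_sub_thetaQuot_mul_ne_zero hq hq.1 (div_pos hx hy)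
  have r1 := thetaQuot_sq_ne_one hq hq.1
  have r2 := thetaQuot_sq_ne_one hq hx
  have r3 := thetaQuot_sq_ne_one hq hy
  rw [eq_div_of_mul_eq d1 n1, eq_div_of_mul_eq d2 n2, eq_div_of_mul_eq d3 n3] at h1
  generalize thetaQuot q (x * y) = α at *
  generalize thetaQuot q (x / y) = β at *
  generalize thetaQuot q q = m at *
  generalize thetaQuot q x = X at *
  generalize thetaQuot q y = f at *
  have h2 : (m - α) * (m - β) * (1 - m * X - (m - X) * f) ^ 2 =
      (1 - m * α) * (1 - m * β) * (m - X - (1 - m * X) * f) ^ 2 := by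
    field_simp at h1
    linear_combination h1
  refine mul_left_cancel₀ (mul_ne_zero (mul_ne_zero r1 r2) r3) ?_
  linear_combination -(1 - X * f) ^ 2 * h2 + ((1 - m * X - (m - X) * f) ^ 2 -
    m ^ 2 * (m - X - (1 - m * X) * f) ^ 2) * h0

end ThetaQuot

section LongDistance

variable {q r : ℝ}

theorem tendsto_thetaQuot (hq : q ∈ Set.Ioo (0 : ℝ) 1) (hr : 0 < r) :
    Tendsto (thetaQuot q) (𝓝 r) (𝓝 (thetaQuot q r)) := by
  have h := (tendsto_thetaR_neg hq (neg_ne_zero.2 hr.ne')).comp (continuous_neg.tendsto r)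
  simp only [Function.comp_def, neg_neg] at h
  exact (h.pow 2).div ((tendsto_thetaR_neg hq hr.ne').pow 2)
    (pow_ne_zero 2 (thetaR_neg_ne_zero_of_pos hq hr))

theorem tendsto_thetaQuot_mul_pow (hq : q ∈ Set.Ioo (0 : ℝ) 1) (hr : 0 < r) (i : ℕ) :
    Tendsto (fun c : ℝ => thetaQuot q (r * c ^ i)) (𝓝[<] 1) (𝓝 (thetaQuot q r)) := by
  refine (tendsto_thetaQuot hq hr).comp (Tendsto.mono_left ?_ nhdsWithin_le_nhds)
  have : Continuous fun c : ℝ => r * c ^ i := by fun_prop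
  simpa using this.tendsto 1

theorem tendsto_thetaQuot_div_sq (hq : q ∈ Set.Ioo (0 : ℝ) 1) :
    Tendsto (fun c : ℝ => thetaQuot q c / (1 - c) ^ 2) (𝓝[<] 1) (𝓝 (thetaRatio q)) := by
  obtain ⟨H, hH, hH'⟩ := exists_thetaR_sq_expansion hq
  have ht1 : thetaR q (-1) ≠ 0 := thetaR_neg_ne_zero_of_pos hq one_pos
  have hle : 𝓝[<] (1 : ℝ) ≤ 𝓝[≠] 1 := nhdsWithin_mono _ fun c hc => ne_of_lt hc
  have h1 := (hH'.comp tendsto_add_inv_sub_two).mono_left hle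
  have h2 : Tendsto (fun c => thetaR q (-c) ^ 2) (𝓝[<] 1) (𝓝 (thetaR q (-1) ^ 2)) :=
    ((tendsto_thetaR_neg hq one_ne_zero).pow 2).mono_left nhdsWithin_le_nhds
  have h := (h1.const_mul (thetaR q (-1) ^ 2 * thetaRatio q)).div h2 (pow_ne_zero 2 ht1)
  rw [mul_one, mul_div_cancel_left₀ _ (pow_ne_zero 2 ht1)] at h
  refine h.congr' ?_
  filter_upwards [self_mem_nhdsWithin,
    nhdsWithin_le_nhds (lt_mem_nhds (zero_lt_one (α := ℝ)))] with c hc1 hc0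
  have hc : 1 - c ≠ 0 := (sub_pos.2 hc1).ne'
  have hc0' : c ≠ 0 := ne_of_gt hc0
  have b := hH c hc0'
  rw [div_eq_iff hc0'] at b
  simp only [Pi.div_apply, Function.comp_apply]
  rw [thetaQuot, b]
  have e : c + c⁻¹ - 2 = (1 - c) ^ 2 / c := by
    field_simp
    ring
  rw [e]
  generalize H ((1 - c) ^ 2 / c) = w
  field_simp

theorem Gt_mul_one_sub (hq : q ∈ Set.Ioo (0 : ℝ) 1) (hr : 0 < r) {c : ℝ} (hc : 0 < c) :
    Gt q r c * (1 - thetaQuot q c * thetaQuot q (r * c ^ 1)) =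
      (1 - thetaQuot q c * thetaQuot q (r * c ^ 2)) ^ 2 *
        (1 + thetaQuot q c * thetaQuot q (r * c ^ 3)) := by
  have h1 := thetaR_addition_neg hq (mul_pos hr (pow_pos hc 1)) hc
  have h2 := thetaR_addition_neg hq (mul_pos hr (pow_pos hc 2)) hc
  rw [show r * c ^ 1 * c = r * c ^ 2 by ring, show r * c ^ 1 / c = r by field_simp] at h1
  rw [show r * c ^ 2 * c = r * c ^ 3 by ring,
    show r * c ^ 2 / c = r * c ^ 1 by field_simp] at h2
  have t1 : thetaR q (-1) ≠ 0 := thetaR_neg_ne_zero_of_pos hq one_pos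
  have t2 := thetaR_neg_ne_zero_of_pos hq hr
  have t3 := thetaR_neg_ne_zero_of_pos hq hc
  have t4 := thetaR_neg_ne_zero_of_pos hq (mul_pos hr (pow_pos hc 1))
  have t5 := thetaR_neg_ne_zero_of_pos hq (mul_pos hr (pow_pos hc 2))
  have t6 := thetaR_neg_ne_zero_of_pos hq (mul_pos hr (pow_pos hc 3))
  have hGt : Gt q r c = c * thetaR q (-(r * c ^ 1)) ^ 4 * thetaR q (-1) ^ 2 *
      thetaR q (-(r * c ^ 3)) ^ 2 /
      (thetaR q (-r) * thetaR q (-c) ^ 2 * thetaR q (-(r * c ^ 2)) ^ 5) *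
      (1 + thetaQuot q c * thetaQuot q (r * c ^ 3)) := by
    rw [Gt, thetaQuot, thetaQuot, pow_one, neg_mul, neg_mul, neg_mul, div_mul_div_comm]
  rw [hGt, mul_right_comm]
  congr 1
  have e1 : 1 - thetaQuot q c * thetaQuot q (r * c ^ 1) =
      thetaR q (-1) ^ 2 * (thetaR q (-(r * c ^ 2)) * thetaR q (-r) * c) /
        (thetaR q (-(r * c ^ 1)) ^ 2 * thetaR q (-c) ^ 2) := by
    rw [h1, mul_div_cancel_left₀ _ (by positivity), mul_comm (thetaQuot q c)]
  have e2 : 1 - thetaQuot q c * thetaQuot q (r * c ^ 2) =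
      thetaR q (-1) ^ 2 * (thetaR q (-(r * c ^ 3)) * thetaR q (-(r * c ^ 1)) * c) /
        (thetaR q (-(r * c ^ 2)) ^ 2 * thetaR q (-c) ^ 2) := by
    rw [h2, mul_div_cancel_left₀ _ (by positivity), mul_comm (thetaQuot q c)]
  rw [e1, e2]
  field_simp

theorem Gt_sub_one (hq : q ∈ Set.Ioo (0 : ℝ) 1) (hr : 0 < r) {c : ℝ} (hc : 0 < c) :
    Gt q r c - 1 = thetaQuot q c ^ 2 *
      ((2 + 6 * thetaQuot q (r * c ^ 2) ^ 2 -
          4 * (thetaQuot q q + (thetaQuot q q)⁻¹) * thetaQuot q (r * c ^ 2) +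
          thetaQuot q c * (2 * thetaQuot q (r * c ^ 2) - 2 * thetaQuot q (r * c ^ 2) ^ 3)) /
          (1 - thetaQuot q c * thetaQuot q (r * c ^ 2)) ^ 2 +
        thetaQuot q (r * c ^ 2) ^ 2 - 2 * thetaQuot q (r * c ^ 2) * thetaQuot q (r * c ^ 3) +
        thetaQuot q c * (thetaQuot q (r * c ^ 2) ^ 2 * thetaQuot q (r * c ^ 3))) /
      (1 - thetaQuot q c * thetaQuot q (r * c ^ 1)) := by
  have h := Gt_mul_one_sub hq hr hc
  have hadd := thetaQuot_mul_add_thetaQuot_div hq (mul_pos hr (pow_pos hc 2)) hc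
  rw [show r * c ^ 2 * c = r * c ^ 3 by ring,
    show r * c ^ 2 / c = r * c ^ 1 by field_simp] at hadd
  have d1 := one_sub_thetaQuot_mul_ne_zero hq hc (mul_pos hr (pow_pos hc 1))
  have d2 := one_sub_thetaQuot_mul_ne_zero hq hc (mul_pos hr (pow_pos hc 2))
  have hm := thetaQuot_nome_ne_zero hq
  rw [eq_div_iff d1]
  generalize thetaQuot q c = f at *
  generalize thetaQuot q (r * c ^ 1) = x₁ at *
  generalize thetaQuot q (r * c ^ 2) = x₂ at *
  generalize thetaQuot q (r * c ^ 3) = x₃ at *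
  generalize thetaQuot q q = m at *
  have hmul : m * (1 - f * x₂) ^ 2 ≠ 0 := mul_ne_zero hm (pow_ne_zero 2 d2)
  have hs : x₁ + x₃ = 2 * x₂ + f * ((2 + 6 * x₂ ^ 2 - 4 * (m + m⁻¹) * x₂ +
      f * (2 * x₂ - 2 * x₂ ^ 3)) / (1 - f * x₂) ^ 2) := by
    refine mul_left_cancel₀ hmul ?_
    field_simp
    linear_combination hadd
  linear_combination h + f * hs

theorem kappa_eq (hq : q ∈ Set.Ioo (0 : ℝ) 1) (hr : 0 < r) :
    kappa q r = thetaRatio q ^ 2 * (2 + 5 * thetaQuot q r ^ 2 -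
      4 * (thetaQuot q q + (thetaQuot q q)⁻¹) * thetaQuot q r) := by
  have h0 := e1_add_e2_add_e3 hq
  have hm := thetaQuot_nome_ne_zero hq
  have hx : thetaRatio q * thetaQuot q r = e1 q - W q (-r) := by
    rw [thetaQuot, ← mul_div_assoc, thetaRatio_mul_sq hq (thetaRegular_of_pos hq hr),
      mul_div_cancel_right₀ _ (pow_ne_zero 2 (thetaR_neg_ne_zero_of_pos hq hr)), e1]
  have h2 : thetaRatio q * thetaQuot q q = e1 q - e2 q := by
    rw [thetaQuot, ← mul_div_assoc, thetaRatio_mul_sq hq (thetaRegular_of_pos hq hq.1),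
      mul_div_cancel_right₀ _ (pow_ne_zero 2 (thetaR_neg_ne_zero_of_pos hq hq.1)), e1, e2]
  have h3 : thetaRatio q * (thetaQuot q q)⁻¹ = e1 q - e3 q := by
    have h := thetaRatio_mul_sq hq (thetaRegular_neg_self hq)
    have hne := thetaR_neg_ne_zero hq (thetaRegular_neg_self hq)
    rw [neg_neg] at h hne
    rw [thetaQuot, inv_div, ← mul_div_assoc, h, mul_div_cancel_right₀ _ (pow_ne_zero 2 hne),
      e1, e3]
  have hK : thetaRatio q ^ 2 = (e1 q - e2 q) * (e1 q - e3 q) := by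
    rw [← h2, ← h3]
    field_simp
  have hw : W q (-r) = e1 q - thetaRatio q * thetaQuot q r := by rw [hx]; ring
  rw [kappa, g2, hw]
  linear_combination 4 * thetaRatio q * thetaQuot q r * (h2 + h3) - 2 * hK +
    (3 * e1 q - e2 q - e3 q - 4 * thetaRatio q * thetaQuot q r) * h0

end LongDistance

theorem long_distance_decay (q r : ℝ) (hq : q ∈ Set.Ioo (0 : ℝ) 1) (hr : 0 < r) :
    Filter.Tendsto (fun c : ℝ => (Gt q r c - 1) / (1 - c) ^ 4)
      (nhdsWithin 1 (Set.Iio 1)) (nhds (kappa q r)) := by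
  have h1 := tendsto_thetaQuot_mul_pow hq hr 1
  have h2 := tendsto_thetaQuot_mul_pow hq hr 2
  have h3 := tendsto_thetaQuot_mul_pow hq hr 3
  have hK := tendsto_thetaQuot_div_sq hq
  have hf : Tendsto (thetaQuot q) (𝓝[<] 1) (𝓝 0) := by
    have h := (tendsto_thetaQuot hq one_pos).mono_left (nhdsWithin_le_nhds (s := Set.Iio 1))
    rwa [thetaQuot, thetaR_one hq, zero_pow two_ne_zero, zero_div] at h
  have d1 := (hf.mul h1).const_sub 1
  have d2 := ((hf.mul h2).const_sub 1).pow 2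
  have hnum := ((((h2.pow 2).const_mul 6).const_add 2).sub
    (h2.const_mul (4 * (thetaQuot q q + (thetaQuot q q)⁻¹)))).add
    (hf.mul ((h2.const_mul 2).sub ((h2.pow 3).const_mul 2)))
  have h := ((hK.pow 2).mul ((((hnum.div d2 (by norm_num)).add (h2.pow 2)).sub
    ((h2.const_mul 2).mul h3)).add (hf.mul ((h2.pow 2).mul h3)))).div d1 (by norm_num)
  rw [kappa_eq hq hr]
  convert! h.congr' ?_ using 2
  · ring
  · filter_upwards [self_mem_nhdsWithin,
      nhdsWithin_le_nhds (lt_mem_nhds (zero_lt_one (α := ℝ)))] with c hc1 hc0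
    have hc : 1 - c ≠ 0 := (sub_pos.2 hc1).ne'
    rw [Gt_sub_one hq hr hc0]
    simp only [Pi.div_apply]
    generalize (2 + 6 * thetaQuot q (r * c ^ 2) ^ 2 - _ + _) / _ = w
    rw [div_pow, ← pow_mul]
    field_simp
end
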